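/- arXiv:2001.03265 — 2 statements merged into one kernel-verified Lean document; each statement's English description precedes it below -/
import Mathlib

section
/- Let α, β, u be complex numbers with Re α > −1/2, Re β > −1/2, Re(α + β) > −1 and |u| < q^{min(0, Re α, Re β)}. Then all sums below over monic irreducible P of F_q[t] converge absolutely, and ∑_{k,l ≥ 0} ∑_P d(P)² u^{2(k+l+1) d(P)} |P|^{−(1+α+β) − k(1+2α) − l(1+2β)} (1 − 1/(|P|+1)) − ∑_P d(P)² y_P/(1 − y_P)² = ∑_P d(P)² |P|^{2+α+β} u^{4 d(P)} (|P|^α − |P|^β)² / ( (|P|^{1+2α} − u^{2 d(P)}) (|P|^{1+2β} − u^{2 d(P)}) (|P|^{1+α+β} − u^{2 d(P)})² ) − ∑_P d(P)² |P|^{1+α+β} u^{2 d(P)} / ( (|P|^{1+2α} − u^{2 d(P)}) (|P|^{1+2β} − u^{2 d(P)}) (|P| + 1) ), where y_P = u^{2 d(P)} / |P|^{1+α+β}. -/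
open Polynomial

noncomputable section

/-- The monic irreducible polynomials of `F_q[t]`. -/
abbrev MonicIrr (q : ℕ) := {P : Polynomial (ZMod q) // P.Monic ∧ Irreducible P}

/-- The general term
`d(P)² u^{2(k+l+1)d(P)} |P|^{-(1+α+β) - k(1+2α) - l(1+2β)} (1 - 1/(|P|+1))`
of the odd-odd equal-prime diagonal sum, indexed by `k = x.1`, `l = x.2.1`, `P = x.2.2`. -/
def ooTerm (q : ℕ) (u α β : ℂ) (x : ℕ × ℕ × MonicIrr q) : ℂ :=
  (x.2.2.1.natDegree : ℂ) ^ 2 * u ^ (2 * (x.1 + x.2.1 + 1) * x.2.2.1.natDegree) *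
    (q : ℂ) ^ ((x.2.2.1.natDegree : ℂ) *
      (-(1 + α + β) - (x.1 : ℂ) * (1 + 2 * α) - (x.2.1 : ℂ) * (1 + 2 * β))) *
    (1 - 1 / ((q : ℂ) ^ x.2.2.1.natDegree + 1))

/-- `y_P = u^{2d(P)} / |P|^{1+α+β}`. -/
def yP (q : ℕ) (u α β : ℂ) (P : MonicIrr q) : ℂ :=
  u ^ (2 * P.1.natDegree) / (q : ℂ) ^ ((P.1.natDegree : ℂ) * (1 + α + β))

/-- The subtracted term `d(P)² y_P / (1 - y_P)²`. -/
def ooSubTerm (q : ℕ) (u α β : ℂ) (P : MonicIrr q) : ℂ :=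
  (P.1.natDegree : ℂ) ^ 2 * yP q u α β P / (1 - yP q u α β P) ^ 2

/-- The first right-hand-side term: `d(P)² |P|^{2+α+β} u^{4d(P)} (|P|^α - |P|^β)²
/ ((|P|^{1+2α} - u^{2d(P)})(|P|^{1+2β} - u^{2d(P)})(|P|^{1+α+β} - u^{2d(P)})²)`. -/
def ooRHS1 (q : ℕ) (u α β : ℂ) (P : MonicIrr q) : ℂ :=
  (P.1.natDegree : ℂ) ^ 2 * (q : ℂ) ^ ((P.1.natDegree : ℂ) * (2 + α + β)) *
    u ^ (4 * P.1.natDegree) *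
    ((q : ℂ) ^ ((P.1.natDegree : ℂ) * α) - (q : ℂ) ^ ((P.1.natDegree : ℂ) * β)) ^ 2 /
    (((q : ℂ) ^ ((P.1.natDegree : ℂ) * (1 + 2 * α)) - u ^ (2 * P.1.natDegree)) *
      ((q : ℂ) ^ ((P.1.natDegree : ℂ) * (1 + 2 * β)) - u ^ (2 * P.1.natDegree)) *
      ((q : ℂ) ^ ((P.1.natDegree : ℂ) * (1 + α + β)) - u ^ (2 * P.1.natDegree)) ^ 2)

/-- The second right-hand-side term: `d(P)² |P|^{1+α+β} u^{2d(P)}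
/ ((|P|^{1+2α} - u^{2d(P)})(|P|^{1+2β} - u^{2d(P)})(|P|+1))`. -/
def ooRHS2 (q : ℕ) (u α β : ℂ) (P : MonicIrr q) : ℂ :=
  (P.1.natDegree : ℂ) ^ 2 * (q : ℂ) ^ ((P.1.natDegree : ℂ) * (1 + α + β)) *
    u ^ (2 * P.1.natDegree) /
    (((q : ℂ) ^ ((P.1.natDegree : ℂ) * (1 + 2 * α)) - u ^ (2 * P.1.natDegree)) *
      ((q : ℂ) ^ ((P.1.natDegree : ℂ) * (1 + 2 * β)) - u ^ (2 * P.1.natDegree)) *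
      ((q : ℂ) ^ P.1.natDegree + 1))

lemma summable_natDegree_monicIrr {q : ℕ} (hq : q.Prime) {w : ℕ → ℝ} (hw : ∀ d, 0 ≤ w d)
    (hs : Summable fun d => (q : ℝ) ^ d * w d) :
    Summable fun P : MonicIrr q => w P.1.natDegree := by
  have : Fact q.Prime := ⟨hq⟩
  have h1 : Summable fun x : (Σ d : ℕ, (Fin d → ZMod q)) => w x.1 := by
    rw [summable_sigma_of_nonneg fun x => hw x.1]
    refine ⟨fun d => Summable.of_finite, ?_⟩
    simpa [tsum_fintype, ZMod.card] using hs
  refine h1.comp_injective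
    (i := fun P : MonicIrr q => ⟨P.1.natDegree, fun i => P.1.coeff i⟩) ?_
  rintro ⟨P, hP, hP'⟩ ⟨Q, hQ, hQ'⟩ h
  simp only [Sigma.mk.injEq] at h
  obtain ⟨hd, hc⟩ := h
  refine Subtype.ext (Polynomial.ext fun i => ?_)
  dsimp only
  rcases lt_trichotomy i P.natDegree with hi | hi | hi
  · have key : ∀ m n : ℕ, m = n → ∀ (f : Fin m → ZMod q) (g : Fin n → ZMod q), HEq f g →
        ∀ (hm : i < m) (hn : i < n), f ⟨i, hm⟩ = g ⟨i, hn⟩ := by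
      rintro m n rfl f g hfg hm hn
      rw [eq_of_heq hfg]
    exact key _ _ hd _ _ hc hi (hd ▸ hi)
  · rw [hi, hP.coeff_natDegree, hd, hQ.coeff_natDegree]
  · rw [coeff_eq_zero_of_natDegree_lt hi, coeff_eq_zero_of_natDegree_lt (hd ▸ hi)]

lemma norm_inv_one_sub_le_two {z : ℂ} (hz : ‖z‖ ≤ 1 / 2) : ‖(1 - z)⁻¹‖ ≤ 2 := by
  have h : 1 / 2 ≤ ‖1 - z‖ := by
    have := norm_sub_norm_le (1 : ℂ) z
    rw [norm_one] at this
    linarith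
  rw [norm_inv, inv_le_comm₀ (by linarith) two_pos]
  linarith

/-- The powers of `|P|` in the statement are products of powers of `|P|`, `|P|^α`, `|P|^β`. -/
lemma cpow_degree_formulas {q : ℕ} (hq : q ≠ 0) (α β : ℂ) (d k l : ℕ) :
    (q : ℂ) ^ ((d : ℂ) * (1 + 2 * α)) = (q : ℂ) ^ d * ((q : ℂ) ^ ((d : ℂ) * α)) ^ 2 ∧
    (q : ℂ) ^ ((d : ℂ) * (1 + 2 * β)) = (q : ℂ) ^ d * ((q : ℂ) ^ ((d : ℂ) * β)) ^ 2 ∧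
    (q : ℂ) ^ ((d : ℂ) * (1 + α + β)) =
      (q : ℂ) ^ d * (q : ℂ) ^ ((d : ℂ) * α) * (q : ℂ) ^ ((d : ℂ) * β) ∧
    (q : ℂ) ^ ((d : ℂ) * (2 + α + β)) =
      ((q : ℂ) ^ d) ^ 2 * (q : ℂ) ^ ((d : ℂ) * α) * (q : ℂ) ^ ((d : ℂ) * β) ∧
    (q : ℂ) ^ ((d : ℂ) * (-(1 + α + β) - (k : ℂ) * (1 + 2 * α) - (l : ℂ) * (1 + 2 * β))) =
      ((q : ℂ) ^ d * (q : ℂ) ^ ((d : ℂ) * α) * (q : ℂ) ^ ((d : ℂ) * β))⁻¹ *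
        (((q : ℂ) ^ d * ((q : ℂ) ^ ((d : ℂ) * α)) ^ 2)⁻¹) ^ k *
        (((q : ℂ) ^ d * ((q : ℂ) ^ ((d : ℂ) * β)) ^ 2)⁻¹) ^ l := by
  have hq0 : (q : ℂ) ≠ 0 := Nat.cast_ne_zero.2 hq
  rw [← Complex.cpow_natCast (q : ℂ) d]
  simp only [← Complex.cpow_nat_mul, ← Complex.cpow_add _ _ hq0, ← Complex.cpow_neg]
  refine ⟨?_, ?_, ?_, ?_, ?_⟩ <;> congr 1 <;> push_cast <;> ring

lemma norm_natCast_cpow_natCast_mul {q : ℕ} (hq : 0 < q) (d : ℕ) (s : ℂ) :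
    ‖(q : ℂ) ^ ((d : ℂ) * s)‖ = ((q : ℝ) ^ s.re) ^ d := by
  rw [Complex.cpow_nat_mul, norm_pow, Complex.norm_natCast_cpow_of_pos hq]

/-- Size estimates for the quotients `u^{2d(P)} / |P|^{1+2s}`. -/
lemma norm_div_le_half {q : ℕ} (hq : q.Prime) {u s : ℂ} (hu : ‖u‖ < (q : ℝ) ^ s.re)
    {d : ℕ} (hd : 0 < d) :
    ‖u ^ (2 * d) / ((q : ℂ) ^ d * ((q : ℂ) ^ ((d : ℂ) * s)) ^ 2)‖ ≤ 1 / 2 := by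
  have hx := norm_natCast_cpow_natCast_mul hq.pos d s
  have hpos : 0 < ((q : ℝ) ^ s.re) ^ d :=
    pow_pos (Real.rpow_pos_of_pos (Nat.cast_pos.2 hq.pos) _) _
  have h1 : ‖u‖ ^ d ≤ ((q : ℝ) ^ s.re) ^ d := pow_le_pow_left₀ (norm_nonneg _) hu.le d
  have h2 : (2 : ℝ) ≤ (q : ℝ) ^ d := by
    calc (2 : ℝ) ≤ q := by exact_mod_cast hq.two_le
      _ ≤ (q : ℝ) ^ d := le_self_pow₀ (by exact_mod_cast hq.one_le) hd.ne'
  rw [norm_div, norm_mul, norm_pow, norm_pow, norm_pow, hx, Complex.norm_natCast, mul_comm 2 d,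
    pow_mul, div_le_div_iff₀ (by positivity) two_pos]
  have h3 : (‖u‖ ^ d) ^ 2 ≤ (((q : ℝ) ^ s.re) ^ d) ^ 2 := pow_le_pow_left₀ (by positivity) h1 2
  nlinarith [sq_nonneg (((q : ℝ) ^ s.re) ^ d)]

lemma norm_yP {q : ℕ} (hq : q.Prime) (u α β : ℂ) (P : MonicIrr q) :
    ‖yP q u α β P‖ = (‖u‖ ^ 2 / (q : ℝ) ^ (1 + α.re + β.re)) ^ P.1.natDegree := by
  rw [yP, norm_div, norm_pow, norm_natCast_cpow_natCast_mul hq.pos, pow_mul, div_pow]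
  simp

lemma norm_sq_div_lt {q : ℕ} (hq : q.Prime) {u α β : ℂ} (hα : ‖u‖ < (q : ℝ) ^ α.re)
    (hβ : ‖u‖ < (q : ℝ) ^ β.re) :
    ‖u‖ ^ 2 / (q : ℝ) ^ (1 + α.re + β.re) < (q : ℝ)⁻¹ := by
  have hq0 : (0 : ℝ) < q := Nat.cast_pos.2 hq.pos
  have h : ‖u‖ * ‖u‖ < (q : ℝ) ^ α.re * (q : ℝ) ^ β.re :=
    mul_lt_mul'' hα hβ (norm_nonneg _) (norm_nonneg _)
  rw [Real.rpow_add hq0, Real.rpow_add hq0, Real.rpow_one, div_lt_iff₀ (by positivity)]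
  calc ‖u‖ ^ 2 = ‖u‖ * ‖u‖ := sq _
    _ < _ := h
    _ = _ := by field_simp

lemma summable_sq_natDegree_mul_norm_yP {q : ℕ} (hq : q.Prime) {u α β : ℂ}
    (hα : ‖u‖ < (q : ℝ) ^ α.re) (hβ : ‖u‖ < (q : ℝ) ^ β.re) :
    Summable fun P : MonicIrr q => (P.1.natDegree : ℝ) ^ 2 * ‖yP q u α β P‖ := by
  have hq0 : (0 : ℝ) < q := Nat.cast_pos.2 hq.pos
  simp only [norm_yP hq]
  have hr := norm_sq_div_lt hq hα hβ
  have hr0 : 0 ≤ ‖u‖ ^ 2 / (q : ℝ) ^ (1 + α.re + β.re) := by positivity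
  set r := ‖u‖ ^ 2 / (q : ℝ) ^ (1 + α.re + β.re)
  refine summable_natDegree_monicIrr hq (w := fun d => (d : ℝ) ^ 2 * r ^ d)
    (fun d => by positivity) ?_
  have hqr : ‖(q : ℝ) * r‖ < 1 := by
    rw [Real.norm_of_nonneg (by positivity)]
    calc (q : ℝ) * r < q * (q : ℝ)⁻¹ := mul_lt_mul_of_pos_left hr hq0
      _ = 1 := mul_inv_cancel₀ hq0.ne'
  refine (summable_pow_mul_geometric_of_norm_lt_one 2 hqr).congr fun d => ?_
  rw [mul_pow]
  ring

lemma norm_yP_le_half {q : ℕ} (hq : q.Prime) {u α β : ℂ} (hα : ‖u‖ < (q : ℝ) ^ α.re)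
    (hβ : ‖u‖ < (q : ℝ) ^ β.re) (P : MonicIrr q) : ‖yP q u α β P‖ ≤ 1 / 2 := by
  have hq2 : (2 : ℝ) ≤ q := by exact_mod_cast hq.two_le
  have hr : ‖u‖ ^ 2 / (q : ℝ) ^ (1 + α.re + β.re) ≤ 1 / 2 := by
    refine (norm_sq_div_lt hq hα hβ).le.trans ?_
    rw [one_div]
    exact inv_anti₀ two_pos hq2
  have hr0 : 0 ≤ ‖u‖ ^ 2 / (q : ℝ) ^ (1 + α.re + β.re) := by positivity
  have : Fact q.Prime := ⟨hq⟩
  rw [norm_yP hq]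
  exact (pow_le_of_le_one hr0 (by linarith) P.2.2.natDegree_pos.ne').trans hr

/-- The quotient `u^{2d(P)} / |P|^{1+2s}`. -/
def primeRatio (q : ℕ) (u s : ℂ) (P : MonicIrr q) : ℂ :=
  u ^ (2 * P.1.natDegree) /
    ((q : ℂ) ^ P.1.natDegree * ((q : ℂ) ^ ((P.1.natDegree : ℂ) * s)) ^ 2)

lemma norm_primeRatio_le_half {q : ℕ} (hq : q.Prime) {u s : ℂ} (hu : ‖u‖ < (q : ℝ) ^ s.re)
    (P : MonicIrr q) : ‖primeRatio q u s P‖ ≤ 1 / 2 :=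
  have : Fact q.Prime := ⟨hq⟩
  norm_div_le_half hq hu P.2.2.natDegree_pos

lemma ooTerm_eq {q : ℕ} (hq : q ≠ 0) (u α β : ℂ) (k l : ℕ) (P : MonicIrr q) :
    ooTerm q u α β (k, l, P) =
      (P.1.natDegree : ℂ) ^ 2 * yP q u α β P * (1 - 1 / ((q : ℂ) ^ P.1.natDegree + 1)) *
        (primeRatio q u α P ^ k * primeRatio q u β P ^ l) := by
  obtain ⟨-, -, hC, -, hE⟩ := cpow_degree_formulas hq α β P.1.natDegree k l
  simp only [ooTerm, yP, primeRatio, hC, hE]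
  rw [show 2 * (k + l + 1) * P.1.natDegree =
    2 * P.1.natDegree + 2 * P.1.natDegree * k + 2 * P.1.natDegree * l by ring, pow_add, pow_add,
    pow_mul u _ k, pow_mul u _ l]
  simp only [div_eq_mul_inv, mul_pow]
  ring

lemma norm_inv_natCast_pow_add_one_le (q d : ℕ) : ‖((q : ℂ) ^ d + 1)⁻¹‖ ≤ 1 := by
  rw [norm_inv]
  apply inv_le_one_of_one_le₀
  rw [show (q : ℂ) ^ d + 1 = ((q ^ d + 1 : ℕ) : ℂ) by push_cast; rfl, Complex.norm_natCast]
  exact_mod_cast Nat.le_add_left 1 _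

lemma norm_one_sub_inv_natCast_pow_add_one_le (q d : ℕ) :
    ‖1 - 1 / ((q : ℂ) ^ d + 1)‖ ≤ 2 := by
  refine (norm_sub_le _ _).trans ?_
  rw [norm_one, one_div]
  linarith [norm_inv_natCast_pow_add_one_le q d]

lemma summable_ooTerm {q : ℕ} (hq : q.Prime) {u α β : ℂ} (hα : ‖u‖ < (q : ℝ) ^ α.re)
    (hβ : ‖u‖ < (q : ℝ) ^ β.re) : Summable (ooTerm q u α β) := by
  have hg : Summable fun k : ℕ => (1 / 2 : ℝ) ^ k := summable_geometric_two
  have hy := (summable_sq_natDegree_mul_norm_yP hq hα hβ).mul_left 2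
  have h := hg.mul_of_nonneg (hg.mul_of_nonneg hy (fun _ => by positivity)
    (fun _ => by positivity)) (fun _ => by positivity) (fun _ => by positivity)
  refine Summable.of_norm_bounded h ?_
  rintro ⟨k, l, P⟩
  rw [ooTerm_eq hq.ne_zero]
  simp only [norm_mul, norm_pow, Complex.norm_natCast]
  have h1 := pow_le_pow_left₀ (norm_nonneg _) (norm_primeRatio_le_half hq hα P) k
  have h2 := pow_le_pow_left₀ (norm_nonneg _) (norm_primeRatio_le_half hq hβ P) l
  have h3 := norm_one_sub_inv_natCast_pow_add_one_le q P.1.natDegree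
  calc _ ≤ (P.1.natDegree : ℝ) ^ 2 * ‖yP q u α β P‖ * 2 * ((1 / 2) ^ k * (1 / 2) ^ l) := by
        gcongr
    _ = _ := by ring

lemma hasSum_ooTerm_fiber {q : ℕ} (hq : q.Prime) {u α β : ℂ} (hα : ‖u‖ < (q : ℝ) ^ α.re)
    (hβ : ‖u‖ < (q : ℝ) ^ β.re) (P : MonicIrr q) :
    HasSum (fun x : ℕ × ℕ => ooTerm q u α β (x.1, x.2, P))
      ((P.1.natDegree : ℂ) ^ 2 * yP q u α β P * (1 - 1 / ((q : ℂ) ^ P.1.natDegree + 1)) *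
        ((1 - primeRatio q u α P)⁻¹ * (1 - primeRatio q u β P)⁻¹)) := by
  have h1 : ‖primeRatio q u α P‖ < 1 := by linarith [norm_primeRatio_le_half hq hα P]
  have h2 : ‖primeRatio q u β P‖ < 1 := by linarith [norm_primeRatio_le_half hq hβ P]
  simp only [ooTerm_eq hq.ne_zero]
  refine HasSum.mul_left _ ?_
  exact (hasSum_geometric_of_norm_lt_one h1).mul (hasSum_geometric_of_norm_lt_one h2)
    (summable_mul_of_summable_norm (summable_norm_geometric_of_norm_lt_one h1)
      (summable_norm_geometric_of_norm_lt_one h2))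

lemma summable_ooSubTerm {q : ℕ} (hq : q.Prime) {u α β : ℂ} (hα : ‖u‖ < (q : ℝ) ^ α.re)
    (hβ : ‖u‖ < (q : ℝ) ^ β.re) : Summable (ooSubTerm q u α β) := by
  refine Summable.of_norm_bounded
    ((summable_sq_natDegree_mul_norm_yP hq hα hβ).mul_right (2 ^ 2)) fun P => ?_
  have h := norm_inv_one_sub_le_two (norm_yP_le_half hq hα hβ P)
  rw [ooSubTerm, div_eq_mul_inv, ← inv_pow, norm_mul, norm_mul, norm_pow, norm_pow,
    Complex.norm_natCast]
  gcongr

lemma one_sub_ne_zero_of_norm_le_half {z : ℂ} (hz : ‖z‖ ≤ 1 / 2) : 1 - z ≠ 0 := by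
  intro h
  rw [← sub_eq_zero.1 h, norm_one] at hz
  norm_num at hz

lemma ooRHS2_eq {q : ℕ} (hq : q.Prime) (u α β : ℂ) (P : MonicIrr q) :
    ooRHS2 q u α β P = (P.1.natDegree : ℂ) ^ 2 * yP q u α β P *
      ((1 - primeRatio q u α P)⁻¹ * (1 - primeRatio q u β P)⁻¹) *
        ((q : ℂ) ^ P.1.natDegree + 1)⁻¹ := by
  obtain ⟨hA, hB, hC, -, -⟩ := cpow_degree_formulas hq.ne_zero α β P.1.natDegree 0 0
  have hq0 : (q : ℂ) ≠ 0 := Nat.cast_ne_zero.2 hq.ne_zero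
  have hx : (q : ℂ) ^ ((P.1.natDegree : ℂ) * α) ≠ 0 := by simp [Complex.cpow_eq_zero_iff, hq0]
  have hy : (q : ℂ) ^ ((P.1.natDegree : ℂ) * β) ≠ 0 := by simp [Complex.cpow_eq_zero_iff, hq0]
  have hn : (q : ℂ) ^ P.1.natDegree ≠ 0 := pow_ne_zero _ hq0
  simp only [ooRHS2, yP, primeRatio, hA, hB, hC]
  generalize (q : ℂ) ^ ((P.1.natDegree : ℂ) * α) = x at *
  generalize (q : ℂ) ^ ((P.1.natDegree : ℂ) * β) = y at *
  generalize (q : ℂ) ^ P.1.natDegree = n at *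
  generalize u ^ (2 * P.1.natDegree) = U at *
  rw [one_sub_div (by positivity), one_sub_div (by positivity), inv_div, inv_div]
  simp only [div_eq_mul_inv, mul_inv]
  field_simp

lemma summable_ooRHS2 {q : ℕ} (hq : q.Prime) {u α β : ℂ} (hα : ‖u‖ < (q : ℝ) ^ α.re)
    (hβ : ‖u‖ < (q : ℝ) ^ β.re) : Summable (ooRHS2 q u α β) := by
  refine Summable.of_norm_bounded
    ((summable_sq_natDegree_mul_norm_yP hq hα hβ).mul_right (2 * 2 * 1)) fun P => ?_
  have h1 := norm_inv_one_sub_le_two (norm_primeRatio_le_half hq hα P)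
  have h2 := norm_inv_one_sub_le_two (norm_primeRatio_le_half hq hβ P)
  have h3 := norm_inv_natCast_pow_add_one_le q P.1.natDegree
  rw [ooRHS2_eq hq, mul_assoc _ (_ * _) (_⁻¹)]
  simp only [norm_mul, norm_pow, Complex.norm_natCast]
  gcongr

lemma ooRHS1_eq {q : ℕ} (hq : q.Prime) {u α β : ℂ} (hα : ‖u‖ < (q : ℝ) ^ α.re)
    (hβ : ‖u‖ < (q : ℝ) ^ β.re) (P : MonicIrr q) :
    ooRHS1 q u α β P = (P.1.natDegree : ℂ) ^ 2 * yP q u α β P *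
      (1 - 1 / ((q : ℂ) ^ P.1.natDegree + 1)) *
        ((1 - primeRatio q u α P)⁻¹ * (1 - primeRatio q u β P)⁻¹) -
          ooSubTerm q u α β P + ooRHS2 q u α β P := by
  rw [ooRHS2_eq hq]
  obtain ⟨hA, hB, hC, hD, -⟩ := cpow_degree_formulas hq.ne_zero α β P.1.natDegree 0 0
  have hq0 : (q : ℂ) ≠ 0 := Nat.cast_ne_zero.2 hq.ne_zero
  have hx : (q : ℂ) ^ ((P.1.natDegree : ℂ) * α) ≠ 0 := by simp [Complex.cpow_eq_zero_iff, hq0]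
  have hy : (q : ℂ) ^ ((P.1.natDegree : ℂ) * β) ≠ 0 := by simp [Complex.cpow_eq_zero_iff, hq0]
  have hn : (q : ℂ) ^ P.1.natDegree ≠ 0 := pow_ne_zero _ hq0
  have h1 := one_sub_ne_zero_of_norm_le_half (norm_primeRatio_le_half hq hα P)
  have h2 := one_sub_ne_zero_of_norm_le_half (norm_primeRatio_le_half hq hβ P)
  have h3 := one_sub_ne_zero_of_norm_le_half (norm_yP_le_half hq hα hβ P)
  have hU : u ^ (4 * P.1.natDegree) = (u ^ (2 * P.1.natDegree)) ^ 2 := by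
    rw [← pow_mul]; congr 1; ring
  simp only [ooRHS1, ooSubTerm, yP, primeRatio, hA, hB, hC, hD, hU] at h1 h2 h3 ⊢
  generalize (q : ℂ) ^ ((P.1.natDegree : ℂ) * α) = x at *
  generalize (q : ℂ) ^ ((P.1.natDegree : ℂ) * β) = y at *
  generalize (q : ℂ) ^ P.1.natDegree = n at *
  generalize u ^ (2 * P.1.natDegree) = U at *
  rw [one_sub_div (by positivity)] at h1 h2 h3
  have h1' := (div_ne_zero_iff.1 h1).1
  have h2' := (div_ne_zero_iff.1 h2).1
  have h3' := (div_ne_zero_iff.1 h3).1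
  rw [one_div, one_sub_div (by positivity : n * x ^ 2 ≠ 0),
    one_sub_div (by positivity : n * y ^ 2 ≠ 0), one_sub_div (by positivity : n * x * y ≠ 0),
    inv_div, inv_div]
  generalize (n + 1)⁻¹ = e
  field_simp
  ring

/-- the odd-odd equal-prime diagonal of the two level density:
for `Re α, Re β > -1/2`, `Re(α+β) > -1` and `|u| < q^{min(0, Re α, Re β)}`, all sums
below converge absolutely, and
`∑_{k,l≥0} ∑_P d(P)² u^{2(k+l+1)d(P)} |P|^{-(1+α+β)-k(1+2α)-l(1+2β)} (1 - 1/(|P|+1))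
  - ∑_P d(P)² y_P/(1-y_P)² = ∑_P ooRHS1 - ∑_P ooRHS2`. -/
theorem statement16 (q : ℕ) (hq : q.Prime) (α β u : ℂ)
    (hα : -(1 / 2) < α.re) (hβ : -(1 / 2) < β.re) (hαβ : -1 < (α + β).re)
    (hu : ‖u‖ < (q : ℝ) ^ (min (min 0 α.re) β.re)) :
    Summable (ooTerm q u α β) ∧ Summable (ooSubTerm q u α β) ∧
      Summable (ooRHS1 q u α β) ∧ Summable (ooRHS2 q u α β) ∧
      (∑' x : ℕ × ℕ × MonicIrr q, ooTerm q u α β x)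
          - (∑' P : MonicIrr q, ooSubTerm q u α β P)
        = (∑' P : MonicIrr q, ooRHS1 q u α β P) - ∑' P : MonicIrr q, ooRHS2 q u α β P := by
  have hq1 : (1 : ℝ) ≤ q := by exact_mod_cast hq.one_le
  have huα : ‖u‖ < (q : ℝ) ^ α.re := hu.trans_le
    (Real.rpow_le_rpow_of_exponent_le hq1 ((min_le_left _ _).trans (min_le_right _ _)))
  have huβ : ‖u‖ < (q : ℝ) ^ β.re := hu.trans_le
    (Real.rpow_le_rpow_of_exponent_le hq1 (min_le_right _ _))
  have hT := summable_ooTerm hq huα huβ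
  have hS := summable_ooSubTerm hq huα huβ
  have hR := summable_ooRHS2 hq huα huβ
  have hF := (((Equiv.prodComm (MonicIrr q) (ℕ × ℕ)).trans
    (Equiv.prodAssoc ℕ ℕ (MonicIrr q))).hasSum_iff.2 hT.hasSum).prod_fiberwise
      (hasSum_ooTerm_fiber hq huα huβ)
  have hR1 := (hF.sub hS.hasSum).add hR.hasSum
  simp only [← ooRHS1_eq hq huα huβ] at hR1
  refine ⟨hT, hS, hR1.summable, hR, ?_⟩
  rw [hR1.tsum_eq]
  ring
end
end

section
/- Define I_{2,=}^{oo}(N; α, β) = (1/#H_{2g+1}) ∑_{D ∈ H_{2g+1}} ∑ d(P)² χ_D(P^{2k+1} Q^{2l+1}) / ( |P|^{(2k+1)(1/2+α)} |Q|^{(2l+1)(1/2+β)} ), the inner sum running over distinct monic irreducibles P ≠ Q with d(P) = d(Q) and integers k, l ≥ 0 with (2k+1)d(P) + (2l+1)d(Q) ≤ N. Then there is a constant C(q) such that for all integers g ≥ 1 and 1 ≤ N < 4g, and all complex α, β with |α|, |β| ≤ 1/g, | I_{2,=}^{oo}(N; α, β) − ( − ∑_{g < n ≤ ⌊N/2⌋}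 q^{−n(α+β)} + 1_{N ≥ 2g} · q^{−g(α+β)}/(q − 1) ) | ≤ C(q) ( N² q^{N/2 − 2g} + g q^{−g/2} ), where 1_{N ≥ 2g} is 1 if N ≥ 2g and 0 otherwise. -/
open Polynomial UniqueFactorizationMonoid
open scoped Classical

noncomputable section

/-- The quadratic residue symbol `(a/P)` for `P` a monic irreducible polynomial:
`0` if `P ∣ a`, `1` if `a` is a nonzero square mod `P`, `-1` otherwise. -/
def resSym (q : ℕ) (a P : Polynomial (ZMod q)) : ℤ :=
  if P ∣ a then 0 else if ∃ b : Polynomial (ZMod q), P ∣ (a - b ^ 2) then 1 else -1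

/-- The symbol `(a/b)`, extended multiplicatively over the monic irreducible factors
of `b` (with multiplicity); by convention `(a/0) = 0`.  In particular `χ_D(f) = (D/f)`
is `jacSym q D f`, and `χ_f(h) = (f/h)` is `jacSym q f h`. -/
def jacSym (q : ℕ) [Fact q.Prime] (a b : Polynomial (ZMod q)) : ℤ :=
  if b = 0 then 0 else ((normalizedFactors b).map fun P => resSym q a P).prod

/-- The monic polynomial of degree `n` determined by the vector `v` of its
lower-order coefficients. -/
def monicOfDeg (q : ℕ) (n : ℕ) (v : Fin n → ZMod q) : Polynomial (ZMod q) :=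
  X ^ n + ∑ i : Fin n, C (v i) * X ^ (i : ℕ)

/-- The polynomial of degree `< n` with coefficient vector `v`. -/
def polyLT (q : ℕ) (n : ℕ) (v : Fin n → ZMod q) : Polynomial (ZMod q) :=
  ∑ i : Fin n, C (v i) * X ^ (i : ℕ)

/-- Sum of `F` over all monic polynomials of degree `m`; empty for `m < 0`. -/
def sumMonic (q : ℕ) [NeZero q] {M : Type*} [AddCommMonoid M] (m : ℤ)
    (F : Polynomial (ZMod q) → M) : M :=
  if 0 ≤ m then ∑ v : Fin m.toNat → ZMod q, F (monicOfDeg q m.toNat v) else 0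

/-- Sum of `F` over all monic polynomials of degree `≤ n`; empty for `n < 0`. -/
def sumMonicLE (q : ℕ) [NeZero q] {M : Type*} [AddCommMonoid M] (n : ℤ)
    (F : Polynomial (ZMod q) → M) : M :=
  if 0 ≤ n then ∑ m ∈ Finset.range (n.toNat + 1), sumMonic q (m : ℤ) F else 0

/-- Sum of `F` over the set `H_{2g+1}` of monic squarefree polynomials of degree `2g+1`. -/
def sumH (q : ℕ) [NeZero q] {M : Type*} [AddCommMonoid M] (g : ℕ)
    (F : Polynomial (ZMod q) → M) : M :=
  ∑ v : Fin (2 * g + 1) → ZMod q,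
    if Squarefree (monicOfDeg q (2 * g + 1) v) then F (monicOfDeg q (2 * g + 1) v) else 0

/-- `e(a/f)` for monic `f`: the additive character `exp(2πi a₁/q)` where `a₁` is the
coefficient of `t⁻¹` in the expansion of `a/f` at infinity, namely the coefficient of
`t^{deg f - 1}` in `a mod f`. -/
def ePoly (q : ℕ) (a f : Polynomial (ZMod q)) : ℂ :=
  Complex.exp (2 * Real.pi * Complex.I *
    (((a %ₘ f).coeff (f.natDegree - 1)).val : ℂ) / q)

/-- The generalized Gauss sum `G(V, f) = ∑_{u mod f} χ_f(u) e(uV/f)`, the sum running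
over the residues `u` modulo `f`, i.e. the polynomials of degree `< deg f`. -/
def gaussS (q : ℕ) [Fact q.Prime] (V f : Polynomial (ZMod q)) : ℂ :=
  ∑ v : Fin f.natDegree → ZMod q,
    (jacSym q f (polyLT q f.natDegree v) : ℂ) * ePoly q (polyLT q f.natDegree v * V) f

/-- The von Mangoldt function: `Λ(f) = deg P` if `f = P^k` with `P` monic irreducible
and `k ≥ 1`, and `0` otherwise. -/
def vM (q : ℕ) (f : Polynomial (ZMod q)) : ℕ :=
  if h : ∃ P : Polynomial (ZMod q), (∃ k : ℕ, 1 ≤ k ∧ f = P ^ k) ∧ P.Monic ∧ Irreducible P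
  then h.choose.natDegree else 0

/-- `B(α) = ∑_P d(P) / ((|P|^{1+2α} - 1)(|P| + 1))`, over monic irreducible `P`. -/
def Bsum (q : ℕ) (α : ℂ) : ℂ :=
  ∑' P : MonicIrr q, (P.1.natDegree : ℂ) /
    (((q : ℂ) ^ ((P.1.natDegree : ℂ) * (1 + 2 * α)) - 1) * ((q : ℂ) ^ P.1.natDegree + 1))

end

section Stepanov

variable {F : Type*} [Field F]

/-- `f ^ s` almost divides `f ^ i` times the `i`-th Hasse derivative of `f ^ s`. -/
lemma exists_hasseDeriv_pow_mul (f : F[X]) (s : ℕ) : ∀ i : ℕ, ∃ w : F[X],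
    w.natDegree ≤ i * f.natDegree ∧ hasseDeriv i (f ^ s) * f ^ i = f ^ s * w := by
  induction s with
  | zero =>
    intro i
    rcases Nat.eq_zero_or_pos i with rfl | hi
    · exact ⟨1, by simp, by simp⟩
    · exact ⟨0, by simp, by simp [hasseDeriv_apply_one i hi]⟩
  | succ s ih =>
    choose w hwd hw using ih
    intro i
    refine ⟨∑ ij ∈ Finset.HasAntidiagonal.antidiagonal i, if ij.1 = 0 then w ij.2
      else hasseDeriv ij.1 f * f ^ (ij.1 - 1) * w ij.2, ?_, ?_⟩
    · refine natDegree_sum_le_of_forall_le _ _ fun ij hij => ?_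
      obtain ⟨a, b⟩ := ij
      have hab : a + b = i := Finset.HasAntidiagonal.mem_antidiagonal.1 hij
      subst hab
      dsimp only
      split_ifs with h
      · subst h; simp [hwd b]
      · obtain ⟨a, rfl⟩ := Nat.exists_eq_succ_of_ne_zero h
        refine natDegree_mul_le.trans ?_
        have h1 : (hasseDeriv (a + 1) f * f ^ (a + 1 - 1)).natDegree
            ≤ f.natDegree + a * f.natDegree := by
          refine natDegree_mul_le.trans (add_le_add ((natDegree_hasseDeriv_le _ _).trans
            (Nat.sub_le _ _)) ?_)
          simp
        have h2 := hwd b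
        simp only [Nat.succ_eq_add_one]
        nlinarith
    · rw [pow_succ' f s, hasseDeriv_mul, Finset.sum_mul, Finset.mul_sum]
      refine Finset.sum_congr rfl fun ij hij => ?_
      obtain ⟨a, b⟩ := ij
      have hab : a + b = i := Finset.HasAntidiagonal.mem_antidiagonal.1 hij
      subst hab
      dsimp only
      have hb := hw b
      split_ifs with h
      · subst h
        simp only [hasseDeriv_zero', zero_add]
        rw [mul_assoc, hb, mul_assoc]
      · obtain ⟨a, rfl⟩ := Nat.exists_eq_succ_of_ne_zero h
        simp only [Nat.succ_eq_add_one, Nat.add_sub_cancel]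
        rw [pow_add, pow_succ]
        linear_combination (hasseDeriv (a + 1) f * f ^ a * f) * hb

/-- The linear operator `k ↦ f ^ l * E_l (f ^ s * k) / f ^ s`, for `E_l` the `l`-th Hasse
derivative. -/
lemma exists_hasseDeriv_pow_mul_linearMap (f : F[X]) (s l : ℕ) : ∃ W : F[X] →ₗ[F] F[X],
    (∀ k, hasseDeriv l (f ^ s * k) * f ^ l = f ^ s * W k) ∧
    ∀ k, (W k).natDegree ≤ l * f.natDegree + k.natDegree := by
  choose w hwd hw using exists_hasseDeriv_pow_mul f s
  refine ⟨∑ ij ∈ Finset.HasAntidiagonal.antidiagonal l,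
    (LinearMap.mulLeft F (w ij.1 * f ^ ij.2)).comp (hasseDeriv ij.2), fun k => ?_, fun k => ?_⟩
  · rw [hasseDeriv_mul, Finset.sum_mul, LinearMap.sum_apply, Finset.mul_sum]
    refine Finset.sum_congr rfl fun ij hij => ?_
    have hab : ij.1 + ij.2 = l := Finset.HasAntidiagonal.mem_antidiagonal.1 hij
    rw [← hab, pow_add]
    simp only [LinearMap.comp_apply, LinearMap.mulLeft_apply]
    linear_combination (hasseDeriv ij.2 k * f ^ ij.2) * hw ij.1
  · rw [LinearMap.sum_apply]
    refine natDegree_sum_le_of_forall_le _ _ fun ij hij => ?_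
    have hab : ij.1 + ij.2 = l := Finset.HasAntidiagonal.mem_antidiagonal.1 hij
    simp only [LinearMap.comp_apply, LinearMap.mulLeft_apply]
    refine natDegree_mul_le.trans (add_le_add (natDegree_mul_le.trans ?_)
      ((natDegree_hasseDeriv_le _ _).trans (Nat.sub_le _ _)))
    rw [← hab, add_mul]
    exact add_le_add (hwd _) natDegree_pow_le

lemma X_sub_C_pow_dvd_of_hasseDeriv_eval_eq_zero (h : F[X]) (x : F) (M : ℕ)
    (hh : ∀ l < M, (hasseDeriv l h).eval x = 0) : (X - C x) ^ M ∣ h := by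
  have h1 : X ^ M ∣ taylor x h := by
    rw [X_pow_dvd_iff]
    intro d hd
    rw [taylor_coeff]
    exact hh d hd
  obtain ⟨u, hu⟩ := h1
  refine ⟨taylor (-x) u, ?_⟩
  have h2 : h = taylor (-x) (taylor x h) := by rw [taylor_taylor]; simp
  rw [h2, hu, taylor_mul, taylor_pow, taylor_X]
  simp [sub_eq_add_neg]

/-- Linear algebra step of Stepanov's method: the vanishing conditions have a nontrivial
solution. -/
lemma exists_stepanov_coeffs (M J K d : ℕ) (hK : 1 ≤ K) (hJ : 1 ≤ J) (a : F)
    (hdim : M * (K + M * d + J) < 2 * (J * K))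
    (W₀ W₁ : ℕ → F[X] →ₗ[F] F[X])
    (hW₀ : ∀ l k, (W₀ l k).natDegree ≤ l * d + k.natDegree)
    (hW₁ : ∀ l k, (W₁ l k).natDegree ≤ l * d + k.natDegree) :
    ∃ k₀ k₁ : Fin J → F[X], ¬ (k₀ = 0 ∧ k₁ = 0) ∧ (∀ j, (k₀ j).degree < K) ∧
      (∀ j, (k₁ j).degree < K) ∧
      ∀ l < M, ∑ j : Fin J, (W₀ l (k₀ j) + C a * W₁ l (k₁ j)) * X ^ (j : ℕ) = 0 := by
  let T := degreeLT F (K + M * d + J)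
  let V := (Fin J → degreeLT F K) × (Fin J → degreeLT F K)
  let L : ℕ → V →ₗ[F] F[X] := fun l =>
    ∑ j : Fin J, (LinearMap.mulRight F (X ^ (j : ℕ))).comp
      ((W₀ l).comp ((degreeLT F K).subtype.comp ((LinearMap.proj j).comp (LinearMap.fst F _ _)))
        + (LinearMap.mulLeft F (C a)).comp ((W₁ l).comp ((degreeLT F K).subtype.comp
          ((LinearMap.proj j).comp (LinearMap.snd F _ _)))))
  have hL : ∀ l v, L l v = ∑ j : Fin J,
      (W₀ l (v.1 j : F[X]) + C a * W₁ l (v.2 j : F[X])) * X ^ (j : ℕ) := by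
    intro l v
    simp [L, LinearMap.sum_apply]
    rfl
  have hdeg : ∀ v : degreeLT F K, (v : F[X]).natDegree ≤ K - 1 := by
    intro v
    have := mem_degreeLT.1 v.2
    by_cases h : (v : F[X]) = 0
    · simp [h]
    · have := (natDegree_lt_iff_degree_lt h).2 this
      omega
  have hT : ∀ (l : Fin M) v, L l v ∈ T := by
    intro l v
    rw [hL, mem_degreeLT]
    have h1 : (∑ j : Fin J, (W₀ l (v.1 j : F[X]) + C a * W₁ l (v.2 j : F[X])) *
        X ^ (j : ℕ)).natDegree ≤ (M * d + (K - 1)) + (J - 1) := by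
      refine natDegree_sum_le_of_forall_le _ _ fun j _ => ?_
      refine natDegree_mul_le.trans (add_le_add ?_ ?_)
      · have hl : (l : ℕ) * d ≤ M * d := Nat.mul_le_mul_right _ l.2.le
        refine (natDegree_add_le _ _).trans (max_le ?_ ((natDegree_C_mul_le _ _).trans ?_))
        · exact (hW₀ _ _).trans (add_le_add hl (hdeg _))
        · exact (hW₁ _ _).trans (add_le_add hl (hdeg _))
      · rw [natDegree_X_pow]; have := j.2; omega
    refine lt_of_le_of_lt degree_le_natDegree ?_
    exact_mod_cast (by omega : _ < K + M * d + J)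
  let Φ : V →ₗ[F] (Fin M → T) := LinearMap.pi fun l => (L l).codRestrict T (hT l)
  have hfr : ∀ n, Module.finrank F (degreeLT F n) = n := by
    intro n
    rw [(degreeLTEquiv F n).finrank_eq]; simp
  have : ∀ n, FiniteDimensional F (degreeLT F n) := fun n =>
    Module.Finite.equiv (degreeLTEquiv F n).symm
  have hker : LinearMap.ker Φ ≠ ⊥ := by
    refine LinearMap.ker_ne_bot_of_finrank_lt ?_
    simp only [V, T, Module.finrank_prod, Module.finrank_pi_fintype, hfr, Finset.sum_const,
      Finset.card_univ, Fintype.card_fin, smul_eq_mul]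
    omega
  obtain ⟨v, hv, hv0⟩ := (Submodule.ne_bot_iff _).1 hker
  refine ⟨fun j => v.1 j, fun j => v.2 j, ?_, fun j => mem_degreeLT.1 (v.1 j).2,
    fun j => mem_degreeLT.1 (v.2 j).2, ?_⟩
  · rintro ⟨h0, h1⟩
    apply hv0
    refine Prod.ext (funext fun j => Subtype.ext ?_) (funext fun j => Subtype.ext ?_)
    · exact congrFun h0 j
    · exact congrFun h1 j
  · intro l hl
    rw [← hL]
    have := congrFun (LinearMap.mem_ker.1 hv) ⟨l, hl⟩
    exact congrArg Subtype.val this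

variable [Fintype F]

lemma X_sub_C_pow_card (x : F) :
    (X - C x) ^ Fintype.card F = X ^ Fintype.card F - C x := by
  rw [← FiniteField.expand_card]
  simp

/-- The auxiliary polynomial of Stepanov's method vanishes to high order. -/
lemma stepanov_vanishing (f : F[X]) (M J e : ℕ) (hM : M ≤ Fintype.card F)
    (k₀ k₁ : Fin J → F[X]) (a x : F) (hfx : f.eval x ≠ 0) (hgx : (f.eval x) ^ e = a)
    (W₀ W₁ : ℕ → F[X] →ₗ[F] F[X])
    (hW₀ : ∀ l k, hasseDeriv l (f ^ M * k) * f ^ l = f ^ M * W₀ l k)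
    (hW₁ : ∀ l k, hasseDeriv l (f ^ (M + e) * k) * f ^ l = f ^ (M + e) * W₁ l k)
    (hz : ∀ l < M, ∑ j : Fin J, (W₀ l (k₀ j) + C a * W₁ l (k₁ j)) * X ^ (j : ℕ) = 0) :
    (X - C x) ^ M ∣ ∑ j : Fin J,
      (f ^ M * k₀ j + f ^ (M + e) * k₁ j) * X ^ (Fintype.card F * j) := by
  have h1 : (X - C x) ^ M ∣ ∑ j : Fin J,
      (f ^ M * k₀ j + f ^ (M + e) * k₁ j) * C (x ^ (j : ℕ)) := by
    refine X_sub_C_pow_dvd_of_hasseDeriv_eval_eq_zero _ _ _ fun l hl => ?_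
    have h2 : (hasseDeriv l (∑ j : Fin J,
        (f ^ M * k₀ j + f ^ (M + e) * k₁ j) * C (x ^ (j : ℕ))) * f ^ l) =
        ∑ j : Fin J, (f ^ M * W₀ l (k₀ j) + f ^ (M + e) * W₁ l (k₁ j)) * C (x ^ (j : ℕ)) := by
      rw [map_sum, Finset.sum_mul]
      refine Finset.sum_congr rfl fun j _ => ?_
      rw [mul_comm _ (C _), ← smul_eq_C_mul, map_smul, map_add, smul_eq_C_mul,
        ← hW₀, ← hW₁]
      ring
    have h3 := congrArg (eval x) h2
    have h4 := congrArg (eval x) (hz l hl)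
    simp only [eval_mul, eval_pow, eval_finsetSum, eval_add, eval_C, eval_X, eval_zero] at h3 h4
    have h5 : (hasseDeriv l (∑ j : Fin J,
        (f ^ M * k₀ j + f ^ (M + e) * k₁ j) * C (x ^ (j : ℕ)))).eval x * (f.eval x) ^ l = 0 := by
      rw [h3, pow_add, hgx]
      calc _ = f.eval x ^ M * ∑ j : Fin J, ((W₀ l (k₀ j)).eval x
              + a * (W₁ l (k₁ j)).eval x) * x ^ (j : ℕ) := by
            rw [Finset.mul_sum]
            exact Finset.sum_congr rfl fun j _ => by ring
        _ = 0 := by rw [h4, mul_zero]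
    exact (mul_eq_zero.1 h5).resolve_right (pow_ne_zero _ hfx)
  have h2 : (X - C x) ^ M ∣ (∑ j : Fin J,
      (f ^ M * k₀ j + f ^ (M + e) * k₁ j) * X ^ (Fintype.card F * j)) - ∑ j : Fin J,
      (f ^ M * k₀ j + f ^ (M + e) * k₁ j) * C (x ^ (j : ℕ)) := by
    rw [← Finset.sum_sub_distrib]
    refine Finset.dvd_sum fun j _ => ?_
    rw [← mul_sub]
    refine Dvd.dvd.mul_left ((pow_dvd_pow _ hM).trans ?_) _
    rw [X_sub_C_pow_card, pow_mul, C_pow]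
    exact sub_dvd_pow_sub_pow _ _ _
  exact (dvd_iff_dvd_of_dvd_sub h2).2 h1

/-- Nontriviality of the auxiliary polynomial of Stepanov's method. -/
lemma stepanov_nonvanishing (f : F[X]) (hf0 : f.eval 0 ≠ 0)
    (hf : ∀ (c : F) (u : F[X]), f ≠ C c * u ^ 2) (J K e : ℕ)
    (he : Fintype.card F = 2 * e + 1) (hK : 2 * K + f.natDegree ≤ Fintype.card F + 1)
    (k₀ k₁ : Fin J → F[X]) (hk₀ : ∀ j, (k₀ j).degree < K) (hk₁ : ∀ j, (k₁ j).degree < K)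
    (hz : ∑ j : Fin J, (k₀ j + f ^ e * k₁ j) * X ^ (Fintype.card F * j) = 0) :
    k₀ = 0 ∧ k₁ = 0 := by
  have key : ∀ a b : F[X], a.degree < K → b.degree < K →
      X ^ Fintype.card F ∣ a + f ^ e * b → a = 0 ∧ b = 0 := by
    intro a b ha hb hab
    have h1 : X ^ Fintype.card F ∣ a ^ 2 * f - C (f.eval 0) * b ^ 2 := by
      have h2 : X ^ Fintype.card F ∣ f ^ Fintype.card F - C (f.eval 0) := by
        rw [← FiniteField.expand_card f, ← expand_C (Fintype.card F) (f.eval 0), ← map_sub]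
        have : X ∣ f - C (f.eval 0) := by
          rw [X_dvd_iff]; simp [coeff_zero_eq_eval_zero]
        obtain ⟨u, hu⟩ := this
        rw [hu, map_mul, expand_X]
        exact dvd_mul_right _ _
      have h3 : a ^ 2 * f - C (f.eval 0) * b ^ 2 =
          (a + f ^ e * b) * ((a - f ^ e * b) * f)
            + (f ^ Fintype.card F - C (f.eval 0)) * b ^ 2 := by
        rw [he]; ring
      rw [h3]
      exact dvd_add (hab.mul_right _) (h2.mul_right _)
    have h4 : a ^ 2 * f = C (f.eval 0) * b ^ 2 := by
      rw [← sub_eq_zero]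
      by_contra hne
      have h5 := natDegree_le_of_dvd h1 hne
      rw [natDegree_X_pow] at h5
      have hd : ∀ c : F[X], c.degree < K → 2 * c.natDegree + 2 ≤ 2 * K ∨ c = 0 := by
        intro c hc
        by_cases h : c = 0
        · exact Or.inr h
        · left
          have := (natDegree_lt_iff_degree_lt h).2 hc
          omega
      have h6 : (a ^ 2 * f).natDegree < Fintype.card F := by
        rcases hd a ha with h | h
        · have : (a ^ 2 * f).natDegree ≤ 2 * a.natDegree + f.natDegree :=
            natDegree_mul_le.trans (add_le_add natDegree_pow_le le_rfl)
          omega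
        · subst h; simp; omega
      have h7 : (C (f.eval 0) * b ^ 2).natDegree < Fintype.card F := by
        rcases hd b hb with h | h
        · have : (C (f.eval 0) * b ^ 2).natDegree ≤ 2 * b.natDegree :=
            (natDegree_C_mul_le _ _).trans natDegree_pow_le
          omega
        · subst h; simp; omega
      have := (natDegree_sub_le (a ^ 2 * f) (C (f.eval 0) * b ^ 2))
      omega
    by_cases ha0 : a = 0
    · subst ha0
      refine ⟨rfl, ?_⟩
      have : C (f.eval 0) * b ^ 2 = 0 := by rw [← h4]; ring
      rcases mul_eq_zero.1 this with h | h
      · exact absurd (C_eq_zero.1 h) hf0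
      · exact pow_eq_zero_iff (two_ne_zero) |>.1 h
    · exfalso
      have h5 : a ^ 2 ∣ b ^ 2 := by
        have : a ^ 2 ∣ C (f.eval 0) * b ^ 2 := ⟨f, h4.symm⟩
        exact (IsUnit.dvd_mul_left (isUnit_C.2 (isUnit_iff_ne_zero.2 hf0))).1 this
      obtain ⟨w, hw⟩ := (IsIntegrallyClosed.pow_dvd_pow_iff two_ne_zero).1 h5
      apply hf (f.eval 0) w
      refine mul_left_cancel₀ (pow_ne_zero 2 ha0) ?_
      rw [h4, hw]; ring
  have main : ∀ n : ℕ, ∀ j : Fin J, (j : ℕ) < n → k₀ j = 0 ∧ k₁ j = 0 := by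
    intro n
    induction n with
    | zero => intro j hj; omega
    | succ n ih =>
      intro j hj
      rcases Nat.lt_succ_iff_lt_or_eq.1 hj with h | h
      · exact ih j h
      · refine key _ _ (hk₀ j) (hk₁ j) ?_
        have h1 : X ^ (Fintype.card F * (n + 1)) ∣
            (k₀ j + f ^ e * k₁ j) * X ^ (Fintype.card F * (j : ℕ)) := by
          rw [← Finset.add_sum_erase _ _ (Finset.mem_univ j)] at hz
          rw [eq_neg_of_add_eq_zero_left hz, dvd_neg]
          refine Finset.dvd_sum fun i hi => ?_
          rcases lt_or_ge (i : ℕ) n with h' | h'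
          · obtain ⟨e0, e1⟩ := ih i h'
            simp [e0, e1]
          · have : (i : ℕ) ≠ n := by
              intro hin
              exact Finset.ne_of_mem_erase hi (Fin.ext (by omega))
            exact Dvd.dvd.mul_left (pow_dvd_pow _ (Nat.mul_le_mul_left _ (by omega))) _
        rw [h, mul_add, mul_one, pow_add, mul_comm (X ^ _) (X ^ _)] at h1
        exact (mul_dvd_mul_iff_right (pow_ne_zero _ X_ne_zero)).1 h1
  exact ⟨funext fun j => (main J j j.2).1, funext fun j => (main J j j.2).2⟩

/-- Stepanov's inequality with free parameters. -/
lemma stepanov_card_mul_le (f : F[X]) (hf0 : f.eval 0 ≠ 0)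
    (hf : ∀ (c : F) (u : F[X]), f ≠ C c * u ^ 2) (M J K e : ℕ)
    (he : Fintype.card F = 2 * e + 1) (hK : 2 * K + f.natDegree ≤ Fintype.card F + 1)
    (hM : M ≤ Fintype.card F) (hK1 : 1 ≤ K) (hJ : 1 ≤ J)
    (hdim : M * (K + M * f.natDegree + J) < 2 * (J * K)) (a : F) :
    M * (Finset.univ.filter fun x : F => f.eval x ≠ 0 ∧ (f.eval x) ^ e = a).card ≤
      (M + e) * f.natDegree + (K - 1) + Fintype.card F * (J - 1) := by
  choose W₀ hW₀ hW₀d using exists_hasseDeriv_pow_mul_linearMap f M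
  choose W₁ hW₁ hW₁d using exists_hasseDeriv_pow_mul_linearMap f (M + e)
  obtain ⟨k₀, k₁, hne, hk₀, hk₁, hz⟩ :=
    exists_stepanov_coeffs M J K f.natDegree hK1 hJ a hdim W₀ W₁ hW₀d hW₁d
  set h : F[X] := ∑ j : Fin J,
      (f ^ M * k₀ j + f ^ (M + e) * k₁ j) * X ^ (Fintype.card F * j) with hh
  have hh0 : h ≠ 0 := by
    intro h0
    apply hne
    refine stepanov_nonvanishing f hf0 hf J K e he hK k₀ k₁ hk₀ hk₁ ?_
    have hf' : f ≠ 0 := by rintro rfl; simp at hf0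
    refine mul_left_cancel₀ (pow_ne_zero M hf') ?_
    rw [mul_zero, ← h0, hh, Finset.mul_sum]
    exact Finset.sum_congr rfl fun j _ => by ring
  have hdeg : ∀ v : F[X], v.degree < K → v.natDegree ≤ K - 1 := by
    intro v hv
    by_cases h : v = 0
    · simp [h]
    · have := (natDegree_lt_iff_degree_lt h).2 hv
      omega
  have hhd : h.natDegree ≤ (M + e) * f.natDegree + (K - 1) + Fintype.card F * (J - 1) := by
    refine natDegree_sum_le_of_forall_le _ _ fun j _ => ?_
    refine natDegree_mul_le.trans (add_le_add ?_ ?_)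
    · refine (natDegree_add_le _ _).trans (max_le ?_ ?_)
      · refine natDegree_mul_le.trans (add_le_add (natDegree_pow_le.trans ?_) (hdeg _ (hk₀ j)))
        exact Nat.mul_le_mul_right _ (Nat.le_add_right _ _)
      · exact natDegree_mul_le.trans (add_le_add natDegree_pow_le (hdeg _ (hk₁ j)))
    · rw [natDegree_X_pow]
      have := j.2
      exact Nat.mul_le_mul_left _ (by omega)
  refine le_trans ?_ hhd
  have hdvd : ∏ x ∈ Finset.univ.filter (fun x : F => f.eval x ≠ 0 ∧ (f.eval x) ^ e = a),
      (X - C x) ^ M ∣ h := by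
    refine Finset.prod_dvd_of_coprime ?_ ?_
    · intro x _ y _ hxy
      exact (pairwise_coprime_X_sub_C Function.injective_id hxy).pow
    · intro x hx
      obtain ⟨-, h1, h2⟩ := Finset.mem_filter.1 hx
      exact stepanov_vanishing f M J e hM k₀ k₁ a x h1 h2 W₀ W₁ hW₀ hW₁ hz
  have h1 := natDegree_le_of_dvd hdvd hh0
  rw [natDegree_prod_of_monic _ _ fun x _ => (monic_X_sub_C x).pow M] at h1
  simpa [natDegree_pow, mul_comm] using h1

/-- Upper bound for the number of points where `f` takes values in a given class modulo
squares. -/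
lemma stepanov_card_le (f : F[X]) (hf0 : f.eval 0 ≠ 0)
    (hf : ∀ (c : F) (u : F[X]), f ≠ C c * u ^ 2) (hm : 1 ≤ f.natDegree) (e : ℕ)
    (he : Fintype.card F = 2 * e + 1) (hQ : 16 ≤ Fintype.card F)
    (hmQ : 4 * f.natDegree ≤ Fintype.card F) (a : F) :
    ((Finset.univ.filter fun x : F => f.eval x ≠ 0 ∧ (f.eval x) ^ e = a).card : ℝ) ≤
      (Fintype.card F : ℝ) / 2 + 7 * f.natDegree * √(Fintype.card F : ℝ) := by
  set Q := Fintype.card F with hQdef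
  set m := f.natDegree with hmdef
  set r := Nat.sqrt Q / 4 with hr
  set N := (Finset.univ.filter fun x : F => f.eval x ≠ 0 ∧ (f.eval x) ^ e = a).card with hN
  have hs : 4 ≤ Nat.sqrt Q := Nat.le_sqrt.2 (by omega)
  have hs1 : Nat.sqrt Q * Nat.sqrt Q ≤ Q := Nat.sqrt_le Q
  have hs2 : Q < (Nat.sqrt Q + 1) * (Nat.sqrt Q + 1) := Nat.lt_succ_sqrt Q
  have hr1 : 1 ≤ r := by omega
  have hr2 : 4 * r ≤ Nat.sqrt Q := by omega
  have hr3 : Nat.sqrt Q + 1 ≤ 8 * r := by omega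
  have hr4 : 16 * (r * r) ≤ Q := by nlinarith
  have hr5 : Q ≤ 64 * (r * r) := by nlinarith
  have hr6 : 4 * r ≤ Q := by nlinarith
  set K := (Q + 1 - m) / 2 with hKdef
  have hK1 : 3 * Q ≤ 8 * K := by omega
  have key := stepanov_card_mul_le f hf0 hf (2 * r) (r + m) K e he (by omega) (by omega)
    (by omega) (by omega) (by
      rw [← hmdef]
      have h1 : m * (3 * Q) ≤ m * (8 * K) := Nat.mul_le_mul_left _ hK1
      have h2 : m * (16 * (r * r)) ≤ m * Q := Nat.mul_le_mul_left _ hr4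
      have h3 : r * r * 1 ≤ r * r * m := Nat.mul_le_mul_left _ hm
      have h4 : r * m * 1 ≤ r * m * r := Nat.mul_le_mul_left _ hr1
      have h5 : 1 ≤ r * m := Nat.mul_pos hr1 hm
      nlinarith) a
  rw [← hmdef, ← hN] at key
  have key' : 2 * r * N ≤ 2 * r * m + e * m + (K - 1) + Q * (r + m - 1) := by
    calc _ ≤ _ := key
      _ = _ := by ring
  obtain ⟨b, hb⟩ : ∃ b, r + m = b + 1 := ⟨r + m - 1, by omega⟩
  have hb' : r + m - 1 = b := by omega
  rw [hb'] at key'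
  have e1 : 2 * (K - 1) ≤ Q := by omega
  have hkey : (2 * r * N : ℝ) ≤ 2 * r * m + e * m + ((K - 1 : ℕ) : ℝ) + Q * b := by
    exact_mod_cast key'
  have e1' : 2 * ((K - 1 : ℕ) : ℝ) ≤ Q := by exact_mod_cast e1
  have hbR : (r : ℝ) + m = b + 1 := by exact_mod_cast hb
  have heR : (Q : ℝ) = 2 * e + 1 := by exact_mod_cast he
  have hrR : (1 : ℝ) ≤ r := by exact_mod_cast hr1
  have hmR : (1 : ℝ) ≤ m := by exact_mod_cast hm
  have hQR : (1 : ℝ) ≤ Q := by exact_mod_cast (by omega : 1 ≤ Q)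
  set t := √(Q : ℝ) with ht
  have ht2 : t * t = Q := Real.mul_self_sqrt (by positivity)
  have ht1 : 1 ≤ t := Real.one_le_sqrt.2 hQR
  have ht8 : t ≤ 8 * r := by
    rw [ht]
    refine Real.sqrt_le_iff.2 ⟨by positivity, ?_⟩
    have : (Q : ℝ) ≤ 64 * (r * r) := by exact_mod_cast hr5
    nlinarith
  have hb2 : (b : ℝ) = r + m - 1 := by linarith
  have hfin : (2 * r * N : ℝ) ≤ 2 * r * (Q / 2 + 7 * m * t) := by
    have h1 : (Q : ℝ) * m ≤ 8 * r * m * t := by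
      rw [← ht2]; nlinarith [mul_le_mul_of_nonneg_left ht8 (by positivity : 0 ≤ t * m)]
    have h2 : (r : ℝ) * m ≤ r * m * t := le_mul_of_one_le_right (by positivity) ht1
    have h3 : (e : ℝ) * m ≤ Q * m / 2 := by rw [heR]; nlinarith
    rw [hb2] at hkey
    nlinarith
  exact le_of_mul_le_mul_left hfin (by positivity)

/-- The Weil bound for quadratic character sums, when `f` does not vanish at the origin. -/
lemma abs_sum_quadraticChar_eval_le_aux (h2 : ringChar F ≠ 2) (f : F[X]) (hf0 : f.eval 0 ≠ 0)
    (hf : ∀ (c : F) (u : F[X]), f ≠ C c * u ^ 2) (hm : 1 ≤ f.natDegree)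
    (hQ : 16 ≤ Fintype.card F) (hmQ : 4 * f.natDegree ≤ Fintype.card F) :
    |∑ x : F, (quadraticChar F (f.eval x) : ℝ)| ≤
      15 * f.natDegree * √(Fintype.card F : ℝ) := by
  obtain ⟨e, he⟩ : ∃ e, Fintype.card F = 2 * e + 1 := by
    have := FiniteField.odd_card_of_char_ne_two h2
    exact ⟨Fintype.card F / 2, by omega⟩
  have he2 : Fintype.card F / 2 = e := by omega
  have hchar : ∀ x : F, (quadraticChar F (f.eval x) : F) = (f.eval x) ^ e := by
    intro x; rw [quadraticChar_eq_pow_of_char_ne_two' h2, he2]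
  set A := Finset.univ.filter fun x : F => f.eval x ≠ 0 ∧ (f.eval x) ^ e = 1 with hA
  set B := Finset.univ.filter fun x : F => f.eval x ≠ 0 ∧ (f.eval x) ^ e = -1 with hB
  set Z := Finset.univ.filter fun x : F => f.eval x = 0 with hZ
  have hne : (1 : F) ≠ -1 := fun h => Ring.neg_one_ne_one_of_char_ne_two h2 h.symm
  have hsum : ∑ x : F, (quadraticChar F (f.eval x) : ℝ) = (A.card : ℝ) - B.card := by
    rw [hA, hB, Finset.card_filter, Finset.card_filter]
    push_cast
    rw [← Finset.sum_sub_distrib]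
    refine Finset.sum_congr rfl fun x _ => ?_
    by_cases hx : f.eval x = 0
    · simp [hx]
    · rcases quadraticChar_dichotomy hx with h | h
      · have := hchar x
        rw [h] at this
        simp only [Int.cast_one] at this
        simp [hx, h, ← this, hne]
      · have := hchar x
        rw [h] at this
        simp only [Int.cast_neg, Int.cast_one] at this
        simp [hx, h, ← this, hne.symm]
  have hcard : A.card + B.card + Z.card = Fintype.card F := by
    rw [hA, hB, hZ, Finset.card_filter, Finset.card_filter, Finset.card_filter,
      ← Finset.sum_add_distrib, ← Finset.sum_add_distrib, ← Finset.card_univ,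
      Finset.card_eq_sum_ones]
    refine Finset.sum_congr rfl fun x _ => ?_
    by_cases hx : f.eval x = 0
    · simp [hx]
    · have := hchar x
      rcases quadraticChar_dichotomy hx with h | h
      · rw [h] at this
        simp only [Int.cast_one] at this
        simp [hx, ← this, hne]
      · rw [h] at this
        simp only [Int.cast_neg, Int.cast_one] at this
        simp [hx, ← this, hne.symm]
  have hZc : Z.card ≤ f.natDegree := by
    have hf' : f ≠ 0 := by rintro rfl; simp at hf0
    refine le_trans (Finset.card_le_card (t := f.roots.toFinset) fun x hx => ?_)
      ((Multiset.toFinset_card_le _).trans (card_roots' f))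
    rw [Multiset.mem_toFinset, mem_roots hf']
    exact (Finset.mem_filter.1 hx).2
  have hAb := stepanov_card_le f hf0 hf hm e he hQ hmQ 1
  have hBb := stepanov_card_le f hf0 hf hm e he hQ hmQ (-1)
  rw [← hA] at hAb
  rw [← hB] at hBb
  have hcardR : (A.card : ℝ) + B.card + Z.card = Fintype.card F := by exact_mod_cast hcard
  have hZR : (Z.card : ℝ) ≤ f.natDegree := by exact_mod_cast hZc
  have ht1 : 1 ≤ √(Fintype.card F : ℝ) :=
    Real.one_le_sqrt.2 (by exact_mod_cast (by omega : 1 ≤ Fintype.card F))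
  have hmt : (f.natDegree : ℝ) ≤ f.natDegree * √(Fintype.card F : ℝ) :=
    le_mul_of_one_le_right (by positivity) ht1
  rw [hsum, abs_le]
  constructor <;> linarith

/-- The Weil bound for quadratic character sums over a finite field, with an absolute
constant. -/
theorem abs_sum_quadraticChar_eval_le (h2 : ringChar F ≠ 2) (f : F[X])
    (hf : ∀ (c : F) (u : F[X]), f ≠ C c * u ^ 2) :
    |∑ x : F, (quadraticChar F (f.eval x) : ℝ)| ≤
      15 * f.natDegree * √(Fintype.card F : ℝ) := by
  have hm : 1 ≤ f.natDegree := by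
    by_contra h
    have h0 : f.natDegree = 0 := by omega
    exact hf (f.coeff 0) 1 (by simpa using eq_C_of_natDegree_eq_zero h0)
  have hmR : (1 : ℝ) ≤ f.natDegree := by exact_mod_cast hm
  have hQ1 : (1 : ℝ) ≤ Fintype.card F := by exact_mod_cast Fintype.card_pos
  have ht1 : 1 ≤ √(Fintype.card F : ℝ) := Real.one_le_sqrt.2 hQ1
  have ht2 : √(Fintype.card F : ℝ) * √(Fintype.card F : ℝ) = Fintype.card F :=
    Real.mul_self_sqrt (by positivity)
  have htriv : |∑ x : F, (quadraticChar F (f.eval x) : ℝ)| ≤ Fintype.card F := by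
    refine (Finset.abs_sum_le_sum_abs _ _).trans ?_
    calc _ ≤ ∑ x : F, (1 : ℝ) := Finset.sum_le_sum fun x _ => by
          by_cases hx : f.eval x = 0
          · simp [hx]
          · rcases quadraticChar_dichotomy hx with h | h <;> simp [h]
      _ = _ := by simp
  by_cases hQ : 16 ≤ Fintype.card F
  swap
  · have : (Fintype.card F : ℝ) ≤ 16 := by exact_mod_cast (by omega : Fintype.card F ≤ 16)
    have ht4 : √(Fintype.card F : ℝ) ≤ 4 :=
      Real.sqrt_le_iff.2 ⟨by norm_num, by linarith⟩
    nlinarith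
  by_cases hmQ : 4 * f.natDegree ≤ Fintype.card F
  swap
  · have : (Fintype.card F : ℝ) ≤ 4 * f.natDegree := by
      exact_mod_cast (by omega : Fintype.card F ≤ 4 * f.natDegree)
    nlinarith
  have hf' : f ≠ 0 := by rintro rfl; simp at hm
  obtain ⟨a, ha⟩ : ∃ a : F, f.eval a ≠ 0 := by
    by_contra! h
    have := card_le_degree_of_subset_roots (p := f) (Z := Finset.univ)
      (fun x _ => (mem_roots hf').2 (h x))
    rw [Finset.card_univ] at this
    omega
  have key := abs_sum_quadraticChar_eval_le_aux h2 (taylor a f) (by simpa [taylor_eval] using ha)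
    (fun c u h => hf c (taylor (-a) u) (by
      have h3 : f = taylor (-a) (taylor a f) := by rw [taylor_taylor]; simp
      rw [h3, h, taylor_mul, taylor_pow, taylor_C]))
    (by simpa using hm) hQ (by simpa using hmQ)
  rw [natDegree_taylor] at key
  convert key using 2
  refine (Fintype.sum_equiv (Equiv.addRight a) _ _ fun x => ?_).symm
  simp [taylor_eval]

end Stepanov

section FiniteExtension

variable {q : ℕ} [Fact q.Prime] {F : Type*} [Field F] [Algebra (ZMod q) F]

lemma mem_range_algebraMap_of_pow_eq {a : F} (h : a ^ q = a) :
    a ∈ (algebraMap (ZMod q) F).range := by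
  have : CharP F q := charP_of_injective_algebraMap (algebraMap (ZMod q) F).injective q
  have h1 := (Subfield.mem_bot_iff_pow_eq_self (F := F) (p := q) (x := a)).2 h
  obtain ⟨k, hk⟩ := (mem_bot_iff_intCast q F).1 h1
  exact ⟨k, by simp [hk]⟩

/-- A monic nonsquare over the prime field remains a nonsquare (up to constants) over any
extension. -/
lemma map_ne_C_mul_sq (hq2 : q ≠ 2) {B : (ZMod q)[X]} (hB : B.Monic) (hs : ¬ IsSquare B)
    (c : F) (u : F[X]) : B.map (algebraMap (ZMod q) F) ≠ C c * u ^ 2 := by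
  intro h
  have hp : CharP F q := charP_of_injective_algebraMap (algebraMap (ZMod q) F).injective q
  have : ExpChar F q := ExpChar.prime Fact.out
  have hBm : (B.map (algebraMap (ZMod q) F)).Monic := hB.map _
  have hu : u ≠ 0 := by rintro rfl; exact hBm.ne_zero (by simp [h])
  set w := u * C (u.leadingCoeff⁻¹) with hw
  have hwm : w.Monic := monic_mul_leadingCoeff_inv hu
  have hBw : B.map (algebraMap (ZMod q) F) = w ^ 2 := by
    have h1 : B.map (algebraMap (ZMod q) F) = C (c * u.leadingCoeff ^ 2) * w ^ 2 := by
      have h5 : u = w * C u.leadingCoeff := by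
        rw [hw, mul_assoc, ← C_mul, inv_mul_cancel₀ (leadingCoeff_ne_zero.2 hu)]; simp
      rw [h]; conv_lhs => rw [h5]
      simp only [C_mul, C_pow]; ring
    have h2 := congrArg leadingCoeff h1
    rw [hBm, leadingCoeff_mul, (hwm.pow 2), leadingCoeff_C, mul_one] at h2
    rw [h1, ← h2]; simp
  have hφ : w.map (frobenius F q) = w := by
    have h1 : (w.map (frobenius F q)) ^ 2 = w ^ 2 := by
      rw [← Polynomial.map_pow, ← hBw, Polynomial.map_map]
      congr 1
      exact Subsingleton.elim _ _
    rcases sq_eq_sq_iff_eq_or_eq_neg.1 h1 with h1 | h1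
    · exact h1
    · exfalso
      have h2 := congrArg leadingCoeff h1
      rw [(hwm.map _), leadingCoeff_neg, hwm] at h2
      have : Fact (2 < q) := ⟨by have := (Fact.out : q.Prime).two_le; omega⟩
      exact CharP.neg_one_ne_one F q h2.symm
  obtain ⟨w0, hw0⟩ : ∃ w0 : (ZMod q)[X], w0.map (algebraMap (ZMod q) F) = w := by
    rw [← mem_lifts, lifts_iff_coeff_lifts]
    intro k
    have := congrArg (fun p => coeff p k) hφ
    simp only [coeff_map, frobenius_def] at this
    exact mem_range_algebraMap_of_pow_eq this
  apply hs
  refine ⟨w0, ?_⟩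
  apply Polynomial.map_injective _ (algebraMap (ZMod q) F).injective
  rw [hBw, ← hw0, Polynomial.map_mul, sq]

lemma minpoly_eq_iff_of_irreducible {P : (ZMod q)[X]} (hP : Irreducible P) (hm : P.Monic) {x : F} :
    minpoly (ZMod q) x = P ↔ aeval x P = 0 := by
  constructor
  · rintro rfl; exact minpoly.aeval _ _
  · intro h; exact (minpoly.eq_of_irreducible_of_monic hP h hm).symm

variable [Fintype F] {n : ℕ}

lemma finrank_of_card (hF : Fintype.card F = q ^ n) : Module.finrank (ZMod q) F = n := by
  have h := Module.card_eq_pow_finrank (K := ZMod q) (V := F)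
  rw [hF, ZMod.card] at h
  exact (Nat.pow_right_injective (Fact.out : q.Prime).two_le h).symm

/-- A monic irreducible polynomial of degree `n` over `ZMod q` has exactly `n` roots in the field
with `q ^ n` elements. -/
lemma card_roots_of_irreducible (hF : Fintype.card F = q ^ n) {P : (ZMod q)[X]}
    (hP : Irreducible P) (hPn : P.natDegree = n) :
    (Finset.univ.filter fun x : F => aeval x P = 0).card = n := by
  have hsep : P.Separable := PerfectField.separable_of_irreducible hP
  have hsp : Splits (P.map (algebraMap (ZMod q) F)) := by
    have h1 : P ∣ X ^ q ^ n - X := by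
      have := (hP.natDegree_dvd_iff_dvd_X_pow_card_pow_sub_X (n := n)).1 (by rw [hPn])
      simpa using this
    have h2 : Splits (X ^ (Nat.card F) - X : F[X]) := splits_X_pow_nat_card_sub_X
    have h3 : (X ^ (Nat.card F) - X : F[X]) ≠ 0 :=
      FiniteField.X_pow_card_sub_X_ne_zero _ Finite.one_lt_card
    refine Splits.of_dvd h2 h3 ?_
    have := Polynomial.map_dvd (algebraMap (ZMod q) F) h1
    simpa [Nat.card_eq_fintype_card, hF] using this
  have h := card_rootSet_eq_natDegree hsep hsp
  rw [hPn] at h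
  rw [← h, ← Set.toFinset_card]
  congr 1
  ext x
  simp [mem_rootSet, hP.ne_zero]

/-- The elements of degree `n` over the prime field. -/
noncomputable def genElts (q : ℕ) [Fact q.Prime] (F : Type*) [Field F] [Algebra (ZMod q) F]
    [Fintype F] (n : ℕ) : Finset F :=
  Finset.univ.filter fun x : F => (minpoly (ZMod q) x).natDegree = n

lemma pow_card_pow_eq_self (x : F) : x ^ q ^ (minpoly (ZMod q) x).natDegree = x := by
  have hx : IsIntegral (ZMod q) x := Algebra.IsIntegral.isIntegral x
  have h1 := (minpoly.irreducible hx).natDegree_dvd_iff_dvd_X_pow_card_pow_sub_X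
    (n := (minpoly (ZMod q) x).natDegree) |>.1 dvd_rfl
  rw [Nat.card_zmod] at h1
  have h2 := (minpoly.dvd_iff).1 h1
  simpa [sub_eq_zero] using h2

lemma card_filter_pow_eq_le {k : ℕ} (hk : 1 < k) :
    (Finset.univ.filter fun x : F => x ^ k = x).card ≤ k := by
  have h0 : (X ^ k - X : F[X]) ≠ 0 := FiniteField.X_pow_card_sub_X_ne_zero F hk
  have := card_le_degree_of_subset_roots (p := (X ^ k - X : F[X]))
    (Z := Finset.univ.filter fun x : F => x ^ k = x) (by
      intro x hx
      rw [Multiset.mem_toFinset.symm.trans Multiset.mem_toFinset]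
      rw [mem_roots h0]
      simp at hx
      simp [hx])
  rwa [FiniteField.X_pow_card_sub_X_natDegree_eq F hk] at this

lemma card_compl_genElts_le (hF : Fintype.card F = q ^ n) (hn : 1 ≤ n) :
    ((genElts q F n)ᶜ.card : ℝ) ≤ 2 * √(q : ℝ) ^ n := by
  have hq2 := (Fact.out : q.Prime).two_le
  have h1 : (genElts q F n)ᶜ ⊆ (Finset.Icc 1 (n / 2)).biUnion fun d =>
      Finset.univ.filter fun x : F => x ^ q ^ d = x := by
    intro x hx
    simp only [genElts, Finset.mem_compl, Finset.mem_filter, Finset.mem_univ, true_and] at hx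
    simp only [Finset.mem_biUnion, Finset.mem_Icc, Finset.mem_filter, Finset.mem_univ, true_and]
    have hxi : IsIntegral (ZMod q) x := Algebra.IsIntegral.isIntegral x
    have hd := minpoly.degree_dvd hxi
    rw [finrank_of_card hF] at hd
    refine ⟨_, ⟨minpoly.natDegree_pos hxi, ?_⟩, pow_card_pow_eq_self x⟩
    obtain ⟨c, hc⟩ := hd
    rw [Nat.le_div_iff_mul_le (by norm_num)]
    have hc2 : 2 ≤ c := by
      rcases c with _ | _ | c
      · omega
      · omega
      · omega
    calc _ ≤ (minpoly (ZMod q) x).natDegree * c := Nat.mul_le_mul_left _ hc2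
      _ = n := hc.symm
  have h2 : (genElts q F n)ᶜ.card ≤ ∑ d ∈ Finset.Icc 1 (n / 2), q ^ d := by
    refine (Finset.card_le_card h1).trans (Finset.card_biUnion_le.trans ?_)
    refine Finset.sum_le_sum fun d hd => card_filter_pow_eq_le ?_
    exact Nat.one_lt_pow (by have := Finset.mem_Icc.1 hd; omega) (by omega)
  have h3 : ∀ k : ℕ, ∑ d ∈ Finset.Icc 1 k, q ^ d ≤ 2 * q ^ k := by
    intro k
    induction k with
    | zero => simp
    | succ k ih =>
      rw [Finset.sum_Icc_succ_top (by omega), pow_succ]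
      nlinarith [pow_pos (by omega : 0 < q) k]
  calc ((genElts q F n)ᶜ.card : ℝ) ≤ ((2 * q ^ (n / 2) : ℕ) : ℝ) := by
        exact_mod_cast h2.trans (h3 _)
    _ = 2 * √(q : ℝ) ^ (2 * (n / 2)) := by
        rw [pow_mul, Real.sq_sqrt (Nat.cast_nonneg _)]; push_cast; rfl
    _ ≤ 2 * √(q : ℝ) ^ n := by
        gcongr
        · exact Real.one_le_sqrt.2 (by exact_mod_cast (by omega : 1 ≤ q))
        · omega

end FiniteExtension

section PolynomialFinsets

/-- The polynomials of degree less than `m`. -/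
noncomputable def polysLT (q : ℕ) [NeZero q] (m : ℕ) : Finset (ZMod q)[X] :=
  Finset.univ.image (polyLT q m)

/-- The monic polynomials of degree `m`. -/
noncomputable def monics (q : ℕ) [NeZero q] (m : ℕ) : Finset (ZMod q)[X] :=
  Finset.univ.image (monicOfDeg q m)

variable {q m : ℕ}

lemma coeff_polyLT (v : Fin m → ZMod q) (i : Fin m) : (polyLT q m v).coeff i = v i := by
  simp only [polyLT, finsetSum_coeff, coeff_C_mul, coeff_X_pow]
  rw [Finset.sum_eq_single i] <;> simp +contextual [Fin.val_inj, eq_comm]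

lemma degree_polyLT_lt (v : Fin m → ZMod q) : (polyLT q m v).degree < m := by
  refine (degree_sum_le _ _).trans_lt ?_
  rw [Finset.sup_lt_iff (by exact WithBot.bot_lt_coe _)]
  exact fun i _ => (degree_C_mul_X_pow_le _ _).trans_lt (by exact_mod_cast i.2)

lemma polyLT_injective : Function.Injective (polyLT q m) := by
  intro v w h
  funext i
  rw [← coeff_polyLT v i, h, coeff_polyLT]

lemma monicOfDeg_injective : Function.Injective (monicOfDeg q m) := by
  intro v w h
  exact polyLT_injective (add_left_cancel h)

variable [Fact q.Prime]

@[simp] lemma mem_polysLT {B : (ZMod q)[X]} : B ∈ polysLT q m ↔ B.degree < m := by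
  simp only [polysLT, Finset.mem_image, Finset.mem_univ, true_and]
  constructor
  · rintro ⟨v, rfl⟩; exact degree_polyLT_lt v
  · intro h
    refine ⟨fun i => B.coeff i, ?_⟩
    ext k
    by_cases hk : k < m
    · exact coeff_polyLT (fun i : Fin m => B.coeff i) ⟨k, hk⟩
    · have hk' : (m : WithBot ℕ) ≤ k := by exact_mod_cast not_lt.1 hk
      rw [coeff_eq_zero_of_degree_lt (h.trans_le hk'),
        coeff_eq_zero_of_degree_lt ((degree_polyLT_lt _).trans_le hk')]

@[simp] lemma mem_monics {B : (ZMod q)[X]} : B ∈ monics q m ↔ B.Monic ∧ B.natDegree = m := by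
  simp only [monics, Finset.mem_image, Finset.mem_univ, true_and]
  constructor
  · rintro ⟨v, rfl⟩
    have h := degree_polyLT_lt v
    refine ⟨monic_X_pow_add h, natDegree_eq_of_degree_eq_some ?_⟩
    change (X ^ m + polyLT q m v).degree = (m : WithBot ℕ)
    rw [degree_add_eq_left_of_degree_lt (by rwa [degree_X_pow]), degree_X_pow]
  · rintro ⟨hB, hd⟩
    have h1 : B - X ^ m ∈ polysLT q m := by
      rw [mem_polysLT]
      have := degree_sub_lt_left (p := B) (q := X ^ m)
        (by rw [degree_X_pow, degree_eq_natDegree hB.ne_zero, hd])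
        hB.ne_zero (by rw [hB, monic_X_pow])
      rwa [degree_eq_natDegree hB.ne_zero, hd] at this
    simp only [polysLT, Finset.mem_image, Finset.mem_univ, true_and] at h1
    obtain ⟨v, hv⟩ := h1
    exact ⟨v, by change X ^ m + polyLT q m v = B; rw [hv]; ring⟩

lemma card_polysLT : (polysLT q m).card = q ^ m := by
  rw [polysLT, Finset.card_image_of_injective _ polyLT_injective]; simp [ZMod.card]

lemma card_monics : (monics q m).card = q ^ m := by
  rw [monics, Finset.card_image_of_injective _ monicOfDeg_injective]; simp [ZMod.card]

lemma sum_monicOfDeg {M : Type*} [AddCommMonoid M] (f : (ZMod q)[X] → M) :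
    ∑ v, f (monicOfDeg q m v) = ∑ B ∈ monics q m, f B := by
  rw [monics, Finset.sum_image monicOfDeg_injective.injOn]

end PolynomialFinsets

section PairCharacter

variable {q : ℕ} [Fact q.Prime] {F : Type*} [Field F] [Algebra (ZMod q) F] [Fintype F] {n : ℕ}

/-- The value at `B` of the quadratic character modulo the product of the minimal polynomials
of the two coordinates of `z`. -/
noncomputable def pairChar {q : ℕ} [Fact q.Prime] {F : Type*} [Field F] [Algebra (ZMod q) F]
    [Fintype F] (z : F × F) (B : (ZMod q)[X]) : ℤ :=
  quadraticChar F (aeval z.1 B) * quadraticChar F (aeval z.2 B)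

/-- The pairs of elements of degree `n` with distinct minimal polynomials. -/
noncomputable def genPairs (q : ℕ) [Fact q.Prime] (F : Type*) [Field F] [Algebra (ZMod q) F]
    [Fintype F] (n : ℕ) : Finset (F × F) :=
  (genElts q F n ×ˢ genElts q F n).filter
    fun z => minpoly (ZMod q) z.1 ≠ minpoly (ZMod q) z.2

lemma mem_genPairs {z : F × F} : z ∈ genPairs q F n ↔
    (minpoly (ZMod q) z.1).natDegree = n ∧ (minpoly (ZMod q) z.2).natDegree = n ∧
      minpoly (ZMod q) z.1 ≠ minpoly (ZMod q) z.2 := by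
  simp [genPairs, genElts, and_assoc]

/-- The monic irreducible polynomials of degree `n`. -/
noncomputable def irrs (q : ℕ) [Fact q.Prime] (n : ℕ) : Finset (ZMod q)[X] :=
  (monics q n).filter Irreducible

lemma mem_irrs {P : (ZMod q)[X]} : P ∈ irrs q n ↔ P.Monic ∧ Irreducible P ∧ P.natDegree = n := by
  simp only [irrs, Finset.mem_filter, mem_monics]; tauto

lemma minpoly_mem_irrs {x : F} (hx : x ∈ genElts q F n) : minpoly (ZMod q) x ∈ irrs q n := by
  have hxi : IsIntegral (ZMod q) x := Algebra.IsIntegral.isIntegral x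
  rw [mem_irrs]
  exact ⟨minpoly.monic hxi, minpoly.irreducible hxi, by simpa [genElts] using hx⟩

lemma card_filter_minpoly_eq (hF : Fintype.card F = q ^ n) {P : (ZMod q)[X]} (hP : P ∈ irrs q n) :
    ((genElts q F n).filter fun x => minpoly (ZMod q) x = P).card = n := by
  rw [mem_irrs] at hP
  refine Eq.trans ?_ (card_roots_of_irreducible hF hP.2.1 hP.2.2)
  congr 1
  ext x
  simp only [genElts, Finset.mem_filter, Finset.mem_univ, true_and]
  rw [← minpoly_eq_iff_of_irreducible hP.2.1 hP.1]
  constructor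
  · exact fun h => h.2
  · rintro rfl; exact ⟨hP.2.2, rfl⟩

lemma sum_genElts_minpoly (hF : Fintype.card F = q ^ n) {M : Type*} [AddCommMonoid M]
    (φ : (ZMod q)[X] → M) :
    ∑ x ∈ genElts q F n, φ (minpoly (ZMod q) x) = n • ∑ P ∈ irrs q n, φ P := by
  rw [← Finset.sum_fiberwise_of_maps_to (t := irrs q n) (g := fun x => minpoly (ZMod q) x)
    (fun x hx => minpoly_mem_irrs hx), Finset.smul_sum]
  refine Finset.sum_congr rfl fun P hP => ?_
  rw [Finset.sum_congr rfl (g := fun _ => φ P) (fun x hx => by rw [(Finset.mem_filter.1 hx).2]),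
    Finset.sum_const, card_filter_minpoly_eq hF hP]

lemma sum_genPairs_minpoly (hF : Fintype.card F = q ^ n) {M : Type*} [AddCommMonoid M]
    (φ : (ZMod q)[X] → (ZMod q)[X] → M) :
    ∑ z ∈ genPairs q F n, φ (minpoly (ZMod q) z.1) (minpoly (ZMod q) z.2) =
      (n ^ 2) • ∑ P ∈ irrs q n, ∑ Q ∈ irrs q n, if P ≠ Q then φ P Q else 0 := by
  rw [genPairs, Finset.sum_filter, Finset.sum_product]
  have := sum_genElts_minpoly hF (fun P => ∑ y ∈ genElts q F n,
    if P ≠ minpoly (ZMod q) y then φ P (minpoly (ZMod q) y) else 0)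
  rw [this, sq, mul_smul]
  congr 1
  rw [Finset.smul_sum]
  refine Finset.sum_congr rfl fun P _ => ?_
  exact sum_genElts_minpoly hF (fun Q => if P ≠ Q then φ P Q else 0)

lemma aeval_surjective_of_mem_genElts (hF : Fintype.card F = q ^ n) {x : F}
    (hx : x ∈ genElts q F n) : Function.Surjective (aeval (R := ZMod q) x) := by
  have hxi : IsIntegral (ZMod q) x := Algebra.IsIntegral.isIntegral x
  have h1 : (minpoly (ZMod q) x).natDegree = n := by simpa [genElts] using hx
  have hinj : Set.InjOn (aeval (R := ZMod q) x) (polysLT q n) := by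
    intro a ha b hb hab
    simp only [Finset.mem_coe, mem_polysLT] at ha hb
    have h2 : minpoly (ZMod q) x ∣ a - b := minpoly.dvd _ _ (by simp [hab])
    rw [← sub_eq_zero]
    refine eq_zero_of_dvd_of_degree_lt h2 ?_
    rw [degree_eq_natDegree (minpoly.ne_zero hxi), h1]
    exact (degree_sub_le _ _).trans_lt (max_lt ha hb)
  have h2 : (polysLT q n).image (aeval (R := ZMod q) x) = Finset.univ := by
    rw [← Finset.card_eq_iff_eq_univ, Finset.card_image_of_injOn hinj, card_polysLT, hF]
  intro y
  have := Finset.mem_univ y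
  rw [← h2, Finset.mem_image] at this
  obtain ⟨b, -, hb⟩ := this
  exact ⟨b, hb⟩

lemma resSym_minpoly (hF : Fintype.card F = q ^ n) {x : F} (hx : x ∈ genElts q F n)
    (B : (ZMod q)[X]) : resSym q B (minpoly (ZMod q) x) = quadraticChar F (aeval x B) := by
  rw [resSym, minpoly.dvd_iff, quadraticChar_apply, quadraticCharFun]
  congr 1
  refine if_congr ?_ rfl rfl
  constructor
  · rintro ⟨b, hb⟩
    rw [minpoly.dvd_iff, map_sub, sub_eq_zero, map_pow] at hb
    exact ⟨_, hb.trans (sq _)⟩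
  · rintro ⟨y, hy⟩
    obtain ⟨b, rfl⟩ := aeval_surjective_of_mem_genElts hF hx y
    exact ⟨b, by rw [minpoly.dvd_iff, map_sub, hy, map_pow]; ring⟩

lemma resSym_mul_resSym_minpoly (hF : Fintype.card F = q ^ n) {z : F × F}
    (hz : z ∈ genPairs q F n) (B : (ZMod q)[X]) :
    resSym q B (minpoly (ZMod q) z.1) * resSym q B (minpoly (ZMod q) z.2) = pairChar z B := by
  rw [mem_genPairs] at hz
  rw [resSym_minpoly hF (by simpa [genElts] using hz.1),
    resSym_minpoly hF (by simpa [genElts] using hz.2.1), pairChar]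

end PairCharacter

section PairCharacterSums

lemma sqrt_card {F : Type*} [Fintype F] {q n : ℕ} (hF : Fintype.card F = q ^ n) :
    √(Fintype.card F : ℝ) = √(q : ℝ) ^ n := by
  rw [hF]; push_cast
  rw [Real.sqrt_eq_iff_mul_self_eq (by positivity) (by positivity), ← mul_pow,
    Real.mul_self_sqrt (Nat.cast_nonneg _)]

variable {q : ℕ} [Fact q.Prime] {F : Type*} [Field F] [Algebra (ZMod q) F] {n : ℕ}

lemma aeval_ne_zero_of_natDegree_lt {x : F} (hx : (minpoly (ZMod q) x).natDegree = n)
    {A : (ZMod q)[X]} (hA : A ≠ 0) (hd : A.natDegree < n) : aeval x A ≠ 0 := by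
  intro h
  have := natDegree_le_of_dvd (minpoly.dvd _ _ h) hA
  omega

lemma ringChar_ne_two (hq2 : q ≠ 2) : ringChar F ≠ 2 := by
  have hp : CharP F q := charP_of_injective_algebraMap (algebraMap (ZMod q) F).injective q
  rwa [ringChar.eq F q]

variable [Fintype F]

lemma abs_quadraticChar_le_one (a : F) : |(quadraticChar F a : ℝ)| ≤ 1 := by
  by_cases h : a = 0
  · simp [h]
  · rcases quadraticChar_dichotomy h with h | h <;> simp [h]

lemma abs_pairChar_le_one (z : F × F) (B : (ZMod q)[X]) : |(pairChar z B : ℝ)| ≤ 1 := by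
  rw [pairChar]
  push_cast
  rw [abs_mul]
  exact mul_le_one₀ (abs_quadraticChar_le_one _) (abs_nonneg _) (abs_quadraticChar_le_one _)

lemma abs_sum_genElts_le (hq2 : q ≠ 2) (hF : Fintype.card F = q ^ n) (hn : 1 ≤ n)
    {B : (ZMod q)[X]} (hB : B.Monic) (hs : ¬ IsSquare B) (hd : B.natDegree ≤ n) :
    |∑ x ∈ genElts q F n, (quadraticChar F (aeval x B) : ℝ)| ≤ 17 * n * √(q : ℝ) ^ n := by
  have h1 := abs_sum_quadraticChar_eval_le (ringChar_ne_two (F := F) hq2)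
    (B.map (algebraMap (ZMod q) F)) (map_ne_C_mul_sq hq2 hB hs)
  rw [natDegree_map, sqrt_card hF] at h1
  simp only [eval_map_algebraMap] at h1
  rw [← Finset.sum_add_sum_compl (genElts q F n)] at h1
  have h2 : |∑ x ∈ (genElts q F n)ᶜ, (quadraticChar F (aeval x B) : ℝ)| ≤ 2 * √(q : ℝ) ^ n := by
    refine (Finset.abs_sum_le_sum_abs _ _).trans
      ((Finset.sum_le_card_nsmul _ _ 1 fun x _ => abs_quadraticChar_le_one _).trans ?_)
    simpa using card_compl_genElts_le hF hn
  have h3 : (1 : ℝ) ≤ n := by exact_mod_cast hn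
  have h4 : (B.natDegree : ℝ) ≤ n := by exact_mod_cast hd
  have h5 : 0 ≤ √(q : ℝ) ^ n := by positivity
  rw [abs_le] at h1 h2 ⊢
  constructor <;> nlinarith

/-- The pairs of elements of degree `n` with equal minimal polynomials are few. -/
lemma card_filter_minpoly_eq_minpoly_le (hF : Fintype.card F = q ^ n) :
    (((genElts q F n ×ˢ genElts q F n).filter
      fun z => ¬ minpoly (ZMod q) z.1 ≠ minpoly (ZMod q) z.2).card : ℝ) ≤ n * (q : ℝ) ^ n := by
  have h : ((genElts q F n ×ˢ genElts q F n).filter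
      fun z => ¬ minpoly (ZMod q) z.1 ≠ minpoly (ZMod q) z.2).card ≤ q ^ n * n := by
    rw [Finset.card_filter, Finset.sum_product]
    refine (Finset.sum_le_card_nsmul _ _ n fun x hx => ?_).trans ?_
    · rw [← Finset.card_filter]
      refine le_of_eq (Eq.trans ?_ (card_filter_minpoly_eq hF (minpoly_mem_irrs hx)))
      congr 1
      ext y
      simp [eq_comm]
    · rw [smul_eq_mul]
      gcongr
      exact (Finset.card_le_univ _).trans hF.le
  rw [mul_comm]
  exact_mod_cast h

lemma abs_sum_genPairs_le (hq2 : q ≠ 2) (hF : Fintype.card F = q ^ n) (hn : 1 ≤ n)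
    {B : (ZMod q)[X]} (hB : B.Monic) (hs : ¬ IsSquare B) (hd : B.natDegree ≤ n) :
    |∑ z ∈ genPairs q F n, (pairChar z B : ℝ)| ≤ 290 * n ^ 2 * (q : ℝ) ^ n := by
  have h1 := abs_sum_genElts_le hq2 hF hn hB hs hd
  have h2 : |∑ z ∈ (genElts q F n ×ˢ genElts q F n).filter
      (fun z => ¬ minpoly (ZMod q) z.1 ≠ minpoly (ZMod q) z.2), (pairChar z B : ℝ)|
      ≤ n * (q : ℝ) ^ n := by
    refine (Finset.abs_sum_le_sum_abs _ _).trans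
      ((Finset.sum_le_card_nsmul _ _ 1 fun x _ => abs_pairChar_le_one _ _).trans ?_)
    simpa using card_filter_minpoly_eq_minpoly_le hF
  have h3 : (∑ z ∈ genPairs q F n, (pairChar z B : ℝ)) +
      ∑ z ∈ (genElts q F n ×ˢ genElts q F n).filter
      (fun z => ¬ minpoly (ZMod q) z.1 ≠ minpoly (ZMod q) z.2), (pairChar z B : ℝ) =
      (∑ x ∈ genElts q F n, (quadraticChar F (aeval x B) : ℝ)) ^ 2 := by
    rw [genPairs, Finset.sum_filter_add_sum_filter_not, Finset.sum_product, sq,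
      Finset.sum_mul_sum]
    simp [pairChar]
  have h4 : (∑ x ∈ genElts q F n, (quadraticChar F (aeval x B) : ℝ)) ^ 2 ≤
      289 * n ^ 2 * (q : ℝ) ^ n := by
    rw [← sq_abs]
    calc _ ≤ (17 * n * √(q : ℝ) ^ n) ^ 2 := by gcongr
      _ = 289 * n ^ 2 * (√(q : ℝ) ^ 2) ^ n := by ring
      _ = _ := by rw [Real.sq_sqrt (Nat.cast_nonneg _)]
  have h6 : (1 : ℝ) ≤ n := by exact_mod_cast hn
  have h7 : (n : ℝ) * (q : ℝ) ^ n ≤ n ^ 2 * (q : ℝ) ^ n := by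
    gcongr; nlinarith
  have h8 := sq_nonneg (∑ x ∈ genElts q F n, (quadraticChar F (aeval x B) : ℝ))
  rw [abs_le] at h2 ⊢
  constructor <;> nlinarith

lemma pairChar_sq {z : F × F} (hz : z ∈ genPairs q F n) {A : (ZMod q)[X]} (hA : A ≠ 0)
    (hd : A.natDegree < n) : pairChar z (A ^ 2) = 1 := by
  rw [mem_genPairs] at hz
  simp only [pairChar, map_pow,
    quadraticChar_sq_one (aeval_ne_zero_of_natDegree_lt hz.1 hA hd),
    quadraticChar_sq_one (aeval_ne_zero_of_natDegree_lt hz.2.1 hA hd), one_mul]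

lemma pairChar_mul (z : F × F) (A B : (ZMod q)[X]) :
    pairChar z (A * B) = pairChar z A * pairChar z B := by
  simp only [pairChar, map_mul]; ring

lemma pairChar_C (z : F × F) {c : ZMod q} (hc : c ≠ 0) : pairChar z (C c) = 1 := by
  rw [pairChar, aeval_C, aeval_C, ← sq, quadraticChar_sq_one]
  simpa using hc

lemma card_genPairs_le (hF : Fintype.card F = q ^ n) :
    ((genPairs q F n).card : ℝ) ≤ (q : ℝ) ^ (2 * n) := by
  have := Finset.card_le_univ (genPairs q F n)
  rw [Fintype.card_prod, hF, ← pow_add, ← two_mul] at this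
  exact_mod_cast this

lemma le_card_genPairs (hF : Fintype.card F = q ^ n) (hn : 1 ≤ n) :
    (q : ℝ) ^ (2 * n) - 5 * n * √(q : ℝ) ^ (3 * n) ≤ (genPairs q F n).card := by
  have h1 := card_compl_genElts_le hF hn
  have h2 := card_filter_minpoly_eq_minpoly_le hF
  have h3 : (genPairs q F n).card + ((genElts q F n ×ˢ genElts q F n).filter
      fun z => ¬ minpoly (ZMod q) z.1 ≠ minpoly (ZMod q) z.2).card = (genElts q F n).card ^ 2 := by
    rw [genPairs, Finset.card_filter_add_card_filter_not, Finset.card_product, sq]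
  have h4 : (genElts q F n).card + (genElts q F n)ᶜ.card = q ^ n := by
    rw [Finset.card_add_card_compl, hF]
  have h3' : ((genPairs q F n).card : ℝ) + (((genElts q F n ×ˢ genElts q F n).filter
      fun z => ¬ minpoly (ZMod q) z.1 ≠ minpoly (ZMod q) z.2).card : ℝ) =
        ((genElts q F n).card : ℝ) ^ 2 := by exact_mod_cast h3
  have h4' : ((genElts q F n).card : ℝ) + ((genElts q F n)ᶜ.card : ℝ) = (q : ℝ) ^ n := by
    exact_mod_cast h4
  have h5 : (q : ℝ) ^ n = (√(q : ℝ) ^ n) ^ 2 := by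
    rw [← pow_mul, mul_comm, pow_mul, Real.sq_sqrt (Nat.cast_nonneg _)]
  have h6 : (q : ℝ) ^ (2 * n) = (√(q : ℝ) ^ n) ^ 4 := by
    rw [mul_comm, pow_mul, h5]; ring
  have h7 : √(q : ℝ) ^ (3 * n) = (√(q : ℝ) ^ n) ^ 3 := by
    rw [mul_comm, pow_mul]
  have h8 : 1 ≤ √(q : ℝ) ^ n := one_le_pow₀ (Real.one_le_sqrt.2
    (by exact_mod_cast (Fact.out : q.Prime).one_le))
  have h9 : (1 : ℝ) ≤ n := by exact_mod_cast hn
  rw [h6, h7]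
  rw [h5] at h2 h4'
  generalize √(q : ℝ) ^ n = v at *
  have h10 : ((genElts q F n).card : ℝ) = v ^ 2 - ((genElts q F n)ᶜ.card : ℝ) := by linarith
  have h11 : (n : ℝ) * v ^ 2 ≤ n * v ^ 3 := by
    gcongr
    norm_num
  rw [h10] at h3'
  have h12 : (0 : ℝ) ≤ ((genElts q F n)ᶜ.card : ℝ) := by positivity
  have h13 : v ^ 2 * ((genElts q F n)ᶜ.card : ℝ) ≤ v ^ 2 * (2 * v) := by gcongr
  have h14 : (0 : ℝ) ≤ v ^ 3 * (n - 1) := mul_nonneg (by positivity) (by linarith)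
  nlinarith [sq_nonneg ((genElts q F n)ᶜ.card : ℝ)]

end PairCharacterSums

section GaussSum

variable {F : Type*} [Field F] [Fintype F]

/-- The quadratic Gauss sum of an additive character. -/
noncomputable def quadGauss (ψ : AddChar F ℂ) : ℂ := ∑ a, (quadraticChar F a : ℂ) * ψ a

lemma sum_quadraticChar_mul_addChar (h2 : ringChar F ≠ 2) (ψ : AddChar F ℂ) (b : F) :
    ∑ a, (quadraticChar F a : ℂ) * ψ (a * b) = quadraticChar F b * quadGauss ψ := by
  by_cases hb : b = 0
  · subst hb
    simp only [mul_zero, AddChar.map_zero_eq_one, mul_one, MulChar.map_zero, Int.cast_zero,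
      zero_mul]
    exact_mod_cast quadraticChar_sum_zero h2
  · rw [quadGauss, Finset.mul_sum]
    refine Fintype.sum_equiv (Equiv.mulRight₀ b hb) _ _ fun a => ?_
    have h : (quadraticChar F b : ℂ) * quadraticChar F b = 1 := by
      exact_mod_cast (sq (quadraticChar F b)).symm.trans (quadraticChar_sq_one hb)
    change _ = _ * (((quadraticChar F (a * b) : ℤ) : ℂ) * ψ (a * b))
    rw [map_mul (quadraticChar F), Int.cast_mul]
    linear_combination (-(quadraticChar F a : ℂ) * ψ (a * b)) * h

lemma sum_addChar_sq (h2 : ringChar F ≠ 2) {ψ : AddChar F ℂ} (hψ : ψ ≠ 0) :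
    ∑ a, ψ (a ^ 2) = quadGauss ψ := by
  have h0 : ∑ a, ψ a = 0 := AddChar.sum_eq_zero_of_ne_one hψ
  have h1 : ∑ a, ψ (a ^ 2) = ∑ u, ((quadraticChar F u : ℂ) + 1) * ψ u := by
    rw [← Finset.sum_fiberwise_of_maps_to (t := Finset.univ) (g := fun a : F => a ^ 2)
      (fun a _ => Finset.mem_univ _)]
    refine Finset.sum_congr rfl fun u _ => ?_
    rw [Finset.sum_congr rfl (g := fun _ => ψ u) (fun x hx => by rw [(Finset.mem_filter.1 hx).2]),
      Finset.sum_const, nsmul_eq_mul]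
    congr 1
    have := quadraticChar_card_sqrts h2 u
    rw [← Int.cast_one, ← Int.cast_add, ← this, Int.cast_natCast]
    congr 2
    ext a
    simp
  rw [h1, quadGauss]
  simp only [add_mul, one_mul, Finset.sum_add_distrib, h0, add_zero]

end GaussSum

section Duality

variable {q : ℕ} [Fact q.Prime] {F : Type*} [Field F] [Algebra (ZMod q) F] [Fintype F] {n : ℕ}
  {z : F × F}

lemma eq_zero_of_aeval_pair_eq_zero (hz : z ∈ genPairs q F n) {B : (ZMod q)[X]}
    (hd : B.degree < (2 * n : ℕ)) (h1 : aeval z.1 B = 0) (h2 : aeval z.2 B = 0) : B = 0 := by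
  rw [mem_genPairs] at hz
  have hi1 : IsIntegral (ZMod q) z.1 := Algebra.IsIntegral.isIntegral _
  have hi2 : IsIntegral (ZMod q) z.2 := Algebra.IsIntegral.isIntegral _
  have hc : IsCoprime (minpoly (ZMod q) z.1) (minpoly (ZMod q) z.2) := by
    rw [(minpoly.irreducible hi1).coprime_iff_not_dvd]
    intro h
    exact hz.2.2 (eq_of_monic_of_associated (minpoly.monic hi1) (minpoly.monic hi2)
      ((minpoly.irreducible hi1).associated_of_dvd (minpoly.irreducible hi2) h))
  refine eq_zero_of_dvd_of_degree_lt (hc.mul_dvd (minpoly.dvd _ _ h1) (minpoly.dvd _ _ h2)) ?_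
  rw [degree_mul, degree_eq_natDegree (minpoly.ne_zero hi1), degree_eq_natDegree
    (minpoly.ne_zero hi2), hz.1, hz.2.1]
  refine hd.trans_eq ?_
  rw [two_mul]; rfl

lemma sum_polysLT_aeval_pair (hF : Fintype.card F = q ^ n) (hz : z ∈ genPairs q F n)
    {M : Type*} [AddCommMonoid M] (f : F × F → M) :
    ∑ B ∈ polysLT q (2 * n), f (aeval z.1 B, aeval z.2 B) = ∑ w, f w := by
  have hinj : Set.InjOn (fun B : (ZMod q)[X] => (aeval z.1 B, aeval z.2 B))
      (polysLT q (2 * n)) := by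
    intro a ha b hb hab
    simp only [Finset.mem_coe, mem_polysLT] at ha hb
    simp only [Prod.mk.injEq] at hab
    rw [← sub_eq_zero]
    exact eq_zero_of_aeval_pair_eq_zero hz ((degree_sub_le _ _).trans_lt (max_lt ha hb))
      (by simp [hab.1]) (by simp [hab.2])
  have h2 : (polysLT q (2 * n)).image (fun B : (ZMod q)[X] => (aeval z.1 B, aeval z.2 B)) =
      Finset.univ := by
    rw [← Finset.card_eq_iff_eq_univ, Finset.card_image_of_injOn hinj, card_polysLT,
      Fintype.card_prod, hF, ← pow_add, two_mul]
  rw [← h2, Finset.sum_image hinj]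

/-- The top coefficient of the residue modulo the product of the minimal polynomials is a sum of
functionals of the two coordinates. -/
lemma exists_coeff_functional (hF : Fintype.card F = q ^ n) (hz : z ∈ genPairs q F n) :
    ∃ Λ₁ Λ₂ : F →ₗ[ZMod q] ZMod q, ∀ B : (ZMod q)[X], B.degree < (2 * n : ℕ) →
      Λ₁ (aeval z.1 B) + Λ₂ (aeval z.2 B) = B.coeff (2 * n - 1) := by
  set ev : degreeLT (ZMod q) (2 * n) →ₗ[ZMod q] F × F :=
    ((aeval z.1).toLinearMap.prod (aeval z.2).toLinearMap).domRestrict _ with hev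
  have hev' : ∀ B, ev B = (aeval z.1 B.1, aeval z.2 B.1) := fun B => rfl
  have hinj : Function.Injective ev := by
    rw [← LinearMap.ker_eq_bot, LinearMap.ker_eq_bot']
    rintro ⟨B, hB⟩ h
    rw [hev', Prod.mk_eq_zero] at h
    exact Subtype.ext (eq_zero_of_aeval_pair_eq_zero hz (mem_degreeLT.1 hB) h.1 h.2)
  have hfr : Module.finrank (ZMod q) (degreeLT (ZMod q) (2 * n)) =
      Module.finrank (ZMod q) (F × F) := by
    rw [Module.finrank_prod, finrank_of_card hF, (degreeLTEquiv (ZMod q) (2 * n)).finrank_eq,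
      Module.finrank_fin_fun, two_mul]
  have hsurj : Function.Surjective ev := by
    rw [← LinearMap.range_eq_top]
    apply Submodule.eq_top_of_finrank_eq
    rw [LinearMap.finrank_range_of_inj hinj, hfr]
  set e := LinearEquiv.ofBijective ev ⟨hinj, hsurj⟩ with he
  set Λ : F × F →ₗ[ZMod q] ZMod q :=
    (lcoeff (ZMod q) (2 * n - 1)).comp ((degreeLT (ZMod q) (2 * n)).subtype.comp
      e.symm.toLinearMap) with hΛ
  refine ⟨Λ.comp (LinearMap.inl _ _ _), Λ.comp (LinearMap.inr _ _ _), fun B hB => ?_⟩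
  have h1 : Λ (ev ⟨B, mem_degreeLT.2 hB⟩) = B.coeff (2 * n - 1) := by
    have : e.symm (ev ⟨B, mem_degreeLT.2 hB⟩) = ⟨B, mem_degreeLT.2 hB⟩ := by
      rw [LinearEquiv.symm_apply_eq]; rfl
    simp only [hΛ, LinearMap.comp_apply, LinearEquiv.coe_coe, this]
    rfl
  clear_value Λ
  change Λ (aeval z.1 B, 0) + Λ (0, aeval z.2 B) = _
  rw [← h1, ← map_add, hev']
  simp

/-- Orthogonality relation for the additive character attached to the leading coefficient of the
residue of `u * B`. -/
lemma sum_stdAddChar_mul {l : (ZMod q)[X] →+ ZMod q} (hn : 1 ≤ n)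
    (hl : ∀ B : (ZMod q)[X], B.degree < (2 * n : ℕ) → l B = B.coeff (2 * n - 1))
    {m : ℕ} (hm : m ≤ 2 * n) {u : (ZMod q)[X]} (hu : u.degree < (2 * n : ℕ)) :
    ∑ B ∈ polysLT q m, ZMod.stdAddChar (l (u * B)) =
      if u.degree < (2 * n - m : ℕ) then (q : ℂ) ^ m else 0 := by
  split_ifs with h
  · rw [Finset.sum_congr rfl (g := fun _ => 1), Finset.sum_const, card_polysLT]
    · simp
    · intro B hB
      rw [mem_polysLT] at hB
      have hd : (u * B).degree < (2 * n - 1 : ℕ) := by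
        by_cases hu0 : u = 0
        · simp only [hu0, zero_mul, degree_zero]; exact WithBot.bot_lt_coe _
        by_cases hB0 : B = 0
        · simp only [hB0, mul_zero, degree_zero]; exact WithBot.bot_lt_coe _
        rw [degree_mul, degree_eq_natDegree hu0, degree_eq_natDegree hB0] at *
        norm_cast at *
        omega
      rw [hl _ (hd.trans_le (by exact_mod_cast Nat.sub_le _ _)), coeff_eq_zero_of_degree_lt hd,
        AddChar.map_zero_eq_one]
  · have hu0 : u ≠ 0 := by
      rintro rfl
      exact h (by rw [degree_zero]; exact WithBot.bot_lt_coe _)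
    rw [degree_eq_natDegree hu0] at h hu
    norm_cast at h hu
    set B0 : (ZMod q)[X] := C (u.leadingCoeff⁻¹) * X ^ (2 * n - 1 - u.natDegree) with hB0
    have hB0d : B0.degree < m := by
      refine (degree_C_mul_X_pow_le _ _).trans_lt ?_
      norm_cast
      omega
    have hval : l (u * B0) = 1 := by
      rw [hl]
      · have : (2 * n - 1) = u.natDegree + (2 * n - 1 - u.natDegree) := by omega
        rw [hB0, ← mul_assoc]
        generalize 2 * n - 1 - u.natDegree = e at this
        rw [this, coeff_mul_X_pow, coeff_mul_C]
        exact mul_inv_cancel₀ (leadingCoeff_ne_zero.2 hu0)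
      · rw [degree_mul]
        refine (add_le_add_right (degree_C_mul_X_pow_le _ _) _).trans_lt ?_
        rw [degree_eq_natDegree hu0]
        norm_cast
        omega
    have hne : ZMod.stdAddChar (l (u * B0)) ≠ (1 : ℂ) := by
      rw [hval]
      intro h1
      have := ZMod.injective_stdAddChar (N := q) (h1.trans (AddChar.map_zero_eq_one _).symm)
      exact one_ne_zero this
    have hS : (∑ B ∈ polysLT q m, ZMod.stdAddChar (l (u * B))) * ZMod.stdAddChar (l (u * B0)) =
        ∑ B ∈ polysLT q m, ZMod.stdAddChar (l (u * B)) := by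
      rw [Finset.sum_mul]
      refine Finset.sum_bij' (fun B _ => B + B0) (fun B _ => B - B0) ?_ ?_ ?_ ?_ ?_
      · intro B hB
        rw [mem_polysLT] at *
        exact (degree_add_le _ _).trans_lt (max_lt hB hB0d)
      · intro B hB
        rw [mem_polysLT] at *
        exact (degree_sub_le _ _).trans_lt (max_lt hB hB0d)
      · intro B _; ring
      · intro B _; ring
      · intro B _
        rw [mul_add, map_add, AddChar.map_add_eq_mul]
    have h3 : (∑ B ∈ polysLT q m, ZMod.stdAddChar (l (u * B))) *
        (ZMod.stdAddChar (l (u * B0)) - 1) = 0 := by rw [mul_sub, hS]; ring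
    exact (mul_eq_zero.1 h3).resolve_right (sub_ne_zero.2 hne)

/-- The quadratic form `B ↦ [t ^ (2n-1)] B ^ 2` is hyperbolic. -/
lemma sum_stdAddChar_sq {l : (ZMod q)[X] →+ ZMod q} (hq2 : q ≠ 2) (hn : 1 ≤ n)
    (hl : ∀ B : (ZMod q)[X], B.degree < (2 * n : ℕ) → l B = B.coeff (2 * n - 1)) :
    ∑ B ∈ polysLT q (2 * n), ZMod.stdAddChar (l (B ^ 2)) = (q : ℂ) ^ n := by
  have h2 : (2 : ZMod q) ≠ 0 := by
    have : Fact (2 < q) := ⟨by have := (Fact.out : q.Prime).two_le; omega⟩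
    intro h
    have h' : ((2 : ℕ) : ZMod q) = 0 := by exact_mod_cast h
    rw [ZMod.natCast_eq_zero_iff] at h'
    exact hq2 ((Nat.prime_dvd_prime_iff_eq Fact.out Nat.prime_two).1 h')
  have hsplit : ∑ B ∈ polysLT q (2 * n), ZMod.stdAddChar (l (B ^ 2)) =
      ∑ b ∈ polysLT q n, ∑ a ∈ polysLT q n, ZMod.stdAddChar (l ((a + X ^ n * b) ^ 2)) := by
    rw [← Finset.sum_product']
    symm
    refine Finset.sum_bij' (fun p _ => p.2 + X ^ n * p.1)
      (fun B _ => (B /ₘ X ^ n, B %ₘ X ^ n)) ?_ ?_ ?_ ?_ ?_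
    · rintro ⟨b, a⟩ h
      simp only [Finset.mem_product, mem_polysLT] at h ⊢
      refine (degree_add_le _ _).trans_lt (max_lt (h.2.trans_le ?_) ?_)
      · exact_mod_cast (by omega : n ≤ 2 * n)
      · by_cases hb : b = 0
        · simp only [hb, mul_zero, degree_zero]; exact WithBot.bot_lt_coe _
        · have h1 := h.1
          rw [degree_mul, degree_X_pow, degree_eq_natDegree hb] at *
          norm_cast at *
          omega
    · intro B hB
      simp only [Finset.mem_product, mem_polysLT] at hB ⊢
      constructor
      · by_cases h0 : B /ₘ X ^ n = 0
        · rw [h0, degree_zero]; exact WithBot.bot_lt_coe _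
        rw [degree_eq_natDegree h0]
        norm_cast
        rw [natDegree_divByMonic _ (monic_X_pow n), natDegree_X_pow]
        have hB0 : B ≠ 0 := by rintro rfl; simp at h0
        rw [degree_eq_natDegree hB0] at hB
        norm_cast at hB
        omega
      · exact (degree_modByMonic_lt _ (monic_X_pow n)).trans_eq (degree_X_pow n)
    · rintro ⟨b, a⟩ h
      simp only [Finset.mem_product, mem_polysLT] at h
      have := div_modByMonic_unique (f := a + X ^ n * b) b a (monic_X_pow (R := ZMod q) n)
        ⟨rfl, by rw [degree_X_pow]; exact h.2⟩
      exact Prod.ext this.1 this.2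
    · intro B _
      exact modByMonic_add_div B (X ^ n)
    · intro p _; rfl
  rw [hsplit]
  have hin : ∀ b ∈ polysLT q n, ∑ a ∈ polysLT q n, ZMod.stdAddChar (l ((a + X ^ n * b) ^ 2)) =
      if b = 0 then (q : ℂ) ^ n else 0 := by
    intro b hb
    rw [mem_polysLT] at hb
    have hterm : ∀ a ∈ polysLT q n, (ZMod.stdAddChar (l ((a + X ^ n * b) ^ 2)) : ℂ) =
        ZMod.stdAddChar (l ((C 2 * X ^ n * b) * a)) * ZMod.stdAddChar (l ((X ^ n * b) ^ 2)) := by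
      intro a ha
      rw [mem_polysLT] at ha
      have ha2 : l (a ^ 2) = 0 := by
        have hd : (a ^ 2).degree < (2 * n - 1 : ℕ) := by
          by_cases ha0 : a = 0
          · rw [ha0, zero_pow two_ne_zero, degree_zero]; exact WithBot.bot_lt_coe _
          rw [sq, degree_mul, degree_eq_natDegree ha0] at *
          norm_cast at *
          omega
        rw [hl _ (hd.trans_le (by exact_mod_cast Nat.sub_le _ _)), coeff_eq_zero_of_degree_lt hd]
      have : (a + X ^ n * b) ^ 2 = a ^ 2 + ((C 2 * X ^ n * b) * a + (X ^ n * b) ^ 2) := by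
        rw [C_ofNat]; ring
      rw [this, map_add l, ha2, zero_add, map_add l, AddChar.map_add_eq_mul]
    rw [Finset.sum_congr rfl hterm, ← Finset.sum_mul]
    have hdeg : b ≠ 0 → (C 2 * X ^ n * b).degree = ((n + b.natDegree : ℕ) : WithBot ℕ) := by
      intro hb0
      rw [degree_mul, degree_C_mul_X_pow n h2, degree_eq_natDegree hb0]
      rfl
    rw [sum_stdAddChar_mul hn hl (by omega)]
    · by_cases hb0 : b = 0
      · subst hb0
        rw [if_pos rfl, if_pos (by simp only [mul_zero, degree_zero]; exact WithBot.bot_lt_coe _)]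
        simp
      · rw [if_neg hb0, if_neg, zero_mul]
        rw [hdeg hb0]
        norm_cast
        omega
    · by_cases hb0 : b = 0
      · simp only [hb0, mul_zero, degree_zero]; exact WithBot.bot_lt_coe _
      · rw [hdeg hb0]
        rw [degree_eq_natDegree hb0] at hb
        norm_cast at hb ⊢
        omega
  rw [Finset.sum_congr rfl hin, Finset.sum_ite_eq', if_pos]
  rw [mem_polysLT, degree_zero]; exact WithBot.bot_lt_coe _

/-- The sum of the pair character over all polynomials of degree less than `m`. -/
noncomputable def charSumLT {q : ℕ} [Fact q.Prime] {F : Type*} [Field F] [Algebra (ZMod q) F]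
    [Fintype F] (z : F × F) (m : ℕ) : ℤ :=
  ∑ B ∈ polysLT q m, pairChar z B

lemma pairChar_zero (z : F × F) : pairChar (q := q) z 0 = 0 := by
  simp [pairChar]

lemma charSumLT_zero (z : F × F) : charSumLT (q := q) z 0 = 0 := by
  rw [charSumLT]
  refine Finset.sum_eq_zero fun B hB => ?_
  rw [mem_polysLT, Nat.cast_zero, Nat.WithBot.lt_zero_iff, degree_eq_bot] at hB
  rw [hB, pairChar_zero]

lemma stdAddChar_comp_ne_zero {Λ : F →ₗ[ZMod q] ZMod q} (h : Λ ≠ 0) :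
    (ZMod.stdAddChar (N := q)).compAddMonoidHom (Λ : F →+ ZMod q) ≠ 0 := by
  obtain ⟨a, ha⟩ : ∃ a, Λ a ≠ 0 := by
    by_contra! h'
    exact h (LinearMap.ext h')
  intro h0
  have h1 := DFunLike.congr_fun h0 a
  rw [AddChar.compAddMonoidHom_apply, AddChar.zero_apply] at h1
  exact ha (ZMod.injective_stdAddChar (h1.trans (AddChar.map_zero_eq_one _).symm))

/-- The functional equation for the character sums over polynomials of bounded degree. -/
theorem charSumLT_duality (hq2 : q ≠ 2) (hF : Fintype.card F = q ^ n) (hn : 1 ≤ n)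
    (hz : z ∈ genPairs q F n) {m : ℕ} (hm : m ≤ 2 * n) :
    (q : ℤ) ^ n * charSumLT (q := q) z m = (q : ℤ) ^ m * charSumLT (q := q) z (2 * n - m) := by
  have hr := ringChar_ne_two (F := F) hq2
  obtain ⟨Λ₁, Λ₂, hΛ⟩ := exists_coeff_functional hF hz
  set ψ₁ : AddChar F ℂ := (ZMod.stdAddChar (N := q)).compAddMonoidHom (Λ₁ : F →+ ZMod q) with hψ₁
  set ψ₂ : AddChar F ℂ := (ZMod.stdAddChar (N := q)).compAddMonoidHom (Λ₂ : F →+ ZMod q) with hψ₂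
  set l : (ZMod q)[X] →+ ZMod q :=
    ((Λ₁ : F →+ ZMod q).comp (aeval (R := ZMod q) z.1 : (ZMod q)[X] →+ F)) +
    ((Λ₂ : F →+ ZMod q).comp (aeval (R := ZMod q) z.2 : (ZMod q)[X] →+ F)) with hldef
  have hl' : ∀ B, l B = Λ₁ (aeval z.1 B) + Λ₂ (aeval z.2 B) := fun B => rfl
  have hl : ∀ B : (ZMod q)[X], B.degree < (2 * n : ℕ) → l B = B.coeff (2 * n - 1) := hΛ
  have hψl : ∀ B, ZMod.stdAddChar (l B) = ψ₁ (aeval z.1 B) * ψ₂ (aeval z.2 B) := by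
    intro B
    rw [hl', AddChar.map_add_eq_mul]
    rfl
  have hz' := mem_genPairs.1 hz
  have hi1 : IsIntegral (ZMod q) z.1 := Algebra.IsIntegral.isIntegral _
  have hi2 : IsIntegral (ZMod q) z.2 := Algebra.IsIntegral.isIntegral _
  have hkey : ∀ P : (ZMod q)[X], P.Monic → P.natDegree = n → l (P * X ^ (n - 1)) = 1 := by
    intro P hP hPn
    have hd : (P * X ^ (n - 1)).natDegree = 2 * n - 1 := by
      rw [natDegree_mul hP.ne_zero (pow_ne_zero _ X_ne_zero), hPn, natDegree_X_pow]; omega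
    have hmon : (P * X ^ (n - 1)).Monic := hP.mul (monic_X_pow _)
    rw [hl, ← hd]
    · exact hmon
    · rw [degree_eq_natDegree hmon.ne_zero, hd]
      norm_cast
      omega
  have h1 : Λ₁ ≠ 0 := by
    intro h0
    have := hkey _ (minpoly.monic hi2) hz'.2.1
    rw [hl', h0] at this
    simp at this
  have h2 : Λ₂ ≠ 0 := by
    intro h0
    have := hkey _ (minpoly.monic hi1) hz'.1
    rw [hl', h0] at this
    simp at this
  have hgauss : quadGauss ψ₁ * quadGauss ψ₂ = (q : ℂ) ^ n := by
    rw [← sum_stdAddChar_sq hq2 hn hl, ← sum_addChar_sq hr (stdAddChar_comp_ne_zero h1),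
      ← sum_addChar_sq hr (stdAddChar_comp_ne_zero h2), Finset.sum_mul_sum,
      ← Fintype.sum_prod_type']
    rw [← sum_polysLT_aeval_pair hF hz]
    refine Finset.sum_congr rfl fun B _ => ?_
    rw [hψl, map_pow (aeval z.1), map_pow (aeval z.2)]
  have hexp : ∀ B : (ZMod q)[X], (q : ℂ) ^ n * (pairChar z B : ℂ) =
      ∑ u ∈ polysLT q (2 * n), (pairChar z u : ℂ) * ZMod.stdAddChar (l (u * B)) := by
    intro B
    have e1 := sum_quadraticChar_mul_addChar hr ψ₁ (aeval z.1 B)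
    have e2 := sum_quadraticChar_mul_addChar hr ψ₂ (aeval z.2 B)
    have e3 : ∑ u ∈ polysLT q (2 * n), (pairChar z u : ℂ) * ZMod.stdAddChar (l (u * B)) =
        ∑ w : F × F, ((quadraticChar F w.1 : ℂ) * ψ₁ (w.1 * aeval z.1 B)) *
          ((quadraticChar F w.2 : ℂ) * ψ₂ (w.2 * aeval z.2 B)) := by
      rw [← sum_polysLT_aeval_pair hF hz]
      refine Finset.sum_congr rfl fun u _ => ?_
      rw [hψl, map_mul (aeval z.1), map_mul (aeval z.2), pairChar]
      push_cast
      ring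
    rw [e3, Fintype.sum_prod_type]
    dsimp only
    rw [← Finset.sum_mul_sum, e1, e2, ← hgauss, pairChar]
    push_cast
    ring
  have hfin : (q : ℂ) ^ n * (charSumLT (q := q) z m : ℂ) =
      (q : ℂ) ^ m * (charSumLT (q := q) z (2 * n - m) : ℂ) := by
    rw [charSumLT, charSumLT]
    push_cast
    rw [Finset.mul_sum, Finset.sum_congr rfl (fun B _ => hexp B), Finset.sum_comm, Finset.mul_sum]
    have hsub : polysLT q (2 * n - m) =
        (polysLT q (2 * n)).filter fun u => u.degree < ((2 * n - m : ℕ) : WithBot ℕ) := by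
      ext u
      simp only [Finset.mem_filter, mem_polysLT]
      constructor
      · exact fun h => ⟨h.trans_le (by exact_mod_cast Nat.sub_le _ _), h⟩
      · exact fun h => h.2
    rw [hsub, Finset.sum_filter]
    refine Finset.sum_congr rfl fun u hu => ?_
    rw [← Finset.mul_sum, sum_stdAddChar_mul hn hl hm (mem_polysLT.1 hu)]
    split_ifs <;> ring
  exact_mod_cast hfin

/-- The sum of the pair character over the monic polynomials of degree `m`. -/
noncomputable def charSumMonic {q : ℕ} [Fact q.Prime] {F : Type*} [Field F] [Algebra (ZMod q) F]
    [Fintype F] (z : F × F) (m : ℕ) : ℤ :=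
  ∑ B ∈ monics q m, pairChar z B

lemma charSumLT_succ (z : F × F) (m : ℕ) :
    charSumLT (q := q) z (m + 1) =
      charSumLT (q := q) z m + (q - 1) * charSumMonic (q := q) z m := by
  have hdis : polysLT q (m + 1) = polysLT q m ∪
      ((Finset.univ.filter fun c : ZMod q => c ≠ 0) ×ˢ monics q m).image fun p => C p.1 * p.2 := by
    ext B
    simp only [mem_polysLT, Finset.mem_union, Finset.mem_image, Finset.mem_product,
      Finset.mem_filter, Finset.mem_univ, true_and, mem_monics, Prod.exists]
    constructor
    · intro h
      by_cases hB : B.degree < m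
      · exact Or.inl hB
      · right
        have hB0 : B ≠ 0 := by
          rintro rfl; exact hB (by rw [degree_zero]; exact WithBot.bot_lt_coe _)
        rw [degree_eq_natDegree hB0] at h hB
        norm_cast at h hB
        have hl := leadingCoeff_ne_zero.2 hB0
        refine ⟨B.leadingCoeff, B * C (B.leadingCoeff⁻¹), ⟨hl, monic_mul_leadingCoeff_inv hB0, ?_⟩,
          ?_⟩
        · rw [natDegree_mul_C (inv_ne_zero hl)]; omega
        · rw [mul_comm, mul_assoc, ← C_mul, inv_mul_cancel₀ hl, C_1, mul_one]
    · rintro (h | ⟨c, D, ⟨hc, hD, hDm⟩, rfl⟩)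
      · exact h.trans (by exact_mod_cast Nat.lt_succ_self m)
      · rw [degree_C_mul hc, degree_eq_natDegree hD.ne_zero, hDm]
        exact_mod_cast Nat.lt_succ_self m
  rw [charSumLT, hdis, Finset.sum_union, Finset.sum_image, Finset.sum_product]
  · rw [charSumLT, charSumMonic]
    congr 1
    rw [Finset.sum_congr rfl (g := fun _ => ∑ B ∈ monics q m, pairChar z B)]
    · rw [Finset.sum_const, nsmul_eq_mul]
      congr 1
      rw [Finset.filter_ne', Finset.card_erase_of_mem (Finset.mem_univ _), Finset.card_univ,
        ZMod.card, Nat.cast_pred (Fact.out : q.Prime).pos]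
    · intro c hc
      refine Finset.sum_congr rfl fun B _ => ?_
      dsimp only
      rw [pairChar_mul, pairChar_C z (by simpa using hc), one_mul]
  · rintro ⟨c, D⟩ h ⟨c', D'⟩ h' heq
    simp only [Finset.coe_product, Set.mem_prod, Finset.mem_coe, Finset.mem_filter,
      mem_monics] at h h'
    dsimp only at heq
    have hc := congrArg leadingCoeff heq
    simp only [leadingCoeff_mul, leadingCoeff_C, h.2.1.leadingCoeff, h'.2.1.leadingCoeff,
      mul_one] at hc
    subst hc
    rw [mul_left_cancel₀ (C_ne_zero.2 h.1.2) heq]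
  · rw [Finset.disjoint_left]
    rintro B hB hB'
    simp only [Finset.mem_image, Finset.mem_product,
      Finset.mem_filter, Finset.mem_univ, true_and, mem_monics, Prod.exists, mem_polysLT] at hB hB'
    obtain ⟨c, D, ⟨hc, hD, hDm⟩, rfl⟩ := hB'
    rw [degree_C_mul hc, degree_eq_natDegree hD.ne_zero, hDm] at hB
    exact lt_irrefl _ hB

end Duality

section SquarefreeDecomposition

variable {K : Type*} [Field K]

lemma dvd_of_sq_dvd_squarefree_mul_sq {A A' D : K[X]} (hD : Squarefree D) (hA : A ≠ 0)
    (h : A ^ 2 ∣ D * A' ^ 2) : A ∣ A' := by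
  set g := EuclideanDomain.gcd A A' with hg
  have hg0 : g ≠ 0 := by
    rw [hg, Ne, EuclideanDomain.gcd_eq_zero_iff]
    exact fun h => hA h.1
  obtain ⟨a, ha⟩ := EuclideanDomain.gcd_dvd_left A A'
  obtain ⟨a', ha'⟩ := EuclideanDomain.gcd_dvd_right A A'
  rw [← hg] at ha ha'
  have hco : IsCoprime a a' := by
    obtain ⟨x, y, hxy⟩ : ∃ x y, g = A * x + A' * y :=
      ⟨_, _, EuclideanDomain.gcd_eq_gcd_ab A A'⟩
    refine ⟨x, y, mul_left_cancel₀ hg0 ?_⟩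
    linear_combination -hxy + -x * ha + -y * ha'
  have h1 : a ^ 2 ∣ D * a' ^ 2 := by
    have h2 : g ^ 2 * a ^ 2 ∣ g ^ 2 * (D * a' ^ 2) := by
      convert h using 1
      · rw [ha]; ring
      · rw [ha']; ring
    exact (mul_dvd_mul_iff_left (pow_ne_zero 2 hg0)).1 h2
  have h3 : a ^ 2 ∣ D := (hco.pow (m := 2) (n := 2)).dvd_of_dvd_mul_right h1
  have h4 : IsUnit a := hD a (by rwa [← sq])
  rw [ha, ha']
  exact mul_dvd_mul_left _ h4.dvd

lemma eq_of_squarefree_mul_sq_eq {A A' D D' : K[X]} (hA : A.Monic) (hA' : A'.Monic)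
    (hD : Squarefree D) (hD' : Squarefree D') (h : D * A ^ 2 = D' * A' ^ 2) :
    A = A' ∧ D = D' := by
  have h2 : A = A' := eq_of_monic_of_associated hA hA' (associated_of_dvd_dvd
    (dvd_of_sq_dvd_squarefree_mul_sq hD' hA.ne_zero (by rw [← h]; exact dvd_mul_left _ _))
    (dvd_of_sq_dvd_squarefree_mul_sq hD hA'.ne_zero (by rw [h]; exact dvd_mul_left _ _)))
  subst h2
  exact ⟨rfl, mul_right_cancel₀ (pow_ne_zero 2 hA.ne_zero) h⟩

lemma exists_squarefree_mul_sq : ∀ (m : ℕ) (B : K[X]), B.Monic → B.natDegree = m →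
    ∃ D A : K[X], D.Monic ∧ Squarefree D ∧ A.Monic ∧ B = D * A ^ 2 := by
  intro m
  induction m using Nat.strong_induction_on with
  | _ m ih =>
    intro B hB hm
    by_cases hs : Squarefree B
    · exact ⟨B, 1, hB, hs, monic_one, by simp⟩
    · simp only [Squarefree, not_forall] at hs
      obtain ⟨x, ⟨E, hE⟩, hx⟩ := hs
      have hx0 : x ≠ 0 := by rintro rfl; exact hB.ne_zero (by simp [hE])
      have hl := leadingCoeff_ne_zero.2 hx0
      set w := x * C x.leadingCoeff⁻¹ with hw
      have hwm : w.Monic := monic_mul_leadingCoeff_inv hx0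
      have hxw : x = w * C x.leadingCoeff := by
        rw [hw, mul_assoc, ← C_mul, inv_mul_cancel₀ hl]; simp
      set E' := E * C (x.leadingCoeff ^ 2) with hE'
      have hBE : B = w ^ 2 * E' := by
        rw [hE, hE']; conv_lhs => rw [hxw]
        rw [C_pow]; ring
      have hEm : E'.Monic := (hwm.pow 2).of_mul_monic_left (hBE ▸ hB)
      have hwd : 0 < w.natDegree := by
        have h1 : w.natDegree = x.natDegree := natDegree_mul_C (inv_ne_zero hl)
        rw [h1, Nat.pos_iff_ne_zero]
        intro h0
        exact hx (isUnit_iff_degree_eq_zero.2 (by rw [degree_eq_natDegree hx0, h0]; rfl))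
      have hd : B.natDegree = 2 * w.natDegree + E'.natDegree := by
        rw [hBE, (hwm.pow 2).natDegree_mul hEm, hwm.natDegree_pow]
      obtain ⟨D, A, hD, hDs, hA, h⟩ := ih E'.natDegree (by omega) E' hEm rfl
      exact ⟨D, A * w, hD, hDs, hA.mul hwm, by rw [hBE, h]; ring⟩

end SquarefreeDecomposition

section Sieve

variable {q : ℕ} [Fact q.Prime] {F : Type*} [Field F] [Algebra (ZMod q) F] [Fintype F] {n : ℕ}
  {z : F × F}

lemma sum_monics_eq_sum_squarefree_mul_sq {M : Type*} [AddCommMonoid M] (m : ℕ)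
    (f : (ZMod q)[X] → M) :
    ∑ B ∈ monics q m, f B = ∑ a ∈ Finset.range (m / 2 + 1), ∑ A ∈ monics q a,
      ∑ D ∈ (monics q (m - 2 * a)).filter Squarefree, f (D * A ^ 2) := by
  have h1 : ∀ a, ∑ A ∈ monics q a, ∑ D ∈ (monics q (m - 2 * a)).filter Squarefree, f (D * A ^ 2) =
      ∑ p ∈ monics q a ×ˢ (monics q (m - 2 * a)).filter Squarefree, f (p.2 * p.1 ^ 2) :=
    fun a => (Finset.sum_product' _ _ _).symm
  simp only [h1]
  rw [Finset.sum_sigma']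
  symm
  refine Finset.sum_bij (fun x _ => x.2.2 * x.2.1 ^ 2) ?_ ?_ ?_ ?_
  · rintro ⟨a, A, D⟩ h
    simp only [Finset.mem_sigma, Finset.mem_range, Finset.mem_product, Finset.mem_filter,
      mem_monics] at h ⊢
    obtain ⟨ha, ⟨hA, hAd⟩, ⟨hD, hDd⟩, -⟩ := h
    refine ⟨hD.mul (hA.pow 2), ?_⟩
    rw [hD.natDegree_mul (hA.pow 2), hA.natDegree_pow]
    omega
  · intro x hx x' hx' heq
    rw [Finset.mem_sigma, Finset.mem_product, Finset.mem_filter, mem_monics, mem_monics] at hx hx'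
    obtain ⟨a, A, D⟩ := x
    obtain ⟨a', A', D'⟩ := x'
    obtain ⟨rfl, rfl⟩ := eq_of_squarefree_mul_sq_eq hx.2.1.1 hx'.2.1.1 hx.2.2.2 hx'.2.2.2 heq
    obtain rfl : a = a' := hx.2.1.2.symm.trans hx'.2.1.2
    rfl
  · intro B hB
    rw [mem_monics] at hB
    obtain ⟨D, A, hD, hDs, hA, h⟩ := exists_squarefree_mul_sq m B hB.1 hB.2
    have hd : B.natDegree = D.natDegree + 2 * A.natDegree := by
      rw [h, hD.natDegree_mul (hA.pow 2), hA.natDegree_pow]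
    refine ⟨⟨A.natDegree, A, D⟩, ?_, h.symm⟩
    simp only [Finset.mem_sigma, Finset.mem_range, Finset.mem_product, Finset.mem_filter,
      mem_monics]
    exact ⟨by omega, ⟨hA, trivial⟩, ⟨hD, by omega⟩, hDs⟩
  · intro x _; rfl

/-- The number of monic multiples of degree `a` of a monic polynomial of degree `d`. -/
lemma sum_monics_dvd {P : (ZMod q)[X]} (hP : P.Monic) (a : ℕ) :
    ∑ A ∈ monics q a, (if P ∣ A then (1 : ℤ) else 0) =
      if P.natDegree ≤ a then (q : ℤ) ^ (a - P.natDegree) else 0 := by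
  rw [← Finset.sum_filter, Finset.sum_const, nsmul_eq_mul, mul_one]
  split_ifs with h
  · have : (monics q a).filter (fun A => P ∣ A) =
        (monics q (a - P.natDegree)).image fun A => P * A := by
      ext A
      simp only [Finset.mem_filter, mem_monics, Finset.mem_image]
      constructor
      · rintro ⟨⟨hA, hd⟩, B, rfl⟩
        have hB := hP.of_mul_monic_left hA
        refine ⟨B, ⟨hB, ?_⟩, rfl⟩
        rw [hP.natDegree_mul hB] at hd
        omega
      · rintro ⟨B, ⟨hB, hd⟩, rfl⟩
        refine ⟨⟨hP.mul hB, ?_⟩, dvd_mul_right _ _⟩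
        rw [hP.natDegree_mul hB]
        omega
    rw [this, Finset.card_image_of_injective _ (mul_right_injective₀ hP.ne_zero), card_monics]
    push_cast; rfl
  · rw [Finset.card_eq_zero.2, Nat.cast_zero]
    rw [Finset.filter_eq_empty_iff]
    intro A hA hd
    rw [mem_monics] at hA
    have := natDegree_le_of_dvd hd hA.1.ne_zero
    omega

lemma isCoprime_minpoly_of_mem_genPairs (hz : z ∈ genPairs q F n) :
    IsCoprime (minpoly (ZMod q) z.1) (minpoly (ZMod q) z.2) := by
  rw [mem_genPairs] at hz
  have hi1 : IsIntegral (ZMod q) z.1 := Algebra.IsIntegral.isIntegral _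
  have hi2 : IsIntegral (ZMod q) z.2 := Algebra.IsIntegral.isIntegral _
  rw [(minpoly.irreducible hi1).coprime_iff_not_dvd]
  intro h
  exact hz.2.2 (eq_of_monic_of_associated (minpoly.monic hi1) (minpoly.monic hi2)
    ((minpoly.irreducible hi1).associated_of_dvd (minpoly.irreducible hi2) h))

/-- The number of monic polynomials of degree `a` at which the pair character does not vanish. -/
lemma sum_pairChar_sq (hz : z ∈ genPairs q F n) (a : ℕ) :
    ∑ A ∈ monics q a, pairChar z (A ^ 2) =
      (q : ℤ) ^ a - 2 * (if n ≤ a then (q : ℤ) ^ (a - n) else 0) +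
        if 2 * n ≤ a then (q : ℤ) ^ (a - 2 * n) else 0 := by
  have hco := isCoprime_minpoly_of_mem_genPairs hz
  rw [mem_genPairs] at hz
  have hi1 : IsIntegral (ZMod q) z.1 := Algebra.IsIntegral.isIntegral _
  have hi2 : IsIntegral (ZMod q) z.2 := Algebra.IsIntegral.isIntegral _
  have h1 := sum_monics_dvd (minpoly.monic hi1) a
  have h2 := sum_monics_dvd (minpoly.monic hi2) a
  have h3 := sum_monics_dvd ((minpoly.monic hi1).mul (minpoly.monic hi2)) a
  rw [(minpoly.monic hi1).natDegree_mul (minpoly.monic hi2), hz.1, hz.2.1, ← two_mul] at h3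
  rw [hz.1] at h1
  rw [hz.2.1] at h2
  have hterm : ∀ A ∈ monics q a, pairChar z (A ^ 2) = 1 -
      (if minpoly (ZMod q) z.1 ∣ A then (1 : ℤ) else 0) -
      (if minpoly (ZMod q) z.2 ∣ A then (1 : ℤ) else 0) +
      (if minpoly (ZMod q) z.1 * minpoly (ZMod q) z.2 ∣ A then (1 : ℤ) else 0) := by
    intro A _
    have hq1 : ∀ y : F, quadraticChar F (aeval y A) ^ 2 =
        1 - if minpoly (ZMod q) y ∣ A then (1 : ℤ) else 0 := by
      intro y
      split_ifs with h
      · rw [minpoly.dvd_iff.1 h]; simp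
      · rw [quadraticChar_sq_one (fun h0 => h (minpoly.dvd_iff.2 h0)), sub_zero]
    have hm : (if minpoly (ZMod q) z.1 * minpoly (ZMod q) z.2 ∣ A then (1 : ℤ) else 0) =
        (if minpoly (ZMod q) z.1 ∣ A then (1 : ℤ) else 0) *
        (if minpoly (ZMod q) z.2 ∣ A then (1 : ℤ) else 0) := by
      have : minpoly (ZMod q) z.1 * minpoly (ZMod q) z.2 ∣ A ↔
          minpoly (ZMod q) z.1 ∣ A ∧ minpoly (ZMod q) z.2 ∣ A :=
        ⟨fun h => ⟨dvd_of_mul_right_dvd h, dvd_of_mul_left_dvd h⟩, fun h => hco.mul_dvd h.1 h.2⟩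
      rw [if_congr this rfl rfl, ite_and]
      split_ifs <;> simp
    rw [hm, pairChar, map_pow, map_pow, map_pow, map_pow, hq1, hq1]
    ring
  rw [Finset.sum_congr rfl hterm, Finset.sum_add_distrib, Finset.sum_sub_distrib,
    Finset.sum_sub_distrib, h1, h2, h3, Finset.sum_const, card_monics]
  rw [nsmul_eq_mul]
  push_cast
  ring

/-- The sum of the pair character over the squarefree monic polynomials of degree `m`. -/
noncomputable def charSumSqfree {q : ℕ} [Fact q.Prime] {F : Type*} [Field F] [Algebra (ZMod q) F]
    [Fintype F] (z : F × F) (m : ℕ) : ℤ :=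
  ∑ D ∈ (monics q m).filter Squarefree, pairChar z D

lemma charSumMonic_eq_sum (m : ℕ) :
    charSumMonic (q := q) z m = ∑ a ∈ Finset.range (m / 2 + 1),
      (∑ A ∈ monics q a, pairChar z (A ^ 2)) * charSumSqfree (q := q) z (m - 2 * a) := by
  rw [charSumMonic, sum_monics_eq_sum_squarefree_mul_sq]
  refine Finset.sum_congr rfl fun a _ => ?_
  rw [charSumSqfree, Finset.sum_mul_sum]
  refine Finset.sum_congr rfl fun A _ => Finset.sum_congr rfl fun D _ => ?_
  rw [pairChar_mul, mul_comm]

/-- Recursion for the odd-degree squarefree sums. -/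
lemma charSumSqfree_recursion (hn : 1 ≤ n) (hz : z ∈ genPairs q F n) (r : ℕ) :
    charSumSqfree (q := q) z (2 * (r + 1) + 1) =
      charSumMonic (q := q) z (2 * (r + 1) + 1) - q * charSumMonic (q := q) z (2 * r + 1) +
      2 * (if n ≤ r + 1 then charSumSqfree (q := q) z (2 * (r + 1 - n) + 1) else 0) -
      if 2 * n ≤ r + 1 then charSumSqfree (q := q) z (2 * (r + 1 - 2 * n) + 1) else 0 := by
  set s : ℕ → ℤ := fun a => ∑ A ∈ monics q a, pairChar z (A ^ 2) with hs
  have hs0 : s 0 = 1 := by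
    simp only [hs, sum_pairChar_sq hz]
    rw [if_neg (by omega), if_neg (by omega)]; simp
  have hss : ∀ a, s (a + 1) - q * s a =
      -2 * (if n = a + 1 then 1 else 0) + if 2 * n = a + 1 then 1 else 0 := by
    intro a
    simp only [hs, sum_pairChar_sq hz]
    have hone : ∀ d : ℕ, 1 ≤ d → (if d ≤ a + 1 then (q : ℤ) ^ (a + 1 - d) else 0) -
        q * (if d ≤ a then (q : ℤ) ^ (a - d) else 0) = if d = a + 1 then 1 else 0 := by
      intro d hd
      rcases lt_trichotomy d (a + 1) with h | h | h
      · rw [if_pos h.le, if_pos (by omega), if_neg h.ne, Nat.sub_add_comm (by omega), pow_succ]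
        ring
      · rw [if_pos h.le, if_neg (by omega), if_pos h, h]; simp
      · rw [if_neg (by omega), if_neg (by omega), if_neg (by omega)]; simp
    have e1 := hone n hn
    have e2 := hone (2 * n) (by omega)
    rw [← e1, ← e2]
    ring
  have e1 := charSumMonic_eq_sum (z := z) (q := q) (2 * (r + 1) + 1)
  have e2 := charSumMonic_eq_sum (z := z) (q := q) (2 * r + 1)
  rw [show (2 * (r + 1) + 1) / 2 + 1 = (r + 1) + 1 by omega, Finset.sum_range_succ'] at e1
  rw [show (2 * r + 1) / 2 + 1 = r + 1 by omega] at e2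
  change _ = ∑ a ∈ Finset.range (r + 1), s (a + 1) * _ + s 0 * _ at e1
  change _ = ∑ a ∈ Finset.range (r + 1), s a * _ at e2
  rw [hs0, one_mul, mul_zero, Nat.sub_zero] at e1
  have e3 : charSumMonic (q := q) z (2 * (r + 1) + 1) - q * charSumMonic (q := q) z (2 * r + 1) =
      ∑ a ∈ Finset.range (r + 1), (s (a + 1) - q * s a) *
        charSumSqfree (q := q) z (2 * r + 1 - 2 * a)
        + charSumSqfree (q := q) z (2 * (r + 1) + 1) := by
    rw [e1, e2, Finset.mul_sum, add_sub_right_comm, ← Finset.sum_sub_distrib]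
    congr 1
    refine Finset.sum_congr rfl fun a _ => ?_
    rw [show 2 * (r + 1) + 1 - 2 * (a + 1) = 2 * r + 1 - 2 * a by omega]
    ring
  have e4 : ∀ d : ℕ, 1 ≤ d → ∑ a ∈ Finset.range (r + 1), (if d = a + 1 then (1 : ℤ) else 0) *
      charSumSqfree (q := q) z (2 * r + 1 - 2 * a) =
      if d ≤ r + 1 then charSumSqfree (q := q) z (2 * (r + 1 - d) + 1) else 0 := by
    intro d hd
    obtain ⟨d, rfl⟩ := Nat.exists_eq_add_of_le' hd
    simp only [Nat.add_right_cancel_iff, ite_mul, one_mul, zero_mul]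
    rw [Finset.sum_ite_eq]
    simp only [Finset.mem_range]
    refine if_ctx_congr (by omega) (fun h => ?_) fun _ => rfl
    congr 1
    omega
  have e5 : ∑ a ∈ Finset.range (r + 1), (s (a + 1) - q * s a) *
      charSumSqfree (q := q) z (2 * r + 1 - 2 * a) =
      -2 * (∑ a ∈ Finset.range (r + 1), (if n = a + 1 then (1 : ℤ) else 0) *
        charSumSqfree (q := q) z (2 * r + 1 - 2 * a)) +
      ∑ a ∈ Finset.range (r + 1), (if 2 * n = a + 1 then (1 : ℤ) else 0) *
        charSumSqfree (q := q) z (2 * r + 1 - 2 * a) := by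
    rw [Finset.mul_sum, ← Finset.sum_add_distrib]
    refine Finset.sum_congr rfl fun a _ => ?_
    rw [hss]; ring
  rw [e5, e4 n hn, e4 (2 * n) (by omega)] at e3
  rw [e3]
  ring

end Sieve

section CharSumValues

variable {q : ℕ} [Fact q.Prime] {F : Type*} [Field F] [Algebra (ZMod q) F] [Fintype F] {n : ℕ}
  {z : F × F}

lemma sum_pairChar_add_polysLT (hq2 : q ≠ 2) (hF : Fintype.card F = q ^ n)
    (hz : z ∈ genPairs q F n) (B : (ZMod q)[X]) :
    ∑ L ∈ polysLT q (2 * n), pairChar z (B + L) = 0 := by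
  set f : F × F → ℤ := fun w =>
    quadraticChar F (aeval z.1 B + w.1) * quadraticChar F (aeval z.2 B + w.2) with hf
  have h1 : ∀ L : (ZMod q)[X], pairChar z (B + L) = f (aeval z.1 L, aeval z.2 L) := by
    intro L
    rw [pairChar, map_add (aeval z.1), map_add (aeval z.2)]
  rw [Finset.sum_congr rfl fun L _ => h1 L, sum_polysLT_aeval_pair hF hz f]
  rw [Fintype.sum_prod_type]
  simp only [hf]
  rw [← Finset.sum_mul_sum]
  have h2 : ∑ y : F, quadraticChar F (aeval z.1 B + y) = 0 := by
    rw [← quadraticChar_sum_zero (ringChar_ne_two (F := F) hq2)]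
    exact Fintype.sum_equiv (Equiv.addLeft (aeval z.1 B)) _ _ fun y => rfl
  rw [h2, zero_mul]

lemma charSumMonic_eq_zero (hq2 : q ≠ 2) (hF : Fintype.card F = q ^ n)
    (hz : z ∈ genPairs q F n) {m : ℕ} (hm : 2 * n ≤ m) : charSumMonic (q := q) z m = 0 := by
  have hshift : ∀ L ∈ polysLT q (2 * n), charSumMonic (q := q) z m =
      ∑ B ∈ monics q m, pairChar z (B + L) := by
    intro L hL
    rw [mem_polysLT] at hL
    have hlt : ∀ B : (ZMod q)[X], B.Monic → B.natDegree = m → L.degree < B.degree := by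
      intro B hB hd
      rw [degree_eq_natDegree hB.ne_zero, hd]
      exact hL.trans_le (by exact_mod_cast hm)
    symm
    refine Finset.sum_bij (fun B _ => B + L) ?_ (fun _ _ _ _ h => add_right_cancel h) ?_
      fun _ _ => rfl
    · intro B hB
      rw [mem_monics] at hB ⊢
      exact ⟨hB.1.add_of_left (hlt B hB.1 hB.2), by
        rw [natDegree_add_eq_left_of_degree_lt (hlt B hB.1 hB.2), hB.2]⟩
    · intro B hB
      rw [mem_monics] at hB
      have h := hlt B hB.1 hB.2
      rw [← degree_neg] at h
      refine ⟨B + -L, mem_monics.2 ⟨hB.1.add_of_left h, ?_⟩, by ring⟩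
      rw [natDegree_add_eq_left_of_degree_lt h, hB.2]
  have h1 : ∑ _L ∈ polysLT q (2 * n), charSumMonic (q := q) z m = 0 := by
    rw [Finset.sum_congr rfl hshift, Finset.sum_comm]
    exact Finset.sum_eq_zero fun B _ => sum_pairChar_add_polysLT hq2 hF hz B
  rw [Finset.sum_const, card_polysLT, nsmul_eq_mul] at h1
  have hq : ((q ^ (2 * n) : ℕ) : ℤ) ≠ 0 := by
    exact_mod_cast pow_ne_zero _ (Fact.out : q.Prime).ne_zero
  exact (mul_eq_zero.1 h1).resolve_left hq

lemma charSumMonic_zero (z : F × F) : charSumMonic (q := q) z 0 = 1 := by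
  have : monics q 0 = {1} := by
    ext B
    rw [mem_monics, Finset.mem_singleton]
    constructor
    · exact fun h => h.1.natDegree_eq_zero.1 h.2
    · rintro rfl; exact ⟨monic_one, natDegree_one⟩
  rw [charSumMonic, this, Finset.sum_singleton, pairChar]
  simp

lemma charSumLT_one (z : F × F) : charSumLT (q := q) z 1 = q - 1 := by
  rw [← zero_add 1, charSumLT_succ, charSumLT_zero, charSumMonic_zero]; ring

lemma charSumMonic_pred_two_mul (hq2 : q ≠ 2) (hF : Fintype.card F = q ^ n) (hn : 1 ≤ n)
    (hz : z ∈ genPairs q F n) : charSumMonic (q := q) z (2 * n - 1) = -(q : ℤ) ^ (n - 1) := by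
  have hq0 : (q : ℤ) ≠ 0 := by exact_mod_cast (Fact.out : q.Prime).ne_zero
  have hq1 : (q : ℤ) - 1 ≠ 0 := by
    have := (Fact.out : q.Prime).one_lt
    omega
  have h1 := charSumLT_succ (q := q) z (2 * n - 1)
  rw [Nat.sub_add_cancel (by omega)] at h1
  have h2 := charSumLT_duality hq2 hF hn hz (m := 2 * n) le_rfl
  rw [Nat.sub_self, charSumLT_zero, mul_zero] at h2
  have h3 := charSumLT_duality hq2 hF hn hz (m := 1) (by omega)
  rw [charSumLT_one, pow_one] at h3
  rw [(mul_eq_zero.1 h2).resolve_left (pow_ne_zero _ hq0)] at h1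
  obtain ⟨k, rfl⟩ := Nat.exists_eq_add_of_le' hn
  rw [Nat.add_sub_cancel]
  refine mul_left_cancel₀ (mul_ne_zero hq0 hq1) ?_
  rw [pow_succ] at h3
  linear_combination -(q : ℤ) * h1 + h3

/-- Trivial bound for the squarefree sums. -/
lemma abs_charSumSqfree_le (z : F × F) (m : ℕ) :
    |(charSumSqfree (q := q) z m : ℝ)| ≤ (q : ℝ) ^ m := by
  rw [charSumSqfree]
  push_cast
  refine (Finset.abs_sum_le_sum_abs _ _).trans ?_
  refine (Finset.sum_le_card_nsmul _ _ 1 fun B _ => abs_pairChar_le_one z B).trans ?_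
  rw [nsmul_eq_mul, mul_one]
  have := Finset.card_filter_le (monics q m) Squarefree
  rw [card_monics] at this
  exact_mod_cast this

/-- The odd-degree squarefree sum in the case `n = g`. -/
lemma charSumSqfree_eq_of_eq (hq2 : q ≠ 2) (hF : Fintype.card F = q ^ n) (hn : 1 ≤ n)
    (hz : z ∈ genPairs q F n) :
    charSumSqfree (q := q) z (2 * n + 1) =
      (q : ℤ) ^ n + 2 * charSumSqfree (q := q) z 1 := by
  have h2 := charSumMonic_pred_two_mul hq2 hF hn hz
  obtain ⟨k, rfl⟩ := Nat.exists_eq_add_of_le' hn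
  rw [charSumSqfree_recursion hn hz k, if_pos le_rfl, if_neg (by omega),
    charSumMonic_eq_zero hq2 hF hz (by omega)]
  rw [show 2 * (k + 1) - 1 = 2 * k + 1 by omega, Nat.add_sub_cancel] at h2
  rw [h2, Nat.sub_self, mul_zero, zero_add, pow_succ]
  ring

/-- The odd-degree squarefree sums decay once `n < r`. -/
lemma abs_charSumSqfree_mul_le (hq2 : q ≠ 2) (hF : Fintype.card F = q ^ n) (hn : 1 ≤ n)
    (hz : z ∈ genPairs q F n) (r : ℕ) (hr : n < r) :
    |(charSumSqfree (q := q) z (2 * r + 1) : ℝ)| * (q : ℝ) ^ n ≤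
      3 * q * √(q : ℝ) ^ (3 * r) := by
  set v := √(q : ℝ) with hv
  have hq3 : (3 : ℝ) ≤ q := by
    have := (Fact.out : q.Prime).two_le
    exact_mod_cast (show 3 ≤ q by omega)
  have hv2 : v ^ 2 = q := Real.sq_sqrt (by positivity)
  have hv1 : 1 ≤ v := Real.one_le_sqrt.2 (by linarith)
  have hqn : (q : ℝ) ^ n = v ^ (2 * n) := by rw [pow_mul, hv2]
  have hstep : ∀ r, n < r →
      (∀ s < r, |(charSumSqfree (q := q) z (2 * s + 1) : ℝ)| * (q : ℝ) ^ n ≤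
        q * v ^ (3 * s + 3 * n)) →
      |(charSumSqfree (q := q) z (2 * r + 1) : ℝ)| * (q : ℝ) ^ n ≤ 3 * q * v ^ (3 * r) := by
    intro r hr ih
    have hrec := charSumSqfree_recursion hn hz (r - 1)
    rw [Nat.sub_add_cancel (by omega), if_pos hr.le, charSumMonic_eq_zero hq2 hF hz (by omega),
      charSumMonic_eq_zero hq2 hF hz (by omega)] at hrec
    have h1 := ih (r - n) (by omega)
    rw [show 3 * (r - n) + 3 * n = 3 * r by omega] at h1
    split_ifs at hrec with h2n
    · have h2 := ih (r - 2 * n) (by omega)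
      have h3 : (q : ℝ) * v ^ (3 * (r - 2 * n) + 3 * n) ≤ q * v ^ (3 * r) := by
        exact mul_le_mul_of_nonneg_left (pow_le_pow_right₀ hv1 (by omega)) (by positivity)
      rw [hrec]
      push_cast
      calc _ ≤ (2 * |(charSumSqfree (q := q) z (2 * (r - n) + 1) : ℝ)| +
            |(charSumSqfree (q := q) z (2 * (r - 2 * n) + 1) : ℝ)|) * (q : ℝ) ^ n := by
            gcongr
            rw [mul_zero, sub_zero, zero_add]
            refine (abs_sub _ _).trans_eq ?_
            rw [abs_mul, abs_two]
        _ ≤ _ := by linarith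
    · rw [hrec]
      push_cast
      have h3 : 0 ≤ (q : ℝ) * v ^ (3 * r) := by positivity
      calc _ = 2 * (|(charSumSqfree (q := q) z (2 * (r - n) + 1) : ℝ)| * (q : ℝ) ^ n) := by
            rw [mul_zero, sub_zero, sub_zero, zero_add, abs_mul, abs_two]; ring
        _ ≤ _ := by linarith
  have hweak : ∀ s, |(charSumSqfree (q := q) z (2 * s + 1) : ℝ)| * (q : ℝ) ^ n ≤
      q * v ^ (3 * s + 3 * n) := by
    intro s
    induction s using Nat.strong_induction_on with
    | _ s ih =>
      rcases le_or_gt s n with hs | hs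
      · calc _ ≤ (q : ℝ) ^ (2 * s + 1) * (q : ℝ) ^ n := by
              gcongr; exact abs_charSumSqfree_le z _
          _ = q * v ^ (4 * s + 2 * n) := by
              rw [pow_succ, pow_mul (q : ℝ), hqn, pow_add v, show 4 * s = 2 * 2 * s by ring,
                pow_mul v (2 * 2), pow_mul v 2 2, hv2]
              ring
          _ ≤ _ := by
              exact mul_le_mul_of_nonneg_left (pow_le_pow_right₀ hv1 (by omega)) (by positivity)
      · refine (hstep s hs ih).trans ?_
        have h3 : 3 ≤ v ^ (3 * n) := by
          calc (3 : ℝ) ≤ v ^ 2 := by rw [hv2]; exact hq3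
            _ ≤ _ := pow_le_pow_right₀ hv1 (by omega)
        rw [pow_add]
        have h4 : 0 ≤ (q : ℝ) * v ^ (3 * s) := by positivity
        nlinarith
  exact hstep r hr fun s _ => hweak s

end CharSumValues

section CharSumAverages

variable {q : ℕ} [Fact q.Prime] {F : Type*} [Field F] [Algebra (ZMod q) F] [Fintype F] {n : ℕ}
  {z : F × F}

lemma abs_sum_charSumMonic_sub_le (hq2 : q ≠ 2) (hF : Fintype.card F = q ^ n) (hn : 1 ≤ n) {m : ℕ}
    (hm : m ≤ n) :
    |∑ z ∈ genPairs q F n, (charSumMonic (q := q) z m : ℝ) -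
      (if Even m then (q : ℝ) ^ (m / 2) else 0) * (genPairs q F n).card| ≤
      (q : ℝ) ^ m * (290 * n ^ 2 * (q : ℝ) ^ n) := by
  have hsq : ∑ B ∈ (monics q m).filter IsSquare, ∑ z ∈ genPairs q F n, (pairChar z B : ℝ) =
      (if Even m then (q : ℝ) ^ (m / 2) else 0) * (genPairs q F n).card := by
    split_ifs with he
    · obtain ⟨k, rfl⟩ := he
      have himg : (monics q (k + k)).filter IsSquare = (monics q k).image fun A => A ^ 2 := by
        ext B
        simp only [Finset.mem_filter, mem_monics, Finset.mem_image]
        constructor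
        · rintro ⟨⟨hB, hd⟩, A, rfl⟩
          have hA0 : A ≠ 0 := by rintro rfl; simp at hB
          have hl := leadingCoeff_ne_zero.2 hA0
          have hl2 : A.leadingCoeff * A.leadingCoeff = 1 := by
            rw [← leadingCoeff_mul]; exact hB
          rw [natDegree_mul hA0 hA0] at hd
          refine ⟨A * C A.leadingCoeff⁻¹, ⟨monic_mul_leadingCoeff_inv hA0, ?_⟩, ?_⟩
          · rw [natDegree_mul_C (inv_ne_zero hl)]; omega
          · rw [mul_pow, ← C_pow, inv_pow, sq A.leadingCoeff, hl2, inv_one, C_1, mul_one, sq]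
        · rintro ⟨A, ⟨hA, hd⟩, rfl⟩
          refine ⟨⟨hA.pow 2, ?_⟩, ⟨A, sq A⟩⟩
          rw [hA.natDegree_pow, hd, two_mul]
      have hinj : Set.InjOn (fun A : (ZMod q)[X] => A ^ 2) (monics q k) := by
        intro A hA A' hA' h
        exact (eq_of_squarefree_mul_sq_eq (mem_monics.1 hA).1 (mem_monics.1 hA').1 squarefree_one
          squarefree_one (congrArg (1 * ·) h)).1
      rw [himg, Finset.sum_image hinj,
        Finset.sum_congr rfl (g := fun _ => ((genPairs q F n).card : ℝ))]
      · rw [Finset.sum_const, card_monics, nsmul_eq_mul, ← two_mul,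
          Nat.mul_div_cancel_left _ two_pos]
        push_cast
        rfl
      · intro A hA
        rw [mem_monics] at hA
        rw [Finset.sum_congr rfl (g := fun _ => (1 : ℝ))]
        · simp
        · intro z hz
          rw [pairChar_sq hz hA.1.ne_zero (by omega)]
          simp
    · rw [zero_mul]
      refine Finset.sum_eq_zero fun B hB => ?_
      rw [Finset.mem_filter, mem_monics] at hB
      obtain ⟨⟨hB, hd⟩, A, rfl⟩ := hB
      have hA0 : A ≠ 0 := by rintro rfl; simp at hB
      rw [natDegree_mul hA0 hA0] at hd
      exact absurd ⟨_, hd.symm⟩ he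
  have hsum : ∑ z ∈ genPairs q F n, (charSumMonic (q := q) z m : ℝ) =
      ∑ B ∈ (monics q m).filter IsSquare, ∑ z ∈ genPairs q F n, (pairChar z B : ℝ) +
      ∑ B ∈ (monics q m).filter (fun B => ¬ IsSquare B),
        ∑ z ∈ genPairs q F n, (pairChar z B : ℝ) := by
    rw [Finset.sum_filter_add_sum_filter_not, Finset.sum_comm]
    simp only [charSumMonic, Int.cast_sum]
  rw [hsum, hsq, add_sub_cancel_left]
  refine (Finset.abs_sum_le_sum_abs _ _).trans ?_
  refine (Finset.sum_le_card_nsmul _ _ (290 * n ^ 2 * (q : ℝ) ^ n) fun B hB => ?_).trans ?_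
  · rw [Finset.mem_filter, mem_monics] at hB
    exact abs_sum_genPairs_le hq2 hF hn hB.1.1 hB.2 (by omega)
  · rw [nsmul_eq_mul]
    have := Finset.card_filter_le (monics q m) (fun B => ¬ IsSquare B)
    rw [card_monics] at this
    gcongr
    exact_mod_cast this

lemma abs_sum_charSumLT_sub_le (hq2 : q ≠ 2) (hF : Fintype.card F = q ^ n) (hn : 1 ≤ n) {j : ℕ}
    (hj : j ≤ n + 1) :
    |∑ z ∈ genPairs q F n, (charSumLT (q := q) z j : ℝ) -
      ((q : ℝ) ^ ((j + 1) / 2) - 1) * (genPairs q F n).card| ≤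
      (q : ℝ) ^ j * (290 * n ^ 2 * (q : ℝ) ^ n) := by
  have hq1 : (1 : ℝ) ≤ q := by exact_mod_cast (Fact.out : q.Prime).one_le
  induction j with
  | zero =>
    simp only [charSumLT_zero]
    simp
    positivity
  | succ j ih =>
    have h1 := ih (by omega)
    have h2 := abs_sum_charSumMonic_sub_le hq2 hF hn (m := j) (by omega)
    have h3 : ∑ z ∈ genPairs q F n, (charSumLT (q := q) z (j + 1) : ℝ) =
        ∑ z ∈ genPairs q F n, (charSumLT (q := q) z j : ℝ) +
        (q - 1) * ∑ z ∈ genPairs q F n, (charSumMonic (q := q) z j : ℝ) := by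
      rw [Finset.mul_sum, ← Finset.sum_add_distrib]
      refine Finset.sum_congr rfl fun z _ => ?_
      rw [charSumLT_succ]
      push_cast
      ring
    have h4 : (q : ℝ) ^ ((j + 1 + 1) / 2) - 1 = (q : ℝ) ^ ((j + 1) / 2) - 1 +
        (q - 1) * (if Even j then (q : ℝ) ^ (j / 2) else 0) := by
      split_ifs with he
      · obtain ⟨k, rfl⟩ := he
        rw [show (k + k + 1 + 1) / 2 = k + 1 by omega, show (k + k + 1) / 2 = k by omega,
          show (k + k) / 2 = k by omega]
        ring
      · rw [Nat.not_even_iff_odd] at he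
        obtain ⟨k, rfl⟩ := he
        rw [show (2 * k + 1 + 1 + 1) / 2 = k + 1 by omega,
          show (2 * k + 1 + 1) / 2 = k + 1 by omega]
        ring
    have h5 := mul_le_mul_of_nonneg_left h2 (sub_nonneg.2 hq1)
    rw [← abs_of_nonneg (sub_nonneg.2 hq1), ← abs_mul, abs_of_nonneg (sub_nonneg.2 hq1)] at h5
    rw [h3, h4]
    calc _ = |(∑ z ∈ genPairs q F n, (charSumLT (q := q) z j : ℝ) -
          ((q : ℝ) ^ ((j + 1) / 2) - 1) * (genPairs q F n).card) +
          (q - 1) * (∑ z ∈ genPairs q F n, (charSumMonic (q := q) z j : ℝ) -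
          (if Even j then (q : ℝ) ^ (j / 2) else 0) * (genPairs q F n).card)| := by
          congr 1; ring
      _ ≤ _ := abs_add_le _ _
      _ ≤ _ := add_le_add h1 h5
      _ = _ := by ring

/-- The average of the odd-degree squarefree sums in the transition range `g < n ≤ 2g`. -/
theorem abs_sum_charSumSqfree_add_le (hq2 : q ≠ 2) (hF : Fintype.card F = q ^ n) {g : ℕ}
    (hg : 1 ≤ g) (hgn : g < n) (hn2 : n ≤ 2 * g) :
    |(q : ℝ) ^ n * ∑ z ∈ genPairs q F n, (charSumSqfree (q := q) z (2 * g + 1) : ℝ) +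
      (q : ℝ) ^ (2 * g) * (q - 1) * (genPairs q F n).card| ≤
      1160 * q * n ^ 2 * (q : ℝ) ^ (3 * n) := by
  have hq2' : (2 : ℝ) ≤ q := by exact_mod_cast (Fact.out : q.Prime).two_le
  have hpt : ∀ z ∈ genPairs q F n, (q : ℝ) ^ n * ((q - 1) *
      (charSumSqfree (q := q) z (2 * g + 1) : ℝ)) =
      (q : ℝ) ^ (2 * g + 2) * (charSumLT (q := q) z (2 * (n - g) - 2) : ℝ) -
      (q : ℝ) ^ (2 * g + 1) * (charSumLT (q := q) z (2 * (n - g) - 1) : ℝ) -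
      (q : ℝ) ^ (2 * g + 1) * (charSumLT (q := q) z (2 * (n - g)) : ℝ) +
      (q : ℝ) ^ (2 * g) * (charSumLT (q := q) z (2 * (n - g) + 1) : ℝ) := by
    intro z hz
    have hrec := charSumSqfree_recursion (by omega) hz (g - 1)
    rw [Nat.sub_add_cancel hg, if_neg (by omega), if_neg (by omega),
      show 2 * (g - 1) + 1 = 2 * g - 1 by omega] at hrec
    have d1 := charSumLT_duality hq2 hF (by omega) hz (m := 2 * g + 2) (by omega)
    have d2 := charSumLT_duality hq2 hF (by omega) hz (m := 2 * g + 1) (by omega)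
    have d3 := charSumLT_duality hq2 hF (by omega) hz (m := 2 * g) (by omega)
    have d4 := charSumLT_duality hq2 hF (by omega) hz (m := 2 * g - 1) (by omega)
    rw [show 2 * n - (2 * g + 2) = 2 * (n - g) - 2 by omega] at d1
    rw [show 2 * n - (2 * g + 1) = 2 * (n - g) - 1 by omega] at d2
    rw [show 2 * n - (2 * g) = 2 * (n - g) by omega] at d3
    rw [show 2 * n - (2 * g - 1) = 2 * (n - g) + 1 by omega] at d4
    have s1 := charSumLT_succ (q := q) z (2 * g + 1)
    have s2 := charSumLT_succ (q := q) z (2 * g - 1)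
    rw [Nat.sub_add_cancel (by omega)] at s2
    have hp : (q : ℤ) ^ (2 * g) = q * (q : ℤ) ^ (2 * g - 1) := by
      rw [← pow_succ', Nat.sub_add_cancel (by omega)]
    have hmain : (q : ℤ) ^ n * ((q - 1) * charSumSqfree (q := q) z (2 * g + 1)) =
      (q : ℤ) ^ (2 * g + 2) * charSumLT (q := q) z (2 * (n - g) - 2) -
      (q : ℤ) ^ (2 * g + 1) * charSumLT (q := q) z (2 * (n - g) - 1) -
      (q : ℤ) ^ (2 * g + 1) * charSumLT (q := q) z (2 * (n - g)) +
      (q : ℤ) ^ (2 * g) * charSumLT (q := q) z (2 * (n - g) + 1) := by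
      rw [← d1, ← d2, hrec, pow_succ' (q : ℤ) (2 * g), mul_assoc (q : ℤ), ← d3, hp,
        mul_assoc (q : ℤ), ← d4]
      linear_combination (-(q : ℤ) ^ n) * s1 + (q : ℤ) ^ n * q * s2
    exact_mod_cast hmain
  have hsum : (q : ℝ) ^ n * ((q - 1) * ∑ z ∈ genPairs q F n,
      (charSumSqfree (q := q) z (2 * g + 1) : ℝ)) =
      (q : ℝ) ^ (2 * g + 2) * ∑ z ∈ genPairs q F n, (charSumLT (q := q) z (2 * (n - g) - 2) : ℝ) -
      (q : ℝ) ^ (2 * g + 1) * ∑ z ∈ genPairs q F n, (charSumLT (q := q) z (2 * (n - g) - 1) : ℝ) -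
      (q : ℝ) ^ (2 * g + 1) * ∑ z ∈ genPairs q F n, (charSumLT (q := q) z (2 * (n - g)) : ℝ) +
      (q : ℝ) ^ (2 * g) * ∑ z ∈ genPairs q F n, (charSumLT (q := q) z (2 * (n - g) + 1) : ℝ) := by
    simp only [Finset.mul_sum]
    rw [← Finset.sum_sub_distrib, ← Finset.sum_sub_distrib, ← Finset.sum_add_distrib]
    exact Finset.sum_congr rfl hpt
  obtain ⟨k, hk⟩ : ∃ k, n - g = k + 1 := ⟨n - g - 1, by omega⟩
  rw [hk] at hsum
  have a1 := abs_sum_charSumLT_sub_le hq2 hF (by omega) (j := 2 * (k + 1) - 2) (by omega)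
  have a2 := abs_sum_charSumLT_sub_le hq2 hF (by omega) (j := 2 * (k + 1) - 1) (by omega)
  have a3 := abs_sum_charSumLT_sub_le hq2 hF (by omega) (j := 2 * (k + 1)) (by omega)
  have a4 := abs_sum_charSumLT_sub_le hq2 hF (by omega) (j := 2 * (k + 1) + 1) (by omega)
  rw [show (2 * (k + 1) - 2 + 1) / 2 = k by omega] at a1
  rw [show (2 * (k + 1) - 1 + 1) / 2 = k + 1 by omega] at a2
  rw [show (2 * (k + 1) + 1) / 2 = k + 1 by omega] at a3
  rw [show (2 * (k + 1) + 1 + 1) / 2 = k + 2 by omega] at a4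
  set S1 := ∑ z ∈ genPairs q F n, (charSumLT (q := q) z (2 * (k + 1) - 2) : ℝ)
  set S2 := ∑ z ∈ genPairs q F n, (charSumLT (q := q) z (2 * (k + 1) - 1) : ℝ)
  set S3 := ∑ z ∈ genPairs q F n, (charSumLT (q := q) z (2 * (k + 1)) : ℝ)
  set S4 := ∑ z ∈ genPairs q F n, (charSumLT (q := q) z (2 * (k + 1) + 1) : ℝ)
  set H := ∑ z ∈ genPairs q F n, (charSumSqfree (q := q) z (2 * g + 1) : ℝ)
  set G : ℝ := ((genPairs q F n).card : ℝ)
  set E : ℝ := 290 * n ^ 2 * (q : ℝ) ^ n with hE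
  have hE0 : 0 ≤ E := by positivity
  have key : (q - 1) * ((q : ℝ) ^ n * H + (q : ℝ) ^ (2 * g) * (q - 1) * G) =
      (q : ℝ) ^ (2 * g + 2) * (S1 - ((q : ℝ) ^ k - 1) * G) -
      (q : ℝ) ^ (2 * g + 1) * (S2 - ((q : ℝ) ^ (k + 1) - 1) * G) -
      (q : ℝ) ^ (2 * g + 1) * (S3 - ((q : ℝ) ^ (k + 1) - 1) * G) +
      (q : ℝ) ^ (2 * g) * (S4 - ((q : ℝ) ^ (k + 2) - 1) * G) := by
    linear_combination hsum
  have hQ : ∀ a j : ℕ, ∀ x : ℝ, |x| ≤ (q : ℝ) ^ j * E → a + j ≤ 2 * n + 1 →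
      |(q : ℝ) ^ a * x| ≤ (q : ℝ) ^ (2 * n + 1) * E := by
    intro a j x hx haj
    rw [abs_mul, abs_of_nonneg (by positivity)]
    calc _ ≤ (q : ℝ) ^ a * ((q : ℝ) ^ j * E) := by gcongr
      _ = (q : ℝ) ^ (a + j) * E := by ring
      _ ≤ _ := by
        gcongr
        linarith
  have b1 := hQ (2 * g + 2) _ _ a1 (by omega)
  have b2 := hQ (2 * g + 1) _ _ a2 (by omega)
  have b3 := hQ (2 * g + 1) _ _ a3 (by omega)
  have b4 := hQ (2 * g) _ _ a4 (by omega)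
  rw [abs_le] at b1 b2 b3 b4
  have hfin : |(q - 1) * ((q : ℝ) ^ n * H + (q : ℝ) ^ (2 * g) * (q - 1) * G)| ≤
      4 * ((q : ℝ) ^ (2 * n + 1) * E) := by
    rw [key, abs_le]
    constructor <;> linarith [b1.1, b1.2, b2.1, b2.2, b3.1, b3.2, b4.1, b4.2]
  rw [abs_mul, abs_of_nonneg (by linarith : (0 : ℝ) ≤ q - 1)] at hfin
  have h0 := abs_nonneg ((q : ℝ) ^ n * H + (q : ℝ) ^ (2 * g) * (q - 1) * G)
  calc _ ≤ (q - 1) * |(q : ℝ) ^ n * H + (q : ℝ) ^ (2 * g) * (q - 1) * G| := by nlinarith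
    _ ≤ _ := hfin
    _ = _ := by rw [hE]; ring

end CharSumAverages

section Reduction

variable {q : ℕ} [Fact q.Prime]

lemma resSym_pow_odd (a P : (ZMod q)[X]) (k : ℕ) :
    resSym q a P ^ (2 * k + 1) = resSym q a P := by
  rw [resSym]
  split_ifs <;> simp [pow_succ, pow_mul]

lemma jacSym_pow_mul_pow {P Q : (ZMod q)[X]} (hP : P.Monic) (hPi : Irreducible P) (hQ : Q.Monic)
    (hQi : Irreducible Q) (D : (ZMod q)[X]) (k l : ℕ) :
    jacSym q D (P ^ (2 * k + 1) * Q ^ (2 * l + 1)) = resSym q D P * resSym q D Q := by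
  have hP0 := pow_ne_zero (2 * k + 1) hP.ne_zero
  have hQ0 := pow_ne_zero (2 * l + 1) hQ.ne_zero
  rw [jacSym, if_neg (mul_ne_zero hP0 hQ0), normalizedFactors_mul hP0 hQ0, normalizedFactors_pow,
    normalizedFactors_pow, normalizedFactors_irreducible hPi, normalizedFactors_irreducible hQi,
    hP.normalize_eq_self, hQ.normalize_eq_self]
  simp only [Multiset.map_add, Multiset.map_nsmul, Multiset.prod_add, Multiset.prod_nsmul,
    Multiset.map_singleton, Multiset.prod_singleton, resSym_pow_odd]

lemma sumH_eq_sum {M : Type*} [AddCommMonoid M] (g : ℕ) (f : (ZMod q)[X] → M) :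
    sumH q g f = ∑ D ∈ (monics q (2 * g + 1)).filter Squarefree, f D := by
  rw [sumH, sum_monicOfDeg (fun D => if Squarefree D then f D else 0), Finset.sum_filter]

lemma tsum_irreducible_pairs (N : ℕ) (f : (ZMod q)[X] → (ZMod q)[X] → ℕ → ℕ → ℂ) :
    (∑' x : (ZMod q)[X] × (ZMod q)[X] × ℕ × ℕ,
      if x.1.Monic ∧ Irreducible x.1 ∧ x.2.1.Monic ∧ Irreducible x.2.1 ∧
          x.1 ≠ x.2.1 ∧ x.1.natDegree = x.2.1.natDegree ∧
          (2 * x.2.2.1 + 1) * x.1.natDegree + (2 * x.2.2.2 + 1) * x.2.1.natDegree ≤ N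
      then f x.1 x.2.1 x.2.2.1 x.2.2.2 else 0) =
    ∑ n ∈ Finset.Icc 1 N, ∑ k ∈ Finset.range (N + 1), ∑ l ∈ Finset.range (N + 1),
      if (2 * k + 1) * n + (2 * l + 1) * n ≤ N then
        ∑ P ∈ irrs q n, ∑ Q ∈ irrs q n, if P ≠ Q then f P Q k l else 0
      else 0 := by
  rw [tsum_eq_sum (s := (Finset.Icc 1 N).biUnion fun n =>
    irrs q n ×ˢ irrs q n ×ˢ Finset.range (N + 1) ×ˢ Finset.range (N + 1)), Finset.sum_biUnion]
  · refine Finset.sum_congr rfl fun n _ => ?_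
    have hterm : ∀ P ∈ irrs q n, ∀ Q ∈ irrs q n, ∀ k l : ℕ,
        (if P.Monic ∧ Irreducible P ∧ Q.Monic ∧ Irreducible Q ∧
          P ≠ Q ∧ P.natDegree = Q.natDegree ∧
          (2 * k + 1) * P.natDegree + (2 * l + 1) * Q.natDegree ≤ N
        then f P Q k l else 0) =
        if (2 * k + 1) * n + (2 * l + 1) * n ≤ N then (if P ≠ Q then f P Q k l else 0) else 0 := by
      intro P hP Q hQ k l
      rw [mem_irrs] at hP hQ
      rw [← ite_and]
      refine if_congr ?_ rfl rfl
      rw [hP.2.2, hQ.2.2]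
      tauto
    simp only [Finset.sum_product]
    rw [Finset.sum_congr rfl fun P hP => Finset.sum_congr rfl fun Q hQ =>
      Finset.sum_congr rfl fun k _ => Finset.sum_congr rfl fun l _ => hterm P hP Q hQ k l]
    rw [Finset.sum_congr rfl fun P _ => Finset.sum_comm, Finset.sum_comm]
    refine Finset.sum_congr rfl fun k _ => ?_
    rw [Finset.sum_congr rfl fun P _ => Finset.sum_comm, Finset.sum_comm]
    refine Finset.sum_congr rfl fun l _ => ?_
    split_ifs
    · rfl
    · simp
  · intro n _ m _ hnm
    rw [Function.onFun, Finset.disjoint_left]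
    intro x hx hx'
    rw [Finset.mem_product, mem_irrs] at hx hx'
    exact hnm (hx.1.2.2.symm.trans hx'.1.2.2)
  · intro x hx
    rw [if_neg]
    rintro ⟨h1, h2, h3, h4, -, h6, h7⟩
    refine hx ?_
    have hd := h2.natDegree_pos
    rw [← h6, ← add_mul] at h7
    have h8 : 2 * x.2.2.1 + 1 + (2 * x.2.2.2 + 1) ≤ N :=
      (Nat.le_mul_of_pos_right _ hd).trans h7
    have h9 : x.1.natDegree ≤ N := (Nat.le_mul_of_pos_left _ (by omega)).trans h7
    simp only [Finset.mem_biUnion, Finset.mem_Icc, Finset.mem_product, mem_irrs, Finset.mem_range]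
    exact ⟨x.1.natDegree, ⟨hd, h9⟩, ⟨h1, h2, rfl⟩, ⟨h3, h4, h6.symm⟩, by omega, by omega⟩

/-- The sum of `d(P)² χ_D(PQ)` over the squarefree monic `D` of degree `2g+1` and the pairs of
distinct monic irreducibles `P, Q` of degree `n`. -/
noncomputable def pairSum (q : ℕ) [Fact q.Prime] (g n : ℕ) : ℤ :=
  n ^ 2 * ∑ D ∈ (monics q (2 * g + 1)).filter Squarefree, ∑ P ∈ irrs q n, ∑ Q ∈ irrs q n,
    if P ≠ Q then resSym q D P * resSym q D Q else 0

lemma pairSum_eq {F : Type*} [Field F] [Algebra (ZMod q) F] [Fintype F] {n : ℕ}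
    (hF : Fintype.card F = q ^ n) (g : ℕ) :
    pairSum q g n = ∑ z ∈ genPairs q F n, charSumSqfree (q := q) z (2 * g + 1) := by
  simp only [charSumSqfree]
  rw [Finset.sum_comm, pairSum, Finset.mul_sum]
  refine Finset.sum_congr rfl fun D _ => ?_
  rw [← Finset.sum_congr rfl fun z hz => resSym_mul_resSym_minpoly hF hz D,
    sum_genPairs_minpoly hF fun P Q => resSym q D P * resSym q D Q, nsmul_eq_mul]
  push_cast
  rfl

lemma sumH_tsum_eq (g N : ℕ) (α β : ℂ) :
    sumH q g (fun D =>
      ∑' x : Polynomial (ZMod q) × Polynomial (ZMod q) × ℕ × ℕ,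
        if x.1.Monic ∧ Irreducible x.1 ∧ x.2.1.Monic ∧ Irreducible x.2.1 ∧
            x.1 ≠ x.2.1 ∧ x.1.natDegree = x.2.1.natDegree ∧
            (2 * x.2.2.1 + 1) * x.1.natDegree + (2 * x.2.2.2 + 1) * x.2.1.natDegree ≤ N
        then
          (x.1.natDegree : ℂ) ^ 2 *
            (jacSym q D (x.1 ^ (2 * x.2.2.1 + 1) * x.2.1 ^ (2 * x.2.2.2 + 1)) : ℂ) /
            ((q : ℂ) ^ ((((2 * x.2.2.1 + 1) * x.1.natDegree : ℕ) : ℂ) * (1 / 2 + α)) *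
              (q : ℂ) ^ ((((2 * x.2.2.2 + 1) * x.2.1.natDegree : ℕ) : ℂ) * (1 / 2 + β)))
        else 0) =
    ∑ n ∈ Finset.Icc 1 N, ∑ k ∈ Finset.range (N + 1), ∑ l ∈ Finset.range (N + 1),
      if (2 * k + 1) * n + (2 * l + 1) * n ≤ N then
        (pairSum q g n : ℂ) / ((q : ℂ) ^ ((((2 * k + 1) * n : ℕ) : ℂ) * (1 / 2 + α)) *
          (q : ℂ) ^ ((((2 * l + 1) * n : ℕ) : ℂ) * (1 / 2 + β)))
      else 0 := by
  rw [sumH_eq_sum]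
  rw [Finset.sum_congr rfl fun D _ => tsum_irreducible_pairs N fun P Q k l =>
    (P.natDegree : ℂ) ^ 2 * (jacSym q D (P ^ (2 * k + 1) * Q ^ (2 * l + 1)) : ℂ) /
      ((q : ℂ) ^ ((((2 * k + 1) * P.natDegree : ℕ) : ℂ) * (1 / 2 + α)) *
        (q : ℂ) ^ ((((2 * l + 1) * Q.natDegree : ℕ) : ℂ) * (1 / 2 + β)))]
  rw [Finset.sum_comm]
  refine Finset.sum_congr rfl fun n _ => ?_
  rw [Finset.sum_comm]
  refine Finset.sum_congr rfl fun k _ => ?_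
  rw [Finset.sum_comm]
  refine Finset.sum_congr rfl fun l _ => ?_
  split_ifs
  · rw [pairSum, Int.cast_mul, Int.cast_sum, Finset.mul_sum, Finset.sum_div]
    refine Finset.sum_congr rfl fun D _ => ?_
    rw [Int.cast_sum, Finset.mul_sum, Finset.sum_div]
    refine Finset.sum_congr rfl fun P hP => ?_
    rw [Int.cast_sum, Finset.mul_sum, Finset.sum_div]
    refine Finset.sum_congr rfl fun Q hQ => ?_
    rw [mem_irrs] at hP hQ
    split_ifs
    · rw [hP.2.2, hQ.2.2, jacSym_pow_mul_pow hP.1 hP.2.1 hQ.1 hQ.2.1]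
      push_cast
      rfl
    · simp
  · simp

end Reduction

section PairSumBounds

variable {q : ℕ} [Fact q.Prime]

lemma abs_pairSum_le_of_lt (hq2 : q ≠ 2) {g n : ℕ} (hn : 1 ≤ n) (hng : n < g) :
    |(pairSum q g n : ℝ)| ≤ 3 * q * √(q : ℝ) ^ (3 * g) * (q : ℝ) ^ n := by
  let : Fintype (GaloisField q n) := Fintype.ofFinite _
  have hF : Fintype.card (GaloisField q n) = q ^ n := by
    rw [← Nat.card_eq_fintype_card]; exact GaloisField.card q n (by omega)
  have hq0 : (0 : ℝ) < q := by exact_mod_cast (Fact.out : q.Prime).pos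
  rw [pairSum_eq hF]
  push_cast
  refine le_of_mul_le_mul_right ?_ (pow_pos hq0 n)
  calc _ ≤ (∑ z ∈ genPairs q (GaloisField q n) n,
        |(charSumSqfree (q := q) z (2 * g + 1) : ℝ)|) * (q : ℝ) ^ n := by
        gcongr; exact Finset.abs_sum_le_sum_abs _ _
    _ = ∑ z ∈ genPairs q (GaloisField q n) n,
        |(charSumSqfree (q := q) z (2 * g + 1) : ℝ)| * (q : ℝ) ^ n := Finset.sum_mul _ _ _
    _ ≤ (genPairs q (GaloisField q n) n).card • (3 * q * √(q : ℝ) ^ (3 * g)) :=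
        Finset.sum_le_card_nsmul _ _ _ fun z hz => abs_charSumSqfree_mul_le hq2 hF hn hz g hng
    _ ≤ (q : ℝ) ^ (2 * n) * (3 * q * √(q : ℝ) ^ (3 * g)) := by
        rw [nsmul_eq_mul]
        gcongr
        exact card_genPairs_le hF
    _ = _ := by rw [two_mul, pow_add]; ring

lemma abs_pairSum_self_sub_le (hq2 : q ≠ 2) {g : ℕ} (hg : 1 ≤ g) :
    |(pairSum q g g : ℝ) - (q : ℝ) ^ (3 * g)| ≤ (5 + 2 * q) * g * √(q : ℝ) ^ (5 * g) := by
  let : Fintype (GaloisField q g) := Fintype.ofFinite _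
  have hF : Fintype.card (GaloisField q g) = q ^ g := by
    rw [← Nat.card_eq_fintype_card]; exact GaloisField.card q g (by omega)
  have hq1 : (1 : ℝ) ≤ q := by exact_mod_cast (Fact.out : q.Prime).one_le
  have hv2 : √(q : ℝ) ^ 2 = q := Real.sq_sqrt (by positivity)
  have hv1 : 1 ≤ √(q : ℝ) := Real.one_le_sqrt.2 hq1
  set G := genPairs q (GaloisField q g) g with hG
  have h1 : (pairSum q g g : ℝ) = q ^ g * G.card +
      2 * ∑ z ∈ G, (charSumSqfree (q := q) z 1 : ℝ) := by
    rw [pairSum_eq hF, Finset.sum_congr rfl fun z hz => charSumSqfree_eq_of_eq hq2 hF hg hz,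
      Finset.sum_add_distrib, ← Finset.mul_sum, Finset.sum_const, nsmul_eq_mul]
    push_cast
    ring
  have h2 : |∑ z ∈ G, (charSumSqfree (q := q) z 1 : ℝ)| ≤ q ^ (2 * g) * q := by
    refine (Finset.abs_sum_le_sum_abs _ _).trans ?_
    refine (Finset.sum_le_card_nsmul _ _ (q : ℝ) fun z _ => ?_).trans ?_
    · simpa using abs_charSumSqfree_le (q := q) z 1
    · rw [nsmul_eq_mul]
      gcongr
      exact card_genPairs_le hF
  have h3 := card_genPairs_le (q := q) hF
  have h4 := le_card_genPairs (q := q) hF hg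
  have h5 : |(G.card : ℝ) - q ^ (2 * g)| ≤ 5 * g * √(q : ℝ) ^ (3 * g) := by
    rw [abs_le]
    have : 0 ≤ 5 * (g : ℝ) * √(q : ℝ) ^ (3 * g) := by positivity
    constructor <;> linarith
  have e1 : (q : ℝ) ^ g * √(q : ℝ) ^ (3 * g) = √(q : ℝ) ^ (5 * g) := by
    rw [show 5 * g = 2 * g + 3 * g by ring, pow_add, pow_mul _ 2, hv2]
  have e2 : (q : ℝ) ^ (2 * g) ≤ g * √(q : ℝ) ^ (5 * g) := by
    have hg1 : (1 : ℝ) ≤ g := by exact_mod_cast hg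
    calc (q : ℝ) ^ (2 * g) = 1 * √(q : ℝ) ^ (2 * (2 * g)) := by
          rw [pow_mul (√(q : ℝ)) 2, hv2, one_mul]
      _ ≤ _ := mul_le_mul hg1 (pow_le_pow_right₀ hv1 (by omega)) (by positivity) (by positivity)
  calc _ = |(q : ℝ) ^ g * ((G.card : ℝ) - q ^ (2 * g)) +
        2 * ∑ z ∈ G, (charSumSqfree (q := q) z 1 : ℝ)| := by
        rw [h1]; congr 1; ring
    _ ≤ (q : ℝ) ^ g * |(G.card : ℝ) - q ^ (2 * g)| +
        2 * |∑ z ∈ G, (charSumSqfree (q := q) z 1 : ℝ)| := by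
        refine (abs_add_le _ _).trans_eq ?_
        rw [abs_mul, abs_mul, abs_two, abs_of_nonneg (by positivity : (0 : ℝ) ≤ (q : ℝ) ^ g)]
    _ ≤ (q : ℝ) ^ g * (5 * g * √(q : ℝ) ^ (3 * g)) + 2 * (q ^ (2 * g) * q) := by gcongr
    _ = 5 * g * ((q : ℝ) ^ g * √(q : ℝ) ^ (3 * g)) + 2 * q * q ^ (2 * g) := by ring
    _ ≤ 5 * g * √(q : ℝ) ^ (5 * g) + 2 * q * (g * √(q : ℝ) ^ (5 * g)) := by rw [e1]; gcongr
    _ = _ := by ring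

lemma abs_pairSum_add_le (hq2 : q ≠ 2) {g n : ℕ} (hg : 1 ≤ g) (hgn : g < n) (hn2 : n ≤ 2 * g) :
    |(pairSum q g n : ℝ) + (q : ℝ) ^ (2 * g) * (q - 1) * (q : ℝ) ^ n| ≤
      1160 * q * n ^ 2 * (q : ℝ) ^ (2 * n) +
        (q : ℝ) ^ (2 * g) * (q - 1) * (5 * n * √(q : ℝ) ^ n) := by
  let : Fintype (GaloisField q n) := Fintype.ofFinite _
  have hF : Fintype.card (GaloisField q n) = q ^ n := by
    rw [← Nat.card_eq_fintype_card]; exact GaloisField.card q n (by omega)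
  have hq1 : (1 : ℝ) ≤ q := by exact_mod_cast (Fact.out : q.Prime).one_le
  have hv2 : √(q : ℝ) ^ 2 = q := Real.sq_sqrt (by positivity)
  have h0 : 0 ≤ (q : ℝ) ^ (2 * g) * (q - 1) := mul_nonneg (by positivity) (by linarith)
  have h1 := abs_sum_charSumSqfree_add_le hq2 hF hg hgn hn2
  have h3 := card_genPairs_le (q := q) hF
  have h4 := le_card_genPairs (q := q) hF (by omega)
  set G := genPairs q (GaloisField q n) n with hG
  have h5 : |(q : ℝ) ^ (2 * n) - (G.card : ℝ)| ≤ 5 * n * √(q : ℝ) ^ (3 * n) := by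
    rw [abs_le]
    have : 0 ≤ 5 * (n : ℝ) * √(q : ℝ) ^ (3 * n) := by positivity
    constructor <;> linarith
  refine le_of_mul_le_mul_left ?_ (pow_pos (by linarith : (0 : ℝ) < q) n)
  rw [pairSum_eq hF]
  push_cast
  calc _ = |(q : ℝ) ^ n * (∑ z ∈ G, (charSumSqfree (q := q) z (2 * g + 1) : ℝ) +
        (q : ℝ) ^ (2 * g) * (q - 1) * (q : ℝ) ^ n)| := by
        rw [abs_mul, abs_of_nonneg (by positivity : (0 : ℝ) ≤ (q : ℝ) ^ n)]
    _ = |((q : ℝ) ^ n * ∑ z ∈ G, (charSumSqfree (q := q) z (2 * g + 1) : ℝ) +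
        (q : ℝ) ^ (2 * g) * (q - 1) * G.card) +
        (q : ℝ) ^ (2 * g) * (q - 1) * ((q : ℝ) ^ (2 * n) - G.card)| := by
        congr 1; rw [two_mul n, pow_add]; ring
    _ ≤ _ := abs_add_le _ _
    _ ≤ 1160 * q * n ^ 2 * (q : ℝ) ^ (3 * n) +
        (q : ℝ) ^ (2 * g) * (q - 1) * (5 * n * √(q : ℝ) ^ (3 * n)) := by
        rw [abs_mul ((q : ℝ) ^ (2 * g) * (q - 1)), abs_of_nonneg h0]
        gcongr
    _ = _ := by
        rw [show 3 * n = 2 * n + n by ring, pow_add, pow_add, pow_mul (√(q : ℝ)), hv2]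
        ring

end PairSumBounds

section Weights

/-- The weight of a pair of prime powers with exponents `2k+1, 2l+1` and degree `n`. -/
lemma norm_inv_weight_le {q : ℕ} (hq : 1 < q) {g N n k l : ℕ} (hg : 1 ≤ g) (hN : N < 4 * g)
    (h : (2 * k + 1) * n + (2 * l + 1) * n ≤ N) {α β : ℂ} (hα : ‖α‖ ≤ 1 / (g : ℝ))
    (hβ : ‖β‖ ≤ 1 / (g : ℝ)) :
    ‖((q : ℂ) ^ ((((2 * k + 1) * n : ℕ) : ℂ) * (1 / 2 + α)) *
      (q : ℂ) ^ ((((2 * l + 1) * n : ℕ) : ℂ) * (1 / 2 + β)))⁻¹‖ ≤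
      (q : ℝ) ^ 4 * ((q : ℝ) ^ (n * (k + l + 1)))⁻¹ := by
  have hq0 : (0 : ℝ) < q := by exact_mod_cast (by omega : 0 < q)
  have hq1 : (1 : ℝ) < q := by exact_mod_cast hq
  have hg0 : (0 : ℝ) < g := by exact_mod_cast hg
  rw [norm_inv, norm_mul, Complex.norm_natCast_cpow_of_pos (by omega),
    Complex.norm_natCast_cpow_of_pos (by omega), ← Real.rpow_add hq0, ← Real.rpow_neg hq0.le,
    ← Real.rpow_natCast, ← Real.rpow_natCast, ← Real.rpow_neg hq0.le, ← Real.rpow_add hq0]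
  refine Real.rpow_le_rpow_of_exponent_le hq1.le ?_
  have e1 : ∀ (m : ℕ) (γ : ℂ), ((m : ℂ) * (1 / 2 + γ)).re = m * (1 / 2 + γ.re) := by
    intro m γ
    rw [← Complex.ofReal_natCast, Complex.re_ofReal_mul]
    simp
  have hα' := (abs_le.1 ((Complex.abs_re_le_norm α).trans hα)).1
  have hβ' := (abs_le.1 ((Complex.abs_re_le_norm β).trans hβ)).1
  have e2 : ∀ (m : ℕ) (x : ℝ), -(1 / (g : ℝ)) ≤ x → -(m * (1 / (g : ℝ))) ≤ m * x := by
    intro m x hx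
    have := mul_le_mul_of_nonneg_left hx (Nat.cast_nonneg (α := ℝ) m)
    linarith
  have f1 := e2 ((2 * k + 1) * n) _ hα'
  have f2 := e2 ((2 * l + 1) * n) _ hβ'
  have f3 : (((2 * k + 1) * n : ℕ) : ℝ) * (1 / (g : ℝ)) +
      (((2 * l + 1) * n : ℕ) : ℝ) * (1 / (g : ℝ)) ≤ 4 := by
    rw [← add_mul, mul_one_div, div_le_iff₀ hg0]
    exact_mod_cast h.trans hN.le
  rw [e1, e1]
  have f4 : (((2 * k + 1) * n : ℕ) : ℝ) + (((2 * l + 1) * n : ℕ) : ℝ) =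
      2 * ((n * (k + l + 1) : ℕ) : ℝ) := by
    push_cast; ring
  have f5 : ((4 : ℕ) : ℝ) = 4 := by norm_num
  rw [f5]
  linarith

end Weights

section DegreeContributions

variable {q : ℕ} {g N n : ℕ} {α β : ℂ}

lemma inv_weight_eq (hq : q ≠ 0) :
    ((q : ℂ) ^ ((((2 * 0 + 1) * n : ℕ) : ℂ) * (1 / 2 + α)) *
      (q : ℂ) ^ ((((2 * 0 + 1) * n : ℕ) : ℂ) * (1 / 2 + β)))⁻¹ =
      ((q : ℂ) ^ n)⁻¹ * (q : ℂ) ^ (-(n : ℂ) * (α + β)) := by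
  have hq0 : (q : ℂ) ≠ 0 := by exact_mod_cast hq
  rw [← Complex.cpow_add _ _ hq0, ← Complex.cpow_natCast, ← Complex.cpow_neg, ← Complex.cpow_neg,
    ← Complex.cpow_add _ _ hq0]
  congr 1
  push_cast
  ring

variable [Fact q.Prime]

/-- The contribution of the primes of degree `n` to the two-level density sum. -/
noncomputable def degreeTerm (q : ℕ) [Fact q.Prime] (g N : ℕ) (α β : ℂ) (n : ℕ) : ℂ :=
  ∑ k ∈ Finset.range (N + 1), ∑ l ∈ Finset.range (N + 1),
    if (2 * k + 1) * n + (2 * l + 1) * n ≤ N then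
      (pairSum q g n : ℂ) / ((q : ℂ) ^ ((((2 * k + 1) * n : ℕ) : ℂ) * (1 / 2 + α)) *
        (q : ℂ) ^ ((((2 * l + 1) * n : ℕ) : ℂ) * (1 / 2 + β)))
    else 0

lemma sum_inv_pow_le_two {x : ℝ} (hx : 2 ≤ x) (m : ℕ) :
    ∑ k ∈ Finset.range m, (x ^ k)⁻¹ ≤ 2 := by
  have h : ∀ m, ∑ k ∈ Finset.range m, ((2 : ℝ) ^ k)⁻¹ = 2 - 2 * (2 ^ m)⁻¹ := by
    intro m
    induction m with
    | zero => norm_num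
    | succ m ih => rw [Finset.sum_range_succ, ih, pow_succ]; field_simp; ring
  calc _ ≤ ∑ k ∈ Finset.range m, ((2 : ℝ) ^ k)⁻¹ := by gcongr
    _ ≤ 2 := by
      rw [h]
      have : 0 ≤ ((2 : ℝ) ^ m)⁻¹ := by positivity
      linarith

lemma norm_degreeTerm_le (hq2 : q ≠ 2) (hN : N < 4 * g) (hα : ‖α‖ ≤ 1 / (g : ℝ))
    (hβ : ‖β‖ ≤ 1 / (g : ℝ)) (hn : 1 ≤ n) (hng : n < g) :
    ‖degreeTerm q g N α β n‖ ≤ 12 * q ^ 5 * √(q : ℝ) ^ (3 * g) := by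
  have hq2' : (2 : ℝ) ≤ q := by exact_mod_cast (Fact.out : q.Prime).two_le
  have hP := abs_pairSum_le_of_lt hq2 hn hng
  have hterm : ∀ k l : ℕ, ‖(if (2 * k + 1) * n + (2 * l + 1) * n ≤ N then
      (pairSum q g n : ℂ) / ((q : ℂ) ^ ((((2 * k + 1) * n : ℕ) : ℂ) * (1 / 2 + α)) *
        (q : ℂ) ^ ((((2 * l + 1) * n : ℕ) : ℂ) * (1 / 2 + β)))
      else 0)‖ ≤ 3 * q ^ 5 * √(q : ℝ) ^ (3 * g) * (((q : ℝ) ^ k)⁻¹ * ((q : ℝ) ^ l)⁻¹) := by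
    intro k l
    split_ifs with h
    · have hW := norm_inv_weight_le (Fact.out : q.Prime).one_lt (by omega) hN h hα hβ
      rw [div_eq_mul_inv, norm_mul, Complex.norm_intCast]
      calc _ ≤ (3 * q * √(q : ℝ) ^ (3 * g) * (q : ℝ) ^ n) *
            ((q : ℝ) ^ 4 * ((q : ℝ) ^ (n * (k + l + 1)))⁻¹) := by gcongr
        _ = 3 * q ^ 5 * √(q : ℝ) ^ (3 * g) * ((q : ℝ) ^ (n * (k + l)))⁻¹ := by
            rw [mul_add n, mul_one, pow_add]
            field_simp
        _ ≤ 3 * q ^ 5 * √(q : ℝ) ^ (3 * g) * ((q : ℝ) ^ (k + l))⁻¹ := by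
            gcongr
            · linarith
            · exact Nat.le_mul_of_pos_left _ hn
        _ = _ := by rw [pow_add, mul_inv]
    · rw [norm_zero]; positivity
  calc _ ≤ ∑ k ∈ Finset.range (N + 1), ∑ l ∈ Finset.range (N + 1),
        3 * q ^ 5 * √(q : ℝ) ^ (3 * g) * (((q : ℝ) ^ k)⁻¹ * ((q : ℝ) ^ l)⁻¹) :=
        norm_sum_le_of_le _ fun k _ => norm_sum_le_of_le _ fun l _ => hterm k l
    _ = 3 * q ^ 5 * √(q : ℝ) ^ (3 * g) * ((∑ k ∈ Finset.range (N + 1), ((q : ℝ) ^ k)⁻¹) *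
        ∑ k ∈ Finset.range (N + 1), ((q : ℝ) ^ k)⁻¹) := by
        rw [Finset.sum_mul_sum, Finset.mul_sum]
        simp only [Finset.mul_sum]
    _ ≤ 3 * q ^ 5 * √(q : ℝ) ^ (3 * g) * (2 * 2) := by
        gcongr
        · exact sum_inv_pow_le_two hq2' _
        · exact sum_inv_pow_le_two hq2' _
    _ = _ := by ring

lemma degreeTerm_of_le (hN : N < 4 * g) (hgn : g ≤ n) :
    degreeTerm q g N α β n = if 2 * n ≤ N then
      (pairSum q g n : ℂ) * (((q : ℂ) ^ n)⁻¹ * (q : ℂ) ^ (-(n : ℂ) * (α + β))) else 0 := by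
  have hz : ∀ k l : ℕ, k ≠ 0 ∨ l ≠ 0 → ¬ (2 * k + 1) * n + (2 * l + 1) * n ≤ N := by
    intro k l hkl h
    have h1 : 4 * n ≤ (2 * k + 1) * n + (2 * l + 1) * n := by
      rw [← add_mul]
      exact Nat.mul_le_mul_right _ (by omega)
    omega
  rw [degreeTerm, Finset.sum_eq_single 0, Finset.sum_eq_single 0]
  · rw [← inv_weight_eq (Fact.out : q.Prime).ne_zero, ← div_eq_mul_inv]
    exact if_congr (by omega) rfl rfl
  · exact fun l _ hl => if_neg (hz 0 l (Or.inr hl))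
  · simp
  · exact fun k _ hk => Finset.sum_eq_zero fun l _ => if_neg (hz k l (Or.inl hk))
  · simp

lemma norm_inv_pow_mul_cpow_le (hg : 1 ≤ g) (hN : N < 4 * g) (hnN : 2 * n ≤ N)
    (hα : ‖α‖ ≤ 1 / (g : ℝ)) (hβ : ‖β‖ ≤ 1 / (g : ℝ)) :
    ‖((q : ℂ) ^ n)⁻¹ * (q : ℂ) ^ (-(n : ℂ) * (α + β))‖ ≤ (q : ℝ) ^ 4 * ((q : ℝ) ^ n)⁻¹ := by
  rw [← inv_weight_eq (Fact.out : q.Prime).ne_zero]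
  simpa using norm_inv_weight_le (Fact.out : q.Prime).one_lt hg hN (k := 0) (l := 0) (n := n)
    (by omega) hα hβ

lemma norm_degreeTerm_self_sub_le (hq2 : q ≠ 2) (hg : 1 ≤ g) (hN : N < 4 * g) (hgN : 2 * g ≤ N)
    (hα : ‖α‖ ≤ 1 / (g : ℝ)) (hβ : ‖β‖ ≤ 1 / (g : ℝ)) :
    ‖1 / ((q : ℂ) ^ (2 * g + 1) - (q : ℂ) ^ (2 * g)) * degreeTerm q g N α β g -
      (q : ℂ) ^ (-(g : ℂ) * (α + β)) / ((q : ℂ) - 1)‖ ≤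
      q ^ 4 * (5 + 2 * q) * g * (√(q : ℝ) ^ g)⁻¹ := by
  have hq2' : (2 : ℝ) ≤ q := by exact_mod_cast (Fact.out : q.Prime).two_le
  have hq0 : (q : ℂ) ≠ 0 := by exact_mod_cast (Fact.out : q.Prime).ne_zero
  have hq1 : (q : ℂ) - 1 ≠ 0 := by
    rw [sub_ne_zero]; exact_mod_cast (Fact.out : q.Prime).ne_one
  have hq1' : (0 : ℝ) < q - 1 := by linarith
  have hv0 : 0 < √(q : ℝ) := Real.sqrt_pos.2 (by linarith)
  have hv2 : √(q : ℝ) ^ 2 = q := Real.sq_sqrt (by positivity)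
  have hW := norm_inv_pow_mul_cpow_le (q := q) hg hN hgN hα hβ
  have hP := abs_pairSum_self_sub_le hq2 hg
  rw [degreeTerm_of_le hN le_rfl, if_pos hgN]
  set W := ((q : ℂ) ^ g)⁻¹ * (q : ℂ) ^ (-(g : ℂ) * (α + β)) with hWdef
  have hcp : (q : ℂ) ^ (-(g : ℂ) * (α + β)) = (q : ℂ) ^ g * W := by
    rw [hWdef, mul_inv_cancel_left₀ (pow_ne_zero _ hq0)]
  have hid : 1 / ((q : ℂ) ^ (2 * g + 1) - (q : ℂ) ^ (2 * g)) * (pairSum q g g * W) -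
      (q : ℂ) ^ (-(g : ℂ) * (α + β)) / ((q : ℂ) - 1) =
      (((pairSum q g g : ℝ) - (q : ℝ) ^ (3 * g) : ℝ) : ℂ) * W *
        ((((q : ℝ) ^ (2 * g) * (q - 1) : ℝ)) : ℂ)⁻¹ := by
    rw [hcp]
    push_cast
    rw [show (q : ℂ) ^ (2 * g + 1) - (q : ℂ) ^ (2 * g) = (q : ℂ) ^ (2 * g) * (q - 1) by ring]
    field_simp
    ring
  have hQ : (q : ℝ) ^ (2 * g) ≤ (q : ℝ) ^ (2 * g) * (q - 1) :=
    le_mul_of_one_le_right (by positivity) (by linarith)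
  rw [hid, norm_mul, norm_mul, norm_inv, Complex.norm_real, Complex.norm_real, Real.norm_eq_abs,
    Real.norm_of_nonneg (mul_nonneg (by positivity) (by linarith))]
  calc _ ≤ ((5 + 2 * q) * g * √(q : ℝ) ^ (5 * g)) * ((q : ℝ) ^ 4 * ((q : ℝ) ^ g)⁻¹) *
        ((q : ℝ) ^ (2 * g))⁻¹ := by gcongr
    _ = q ^ 4 * (5 + 2 * q) * g * (√(q : ℝ) ^ (5 * g) * ((q : ℝ) ^ g)⁻¹ *
        ((q : ℝ) ^ (2 * g))⁻¹) := by ring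
    _ = _ := by
      congr 1
      rw [show (q : ℝ) ^ g = √(q : ℝ) ^ (2 * g) by rw [pow_mul, hv2],
        show (q : ℝ) ^ (2 * g) = √(q : ℝ) ^ (4 * g) by
          rw [show 4 * g = 2 * (2 * g) by ring, pow_mul (√(q : ℝ)), hv2]]
      field_simp
      ring

lemma norm_degreeTerm_add_le (hq2 : q ≠ 2) (hg : 1 ≤ g) (hN : N < 4 * g) (hgn : g < n)
    (hnN : 2 * n ≤ N) (hα : ‖α‖ ≤ 1 / (g : ℝ)) (hβ : ‖β‖ ≤ 1 / (g : ℝ)) :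
    ‖1 / ((q : ℂ) ^ (2 * g + 1) - (q : ℂ) ^ (2 * g)) * degreeTerm q g N α β n +
      (q : ℂ) ^ (-(n : ℂ) * (α + β))‖ ≤
      1160 * q ^ 5 * n ^ 2 * ((q : ℝ) ^ n * ((q : ℝ) ^ (2 * g))⁻¹) +
        5 * q ^ 4 * n * (√(q : ℝ) ^ n)⁻¹ := by
  have hq2' : (2 : ℝ) ≤ q := by exact_mod_cast (Fact.out : q.Prime).two_le
  have hq0 : (q : ℂ) ≠ 0 := by exact_mod_cast (Fact.out : q.Prime).ne_zero
  have hq1 : (q : ℂ) - 1 ≠ 0 := by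
    rw [sub_ne_zero]; exact_mod_cast (Fact.out : q.Prime).ne_one
  have hq1' : (0 : ℝ) < q - 1 := by linarith
  have hv0 : 0 < √(q : ℝ) := Real.sqrt_pos.2 (by linarith)
  have hv2 : √(q : ℝ) ^ 2 = q := Real.sq_sqrt (by positivity)
  have hW := norm_inv_pow_mul_cpow_le (q := q) hg hN hnN hα hβ
  have hP := abs_pairSum_add_le hq2 hg hgn (by omega)
  rw [degreeTerm_of_le hN hgn.le, if_pos hnN]
  set W := ((q : ℂ) ^ n)⁻¹ * (q : ℂ) ^ (-(n : ℂ) * (α + β)) with hWdef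
  have hcp : (q : ℂ) ^ (-(n : ℂ) * (α + β)) = (q : ℂ) ^ n * W := by
    rw [hWdef, mul_inv_cancel_left₀ (pow_ne_zero _ hq0)]
  have hid : 1 / ((q : ℂ) ^ (2 * g + 1) - (q : ℂ) ^ (2 * g)) * (pairSum q g n * W) +
      (q : ℂ) ^ (-(n : ℂ) * (α + β)) =
      (((pairSum q g n : ℝ) + (q : ℝ) ^ (2 * g) * (q - 1) * (q : ℝ) ^ n : ℝ) : ℂ) * W *
        ((((q : ℝ) ^ (2 * g) * (q - 1) : ℝ)) : ℂ)⁻¹ := by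
    rw [hcp]
    push_cast
    rw [show (q : ℂ) ^ (2 * g + 1) - (q : ℂ) ^ (2 * g) = (q : ℂ) ^ (2 * g) * (q - 1) by ring]
    field_simp
  have hQ : (q : ℝ) ^ (2 * g) ≤ (q : ℝ) ^ (2 * g) * (q - 1) :=
    le_mul_of_one_le_right (by positivity) (by linarith)
  rw [hid, norm_mul, norm_mul, norm_inv, Complex.norm_real, Complex.norm_real, Real.norm_eq_abs,
    Real.norm_of_nonneg (mul_nonneg (by positivity) (by linarith))]
  calc _ ≤ (1160 * q * n ^ 2 * (q : ℝ) ^ (2 * n) +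
        (q : ℝ) ^ (2 * g) * (q - 1) * (5 * n * √(q : ℝ) ^ n)) * ((q : ℝ) ^ 4 * ((q : ℝ) ^ n)⁻¹) *
        ((q : ℝ) ^ (2 * g) * (q - 1))⁻¹ := by gcongr
    _ = 1160 * q ^ 5 * n ^ 2 * ((q : ℝ) ^ n * ((q : ℝ) ^ (2 * g) * (q - 1))⁻¹) +
        5 * q ^ 4 * n * (√(q : ℝ) ^ n * ((q : ℝ) ^ n)⁻¹) := by
        rw [two_mul n, pow_add (q : ℝ) n n]
        field_simp
    _ ≤ 1160 * q ^ 5 * n ^ 2 * ((q : ℝ) ^ n * ((q : ℝ) ^ (2 * g))⁻¹) +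
        5 * q ^ 4 * n * (√(q : ℝ) ^ n * ((q : ℝ) ^ n)⁻¹) := by gcongr
    _ = _ := by
      congr 2
      rw [show (q : ℝ) ^ n = √(q : ℝ) ^ (2 * n) by rw [pow_mul, hv2], two_mul, pow_add]
      field_simp

end DegreeContributions

section Assembly

lemma sum_pow_le_two_mul_pow {x : ℝ} (hx : 2 ≤ x) (m : ℕ) :
    ∑ k ∈ Finset.range (m + 1), x ^ k ≤ 2 * x ^ m := by
  induction m with
  | zero => norm_num
  | succ m ih =>
    rw [Finset.sum_range_succ, pow_succ]
    have : 0 ≤ x ^ m := by positivity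
    nlinarith

lemma sum_Icc_inv_pow_le {x : ℝ} (hx : 2 ≤ x) (a b : ℕ) :
    ∑ k ∈ Finset.Icc (a + 1) b, (x ^ k)⁻¹ ≤ 2 * (x ^ a)⁻¹ := by
  have h1 : Finset.Icc (a + 1) b = Finset.Ico (a + 1) (b + 1) := by
    ext k; simp only [Finset.mem_Icc, Finset.mem_Ico]; omega
  rw [h1, Finset.sum_Ico_eq_sum_range]
  calc _ = ∑ i ∈ Finset.range (b + 1 - (a + 1)), (x ^ (a + 1))⁻¹ * (x ^ i)⁻¹ := by
        refine Finset.sum_congr rfl fun i _ => ?_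
        rw [pow_add, mul_inv]
    _ ≤ (x ^ (a + 1))⁻¹ * 2 := by
        rw [← Finset.mul_sum]
        gcongr
        exact sum_inv_pow_le_two hx _
    _ ≤ (x ^ a)⁻¹ * 2 := by
        gcongr
        · linarith
        · omega
    _ = _ := mul_comm _ _

lemma norm_sum_degreeTerm_sub_le {q : ℕ} [Fact q.Prime] (hq5 : 5 ≤ q) {g N : ℕ} {α β : ℂ}
    (hg : 1 ≤ g) (hN : N < 4 * g) (hα : ‖α‖ ≤ 1 / (g : ℝ)) (hβ : ‖β‖ ≤ 1 / (g : ℝ)) :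
    ‖(1 / ((q : ℂ) ^ (2 * g + 1) - (q : ℂ) ^ (2 * g))) *
        (∑ n ∈ Finset.Icc 1 N, degreeTerm q g N α β n) -
      (-(∑ n ∈ Finset.Icc (g + 1) (N / 2), (q : ℂ) ^ (-(n : ℂ) * (α + β))) +
        if 2 * g ≤ N then (q : ℂ) ^ (-(g : ℂ) * (α + β)) / ((q : ℂ) - 1) else 0)‖ ≤
      2400 * q ^ 5 * ((N : ℝ) ^ 2 * ((q : ℝ) ^ (N / 2) * ((q : ℝ) ^ (2 * g))⁻¹) +
        g * (√(q : ℝ) ^ g)⁻¹) := by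
  have hq2 : q ≠ 2 := by omega
  have hq5' : (5 : ℝ) ≤ q := by exact_mod_cast hq5
  have hv : 2 ≤ √(q : ℝ) := Real.le_sqrt_of_sq_le (by linarith)
  have hv2 : √(q : ℝ) ^ 2 = q := Real.sq_sqrt (by positivity)
  set v := √(q : ℝ) with hvdef
  set R : ℂ := 1 / ((q : ℂ) ^ (2 * g + 1) - (q : ℂ) ^ (2 * g)) with hR
  have hRn : ‖R‖ ≤ ((q : ℝ) ^ (2 * g))⁻¹ := by
    have h : (q : ℂ) ^ (2 * g + 1) - (q : ℂ) ^ (2 * g) =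
        (((q : ℝ) ^ (2 * g) * (q - 1) : ℝ) : ℂ) := by
      push_cast; ring
    rw [hR, h, one_div, norm_inv, Complex.norm_real, Real.norm_of_nonneg
      (mul_nonneg (by positivity) (by linarith))]
    gcongr
    exact le_mul_of_one_le_right (by positivity) (by linarith)
  set main : ℕ → ℂ := fun n =>
    -(if g < n ∧ 2 * n ≤ N then (q : ℂ) ^ (-(n : ℂ) * (α + β)) else 0) +
    if n = g then (if 2 * g ≤ N then (q : ℂ) ^ (-(g : ℂ) * (α + β)) / ((q : ℂ) - 1) else 0)
      else 0 with hmain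
  have hfilter : (Finset.Icc 1 N).filter (fun n => g < n ∧ 2 * n ≤ N) =
      Finset.Icc (g + 1) (N / 2) := by
    ext n
    simp only [Finset.mem_filter, Finset.mem_Icc]
    omega
  have hmainsum : ∑ n ∈ Finset.Icc 1 N, main n =
      -(∑ n ∈ Finset.Icc (g + 1) (N / 2), (q : ℂ) ^ (-(n : ℂ) * (α + β))) +
        if 2 * g ≤ N then (q : ℂ) ^ (-(g : ℂ) * (α + β)) / ((q : ℂ) - 1) else 0 := by
    rw [hmain, Finset.sum_add_distrib, Finset.sum_neg_distrib, ← Finset.sum_filter, hfilter,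
      Finset.sum_ite_eq']
    congr 1
    split_ifs with h1 h2 h2
    · rfl
    · rfl
    · exact absurd (Finset.mem_Icc.2 ⟨hg, by omega⟩) h1
    · rfl
  rw [← hmainsum, Finset.mul_sum, ← Finset.sum_sub_distrib]
  have hterm : ∀ n ∈ Finset.Icc 1 N, ‖R * degreeTerm q g N α β n - main n‖ ≤
      (if n < g then 12 * q ^ 5 * (v ^ g)⁻¹ else 0) +
      (if n = g then q ^ 4 * (5 + 2 * q) * g * (v ^ g)⁻¹ else 0) +
      (if g < n ∧ 2 * n ≤ N then 1160 * q ^ 5 * N ^ 2 * ((q : ℝ) ^ n * ((q : ℝ) ^ (2 * g))⁻¹) +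
        10 * q ^ 4 * g * (v ^ n)⁻¹ else 0) := by
    intro n hn
    rw [Finset.mem_Icc] at hn
    rcases lt_trichotomy n g with h | h | h
    · simp only [hmain]
      rw [if_neg (by omega), if_neg (by omega), if_pos h, if_neg (by omega), if_neg (by omega),
        neg_zero, add_zero, sub_zero, add_zero, add_zero, norm_mul]
      calc _ ≤ ((q : ℝ) ^ (2 * g))⁻¹ * (12 * q ^ 5 * v ^ (3 * g)) :=
            mul_le_mul hRn (norm_degreeTerm_le hq2 hN hα hβ hn.1 h) (norm_nonneg _) (by positivity)
        _ = _ := by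
            rw [show (q : ℝ) ^ (2 * g) = v ^ (4 * g) by
              rw [show 4 * g = 2 * (2 * g) by ring, pow_mul v, hv2]]
            field_simp
            ring
    · subst h
      simp only [hmain, lt_irrefl, false_and, if_false, if_true, neg_zero, zero_add, add_zero]
      split_ifs with hgN
      · exact norm_degreeTerm_self_sub_le hq2 hg hN hgN hα hβ
      · rw [degreeTerm_of_le hN le_rfl, if_neg hgN, mul_zero, sub_zero, norm_zero]
        positivity
    · simp only [hmain]
      simp only [h.ne', show ¬ n < g by omega, if_false, add_zero, zero_add]
      by_cases hnN : 2 * n ≤ N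
      · rw [if_pos ⟨h, hnN⟩, if_pos ⟨h, hnN⟩, sub_neg_eq_add]
        refine (norm_degreeTerm_add_le hq2 hg hN h hnN hα hβ).trans ?_
        have h1 : (n : ℝ) ≤ N := by exact_mod_cast hn.2
        have h2 : (n : ℝ) ≤ 2 * g := by exact_mod_cast (by omega : n ≤ 2 * g)
        calc _ ≤ 1160 * q ^ 5 * (N : ℝ) ^ 2 * ((q : ℝ) ^ n * ((q : ℝ) ^ (2 * g))⁻¹) +
              5 * q ^ 4 * (2 * g) * (v ^ n)⁻¹ := by gcongr
          _ = _ := by ring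
      · rw [if_neg (fun h => hnN h.2), if_neg (fun h => hnN h.2), degreeTerm_of_le hN h.le,
          if_neg hnN]
        simp
  refine (norm_sum_le_of_le _ hterm).trans ?_
  rw [Finset.sum_add_distrib, Finset.sum_add_distrib]
  have s1 : ∑ n ∈ Finset.Icc 1 N, (if n < g then 12 * q ^ 5 * (v ^ g)⁻¹ else 0) ≤
      g * (12 * q ^ 5 * (v ^ g)⁻¹) := by
    rw [← Finset.sum_filter, Finset.sum_const, nsmul_eq_mul]
    have hc : ((Finset.Icc 1 N).filter (fun n => n < g)).card ≤ g := by
      refine (Finset.card_le_card (t := Finset.range g) fun n hn => ?_).trans_eq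
        (Finset.card_range g)
      exact Finset.mem_range.2 (Finset.mem_filter.1 hn).2
    gcongr
  have s2 : ∑ n ∈ Finset.Icc 1 N, (if n = g then q ^ 4 * (5 + 2 * q) * g * (v ^ g)⁻¹ else 0) ≤
      q ^ 4 * (5 + 2 * q) * g * (v ^ g)⁻¹ := by
    rw [Finset.sum_ite_eq']
    split_ifs
    · exact le_rfl
    · positivity
  have s3 : ∑ n ∈ Finset.Icc 1 N, (if g < n ∧ 2 * n ≤ N then
      1160 * q ^ 5 * N ^ 2 * ((q : ℝ) ^ n * ((q : ℝ) ^ (2 * g))⁻¹) +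
        10 * q ^ 4 * g * (v ^ n)⁻¹ else 0) ≤
      1160 * q ^ 5 * N ^ 2 * ((2 * (q : ℝ) ^ (N / 2)) * ((q : ℝ) ^ (2 * g))⁻¹) +
        10 * q ^ 4 * g * (2 * (v ^ g)⁻¹) := by
    rw [← Finset.sum_filter, hfilter, Finset.sum_add_distrib, ← Finset.mul_sum, ← Finset.mul_sum,
      ← Finset.sum_mul]
    have hq : ∑ n ∈ Finset.Icc (g + 1) (N / 2), (q : ℝ) ^ n ≤ 2 * (q : ℝ) ^ (N / 2) := by
      refine (Finset.sum_le_sum_of_subset_of_nonneg (t := Finset.range (N / 2 + 1)) ?_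
        fun _ _ _ => by positivity).trans (sum_pow_le_two_mul_pow (by linarith) _)
      intro n hn
      rw [Finset.mem_Icc] at hn
      rw [Finset.mem_range]
      omega
    gcongr
    exact sum_Icc_inv_pow_le hv _ _
  refine (add_le_add (add_le_add s1 s2) s3).trans ?_
  set A := (N : ℝ) ^ 2 * ((q : ℝ) ^ (N / 2) * ((q : ℝ) ^ (2 * g))⁻¹) with hA
  set B := (g : ℝ) * (v ^ g)⁻¹ with hB
  have hA0 : 0 ≤ (q : ℝ) ^ 5 * A := by positivity
  have hB0 : 0 ≤ (q : ℝ) ^ 5 * B := by positivity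
  have hq4 : (q : ℝ) ^ 4 * B ≤ (q : ℝ) ^ 5 * B := by
    gcongr
    · linarith
    · norm_num
  calc _ = 2320 * (q ^ 5 * A) + 14 * (q ^ 5 * B) + 25 * (q ^ 4 * B) := by rw [hA, hB]; ring
    _ ≤ 2400 * (q ^ 5 * A) + 2400 * (q ^ 5 * B) := by linarith
    _ = _ := by ring

end Assembly

/-- the equal-degree odd-odd contribution `I_{2,=}^{oo}` to the two
level density: there is `C(q)` such that for `1 ≤ g`, `1 ≤ N < 4g` and
`|α|, |β| ≤ 1/g`,
`I_{2,=}^{oo}(N;α,β) = -∑_{g<n≤⌊N/2⌋} q^{-n(α+β)} + 1_{N≥2g} q^{-g(α+β)}/(q-1)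
  + O(N² q^{N/2-2g} + g q^{-g/2})`. -/
theorem statement17 (q : ℕ) [Fact q.Prime] (hq4 : q % 4 = 1) :
    ∃ C : ℝ, 0 < C ∧ ∀ g N : ℕ, 1 ≤ g → 1 ≤ N → N < 4 * g →
      ∀ α β : ℂ, ‖α‖ ≤ 1 / (g : ℝ) → ‖β‖ ≤ 1 / (g : ℝ) →
      ‖(1 / ((q : ℂ) ^ (2 * g + 1) - (q : ℂ) ^ (2 * g))) *
            sumH q g (fun D =>
              ∑' x : Polynomial (ZMod q) × Polynomial (ZMod q) × ℕ × ℕ,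
                if x.1.Monic ∧ Irreducible x.1 ∧ x.2.1.Monic ∧ Irreducible x.2.1 ∧
                    x.1 ≠ x.2.1 ∧ x.1.natDegree = x.2.1.natDegree ∧
                    (2 * x.2.2.1 + 1) * x.1.natDegree + (2 * x.2.2.2 + 1) * x.2.1.natDegree ≤ N
                then
                  (x.1.natDegree : ℂ) ^ 2 *
                    (jacSym q D (x.1 ^ (2 * x.2.2.1 + 1) * x.2.1 ^ (2 * x.2.2.2 + 1)) : ℂ) /
                    ((q : ℂ) ^ ((((2 * x.2.2.1 + 1) * x.1.natDegree : ℕ) : ℂ) * (1 / 2 + α)) *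
                      (q : ℂ) ^ ((((2 * x.2.2.2 + 1) * x.2.1.natDegree : ℕ) : ℂ) * (1 / 2 + β)))
                else 0)
          - (-(∑ n ∈ Finset.Icc (g + 1) (N / 2), (q : ℂ) ^ (-(n : ℂ) * (α + β)))
              + if 2 * g ≤ N then (q : ℂ) ^ (-(g : ℂ) * (α + β)) / ((q : ℂ) - 1) else 0)‖
        ≤ C * ((N : ℝ) ^ 2 * (q : ℝ) ^ ((N : ℝ) / 2 - 2 * g)
            + (g : ℝ) * (q : ℝ) ^ (-(g : ℝ) / 2)) := by
  have hp := (Fact.out : q.Prime)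
  have hq2 : q ≠ 2 := by omega
  have hq5 : 5 ≤ q := by
    have := hp.two_le
    omega
  have hq1R : (1 : ℝ) ≤ q := by exact_mod_cast hp.one_le
  refine ⟨2400 * (q : ℝ) ^ 5, by positivity, ?_⟩
  intro g N hg _ hN α β hα hβ
  rw [sumH_tsum_eq]
  refine (norm_sum_degreeTerm_sub_le hq5 hg hN hα hβ).trans ?_
  have e1 : (√(q : ℝ) ^ g)⁻¹ = (q : ℝ) ^ (-(g : ℝ) / 2) := by
    rw [Real.sqrt_eq_rpow, ← Real.rpow_mul_natCast (by positivity), ← Real.rpow_neg (by positivity)]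
    congr 1
    ring
  have e2 : (q : ℝ) ^ (N / 2) * ((q : ℝ) ^ (2 * g))⁻¹ ≤ (q : ℝ) ^ ((N : ℝ) / 2 - 2 * g) := by
    rw [← Real.rpow_natCast, ← Real.rpow_natCast, ← Real.rpow_neg (by positivity),
      ← Real.rpow_add (by positivity)]
    refine Real.rpow_le_rpow_of_exponent_le hq1R ?_
    have : ((N / 2 : ℕ) : ℝ) ≤ (N : ℝ) / 2 := Nat.cast_div_le
    push_cast
    linarith
  rw [e1]
  gcongr
end
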